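/- Let F ∈ ℤ[x,y,z] be a non-singular homogeneous form of degree k ≥ 5 and let 0 ≤ γ ≤ k−2 with τ = k−γ. If either 5 ≤ k ≤ 9 and τ > 9/2, or k > 9 and τ > (3/2)·√k, then N*_γ(F,B) = o(B) as B → ∞. -/

import Mathlib

open MvPolynomial

/-- The one-variable polynomial `t ↦ F(p + t v)` restricted to a line, over `ℂ`;
its root multiplicity at `t = 0` is the order of contact of the line with `C_F` at `p`. -/
noncomputable def contactOrder (F : MvPolynomial (Fin 3) ℤ) (p v : Fin 3 → ℂ) : ℕ :=
  Polynomial.rootMultiplicity 0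
    (MvPolynomial.aeval (fun i => Polynomial.C (p i) + Polynomial.C (v i) * Polynomial.X) F)

/-- `p` is an inflection point of `C_F` with tangent direction `v`. -/
def IsInflTangent (F : MvPolynomial (Fin 3) ℤ) (p v : Fin 3 → ℂ) : Prop :=
  p ≠ 0 ∧ MvPolynomial.aeval p F = 0 ∧ (∀ c : ℂ, v ≠ c • p) ∧
    (∑ i, v i * MvPolynomial.aeval p (MvPolynomial.pderiv i F)) = 0 ∧
    3 ≤ contactOrder F p v

/-- The integer point `x` lies on a tangent line of `C_F` at an inflection point,
viewed as a two-dimensional linear subspace of `ℂ³`. -/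
def OnInflTangent (F : MvPolynomial (Fin 3) ℤ) (x : Fin 3 → ℤ) : Prop :=
  ∃ p v : Fin 3 → ℂ, IsInflTangent F p v ∧
    (fun i => (x i : ℂ)) ∈ Submodule.span ℂ ({p, v} : Set (Fin 3 → ℂ))

/-- `x` is a primitive triple counted by `N_γ(F,B)`. -/
def Counted (F : MvPolynomial (Fin 3) ℤ) (γ B : ℝ) (x : Fin 3 → ℤ) : Prop :=
  Int.gcd (x 0) (Int.gcd (x 1) (x 2)) = 1 ∧
    ((|MvPolynomial.eval x F| : ℤ) : ℝ) ≤ B ^ γ ∧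
    B / 2 < max |(x 0 : ℝ)| (max |(x 1 : ℝ)| |(x 2 : ℝ)|) ∧
    max |(x 0 : ℝ)| (max |(x 1 : ℝ)| |(x 2 : ℝ)|) ≤ B

section Wronskian

variable {R ι : Type*} [CommRing R] [Algebra ℚ R]

/-- The differential operator attached to a word in the given derivations. -/
def wordOp (D : ι → Derivation ℚ R R) : List ι → R → R
  | [], f => f
  | i :: w, f => D i (wordOp D w f)

theorem exists_constant_relation (D : ι → Derivation ℚ R R) (d : R → ℕ)
    (hd : ∀ i c, D i c ≠ 0 → d (D i c) < d c) (hd0 : d 0 = 0)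
    (hconst : ∀ c, (∀ i, D i c = 0) → c ∈ Set.range (algebraMap ℚ R))
    {k : ℕ} (N : Set (Fin k → R)) (hN : ∀ c ∈ N, ∀ i, (fun j => D i (c j)) ∈ N)
    (hne : ∃ c ∈ N, c ≠ 0) :
    ∃ c ∈ N, c ≠ 0 ∧ ∃ a : Fin k → ℚ, ∀ j, c j = algebraMap ℚ R (a j) := by
  classical
  obtain ⟨c, ⟨hcN, hc0⟩, hmin⟩ := exists_minimalFor_of_wellFoundedLT
    (fun c : Fin k → R => c ∈ N ∧ c ≠ 0) (fun c => ∑ j, d (c j)) hne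
  refine ⟨c, hcN, hc0, ?_⟩
  have key : ∀ i j, D i (c j) = 0 := by
    intro i
    by_contra! hij
    obtain ⟨j, hj⟩ := hij
    have h1 : (fun j => D i (c j)) ≠ 0 := fun h => hj (congrFun h j)
    have hle : ∀ j, d (D i (c j)) ≤ d (c j) := by
      intro j
      by_cases h : D i (c j) = 0
      · rw [h, hd0]; exact Nat.zero_le _
      · exact (hd i _ h).le
    have hlt : ∑ j, d (D i (c j)) < ∑ j, d (c j) :=
      Finset.sum_lt_sum (fun j _ => hle j) ⟨j, Finset.mem_univ _, hd i _ hj⟩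
    have := hmin (j := fun j => D i (c j)) ⟨hN c hcN i, h1⟩ hlt.le
    exact absurd hlt (not_lt.mpr this)
  choose a ha using fun j => hconst (c j) (fun i => key i j)
  exact ⟨a, fun j => (ha j).symm⟩

theorem exists_wronskian_ne_zero [IsDomain R] (D : ι → Derivation ℚ R R) (d : R → ℕ)
    (hd : ∀ i c, D i c ≠ 0 → d (D i c) < d c) (hd0 : d 0 = 0)
    (hconst : ∀ c, (∀ i, D i c = 0) → c ∈ Set.range (algebraMap ℚ R))
    {k : ℕ} (φ : Fin k → R) (hφ : LinearIndependent ℚ φ) :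
    ∃ w : Fin k → List ι, (∀ i, (w i).length ≤ k - 1) ∧
      (Matrix.of fun i j => wordOp D (w i) (φ j)).det ≠ 0 := by
  classical
  rcases Nat.eq_zero_or_pos k with rfl | hk
  · exact ⟨fun _ => [], fun i => i.elim0, by simp⟩
  let K := FractionRing R
  let v : List ι → Fin k → K := fun w j => algebraMap R K (wordOp D w (φ j))
  let V : ℕ → Submodule K (Fin k → K) := fun s => Submodule.span K (v '' {w | w.length ≤ s})
  have hmono : ∀ s, V s ≤ V (s + 1) := fun s =>
    Submodule.span_mono (Set.image_mono fun w hw => Nat.le_succ_of_le hw)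
  have hinj : Function.Injective (algebraMap R K) := IsFractionRing.injective R K
  have hstab : ∀ s, V s = V (s + 1) → V s = ⊤ := by
    intro s hs
    by_contra htop
    obtain ⟨f, hf0, hfV⟩ := Submodule.exists_le_ker_of_lt_top (V s) (lt_top_iff_ne_top.mpr htop)
    let N : Set (Fin k → R) := {c | ∀ w : List ι, w.length ≤ s → ∑ j, c j * wordOp D w (φ j) = 0}
    have hNs : ∀ c ∈ N, ∀ w : List ι, w.length ≤ s + 1 → ∑ j, c j * wordOp D w (φ j) = 0 := by
      intro c hc w hw
      let g : (Fin k → K) →ₗ[K] K := ∑ j, (algebraMap R K (c j)) • LinearMap.proj j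
      have hgv : ∀ w, g (v w) = algebraMap R K (∑ j, c j * wordOp D w (φ j)) := by
        intro w
        simp only [g, v, map_sum, map_mul, LinearMap.sum_apply, LinearMap.smul_apply,
          LinearMap.proj_apply, smul_eq_mul]
      have hle : V s ≤ LinearMap.ker g := by
        apply Submodule.span_le.mpr
        rintro _ ⟨w, hw, rfl⟩
        simp only [SetLike.mem_coe, LinearMap.mem_ker]
        rw [hgv, hc w hw, map_zero]
      have : v w ∈ LinearMap.ker g := by
        apply hle
        rw [hs]
        exact Submodule.subset_span ⟨w, hw, rfl⟩
      rw [LinearMap.mem_ker, hgv] at this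
      exact hinj (by rw [this, map_zero])
    have hNstab : ∀ c ∈ N, ∀ i, (fun j => D i (c j)) ∈ N := by
      intro c hc i w hw
      have h1 := congrArg (D i) (hc w hw)
      have h2 := hNs c hc (i :: w) (by simpa using hw)
      simp only [map_sum, Derivation.leibniz, smul_eq_mul, map_zero,
        Finset.sum_add_distrib] at h1
      simp only [wordOp] at h2
      rw [h2, zero_add] at h1
      rw [← h1]
      exact Finset.sum_congr rfl fun j _ => mul_comm _ _
    have hNne : ∃ c ∈ N, c ≠ 0 := by
      obtain ⟨b, hb⟩ := IsLocalization.exist_integer_multiples_of_finite (nonZeroDivisors R)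
        (fun j : Fin k => f (Pi.single j 1))
      choose c hc using hb
      have hb0 : algebraMap R K b ≠ 0 := by
        rw [Ne, FaithfulSMul.algebraMap_eq_zero_iff]
        exact nonZeroDivisors.ne_zero b.2
      have hfx : ∀ x : Fin k → K, f x = ∑ j, x j * f (Pi.single j 1) := by
        intro x
        conv_lhs => rw [← Finset.univ_sum_single x]
        rw [map_sum]
        refine Finset.sum_congr rfl fun j _ => ?_
        rw [← smul_eq_mul, ← map_smul, ← Pi.single_smul, smul_eq_mul, mul_one]
      have hcb : ∀ j, algebraMap R K (c j) = algebraMap R K b * f (Pi.single j 1) := by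
        intro j; rw [hc j, Algebra.smul_def]
      refine ⟨c, ?_, ?_⟩
      · intro w hw
        apply hinj
        rw [map_zero, map_sum]
        have : f (v w) = 0 := hfV (Submodule.subset_span ⟨w, hw, rfl⟩)
        rw [hfx] at this
        calc ∑ j, algebraMap R K (c j * wordOp D w (φ j))
            = algebraMap R K b * ∑ j, v w j * f (Pi.single j 1) := by
              rw [Finset.mul_sum]
              refine Finset.sum_congr rfl fun j _ => ?_
              rw [map_mul, hcb]; simp only [v]; ring
          _ = 0 := by rw [this, mul_zero]
      · intro h0
        apply hf0
        ext x
        simp only [LinearMap.comp_apply, LinearMap.zero_apply, LinearMap.single_apply]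
        have := hcb x
        rw [h0] at this
        simp only [Pi.zero_apply, map_zero] at this
        exact (mul_eq_zero.mp this.symm).resolve_left hb0
    obtain ⟨c, hcN, hc0, a, ha⟩ := exists_constant_relation D d hd hd0 hconst N hNstab hNne
    apply hc0
    have h0 := hcN [] (Nat.zero_le _)
    simp only [wordOp, ha, ← Algebra.smul_def] at h0
    have := Fintype.linearIndependent_iff.mp hφ a h0
    ext j
    rw [ha j, this j, map_zero]; rfl
  have hrank : ∀ s, s < k → s + 1 ≤ Module.finrank K (V s) := by
    intro s
    induction s with
    | zero =>
      intro _
      have hne : V 0 ≠ ⊥ := by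
        intro hbot
        have h1 : v [] ∈ V 0 := Submodule.subset_span ⟨[], by simp, rfl⟩
        rw [hbot, Submodule.mem_bot] at h1
        have h2 := congrFun h1 ⟨0, hk⟩
        simp only [v, wordOp, Pi.zero_apply] at h2
        exact hφ.ne_zero ⟨0, hk⟩ (hinj (by rw [h2, map_zero]))
      have := Submodule.one_le_finrank_iff.mpr hne
      simpa using this
    | succ s ih =>
      intro hs
      have ih' := ih (by omega)
      by_cases h : V s = V (s + 1)
      · have htop := hstab s h
        rw [← h, htop, finrank_top, Module.finrank_fin_fun]
        omega
      · have := Submodule.finrank_lt_finrank_of_lt (lt_of_le_of_ne (hmono s) h)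
        omega
  have htop : V (k - 1) = ⊤ := by
    apply Submodule.eq_top_of_finrank_eq
    rw [Module.finrank_fin_fun]
    have h1 := hrank (k - 1) (by omega)
    have h2 := Submodule.finrank_le (V (k - 1))
    rw [Module.finrank_fin_fun] at h2
    omega
  obtain ⟨b, hbsub, hbspan, hbli⟩ := exists_linearIndependent K (v '' {w | w.length ≤ k - 1})
  have hbtop : Submodule.span K (Set.range ((↑) : b → Fin k → K)) = ⊤ := by
    rw [Subtype.range_coe, hbspan]; exact htop
  let B : Module.Basis b K (Fin k → K) := Module.Basis.mk hbli hbtop.ge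
  have : Fintype b := FiniteDimensional.fintypeBasisIndex B
  have hcard : Fintype.card b = Fintype.card (Fin k) := by
    rw [← Module.finrank_eq_card_basis B, Module.finrank_fin_fun, Fintype.card_fin]
  let e : Fin k ≃ b := (Fintype.equivOfCardEq hcard).symm
  choose w hw using fun i => hbsub (e i).2
  refine ⟨w, fun i => (hw i).1, ?_⟩
  have hli : LinearIndependent K (fun i => v (w i)) := by
    have : (fun i => v (w i)) = (fun i : Fin k => ((e i : b) : Fin k → K)) := by
      ext1 i; exact (hw i).2
    rw [this]
    exact hbli.comp e e.injective
  have hunit := (Matrix.linearIndependent_rows_iff_isUnit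
    (A := (Matrix.of fun i j => v (w i) j))).mp hli
  intro hdet
  rw [Matrix.isUnit_iff_isUnit_det] at hunit
  apply hunit.ne_zero
  have : (Matrix.of fun i j => v (w i) j) =
      (algebraMap R K).mapMatrix (Matrix.of fun i j => wordOp D (w i) (φ j)) := by
    ext i j; rfl
  rw [this, ← RingHom.map_det, hdet, map_zero]

end Wronskian

section Hasse

variable {σ R : Type*} [Fintype σ] [CommRing R]

/-- The product of the binomial coefficients `J i` choose `I i`. -/
def multiChoose (J I : σ →₀ ℕ) : ℕ := ∏ i, (J i).choose (I i)

theorem multiChoose_eq_zero {J I : σ →₀ ℕ} (h : ¬ I ≤ J) : multiChoose J I = 0 := by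
  rw [Finsupp.le_def] at h
  push Not at h
  obtain ⟨i, hi⟩ := h
  exact Finset.prod_eq_zero (Finset.mem_univ i) (Nat.choose_eq_zero_of_lt hi)

/-- The multivariate Hasse derivative. -/
noncomputable def hasse (I : σ →₀ ℕ) (P : MvPolynomial σ R) : MvPolynomial σ R :=
  ∑ J ∈ P.support, monomial (J - I) (multiChoose J I * coeff J P)

theorem coeff_hasse (I K : σ →₀ ℕ) (P : MvPolynomial σ R) :
    coeff K (hasse I P) = multiChoose (K + I) I * coeff (K + I) P := by
  classical
  rw [hasse, coeff_sum]
  simp only [coeff_monomial]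
  by_cases h : K + I ∈ P.support
  · rw [Finset.sum_eq_single_of_mem (K + I) h]
    · rw [if_pos (by simp)]
    · intro J _ hJ
      split_ifs with h1
      · rw [multiChoose_eq_zero, Nat.cast_zero, zero_mul]
        intro hle
        exact hJ (by rw [← h1, tsub_add_cancel_of_le hle])
      · rfl
  · rw [notMem_support_iff.mp h, mul_zero]
    refine Finset.sum_eq_zero fun J hJ => ?_
    split_ifs with h1
    · rw [multiChoose_eq_zero, Nat.cast_zero, zero_mul]
      intro hle
      exact h (by rwa [← h1, tsub_add_cancel_of_le hle])
    · rfl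

theorem hasse_add (I : σ →₀ ℕ) (P Q : MvPolynomial σ R) :
    hasse I (P + Q) = hasse I P + hasse I Q := by
  ext K; simp [coeff_hasse, mul_add]

theorem hasse_zero_left (P : MvPolynomial σ R) : hasse 0 P = P := by
  ext K; simp [coeff_hasse, multiChoose]

theorem hasse_map {S : Type*} [CommRing S] (f : R →+* S) (I : σ →₀ ℕ) (P : MvPolynomial σ R) :
    hasse I (map f P) = map f (hasse I P) := by
  ext K; simp [coeff_hasse, coeff_map]

theorem hasse_C_mul (I : σ →₀ ℕ) (c : R) (P : MvPolynomial σ R) :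
    hasse I (C c * P) = C c * hasse I P := by
  ext K; simp only [coeff_hasse, coeff_C_mul]; ring

theorem multiChoose_mul_multiChoose (K J I : σ →₀ ℕ) :
    multiChoose (K + J) J * multiChoose (K + J + I) I =
      multiChoose (I + J) I * multiChoose (K + (I + J)) (I + J) := by
  simp only [multiChoose, ← Finset.prod_mul_distrib, Finsupp.add_apply]
  refine Finset.prod_congr rfl fun i _ => ?_
  have h := Nat.choose_mul (n := K i + (I i + J i)) (k := I i + J i) (s := I i) (by omega)
  rw [show K i + (I i + J i) - I i = K i + J i by omega,
    show I i + J i - I i = J i by omega] at h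
  rw [show K i + J i + I i = K i + (I i + J i) by omega]
  linarith

theorem hasse_hasse (J I : σ →₀ ℕ) (P : MvPolynomial σ R) :
    hasse J (hasse I P) = C (multiChoose (I + J) I : R) * hasse (I + J) P := by
  ext K
  simp only [coeff_hasse, coeff_C_mul]
  rw [← mul_assoc, ← mul_assoc, ← Nat.cast_mul, ← Nat.cast_mul, multiChoose_mul_multiChoose,
    show K + J + I = K + (I + J) by rw [add_assoc, add_comm J I]]

theorem multiChoose_single (i : σ) (K I : σ →₀ ℕ) :
    (K i + 1) * multiChoose (K + Finsupp.single i 1 + I) I =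
      (I i + 1) * multiChoose (K + (I + Finsupp.single i 1)) (I + Finsupp.single i 1) := by
  classical
  simp only [multiChoose]
  rw [← Finset.mul_prod_erase _ _ (Finset.mem_univ i),
    ← Finset.mul_prod_erase _ (fun j => ((K + (I + Finsupp.single i 1) : σ →₀ ℕ) j).choose
      ((I + Finsupp.single i 1 : σ →₀ ℕ) j))
      (Finset.mem_univ i), ← mul_assoc, ← mul_assoc]
  congr 1
  · have h := Nat.choose_succ_right_eq (K i + I i + 1) (I i)
    simp only [Finsupp.add_apply, Finsupp.single_eq_same]
    rw [show K i + 1 + I i = K i + I i + 1 by omega,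
      show K i + (I i + 1) = K i + I i + 1 by omega]
    rw [show K i + I i + 1 - I i = K i + 1 by omega] at h
    linarith
  · refine Finset.prod_congr rfl fun j hj => ?_
    have hj : j ≠ i := Finset.ne_of_mem_erase hj
    simp [Finsupp.single_eq_of_ne hj]

theorem pderiv_hasse (i : σ) (I : σ →₀ ℕ) (P : MvPolynomial σ R) :
    pderiv i (hasse I P) = C ((I i + 1 : ℕ) : R) * hasse (I + Finsupp.single i 1) P := by
  ext K
  have h := multiChoose_single i K I
  have h' := congrArg (Nat.cast : ℕ → R) h
  push_cast at h'
  rw [coeff_pderiv, coeff_hasse, coeff_C_mul, coeff_hasse, ← mul_assoc]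
  push_cast
  rw [← h', show K + (I + Finsupp.single i 1) = K + Finsupp.single i 1 + I by
    rw [add_assoc, add_comm I]]
  ring

/-- The translate `P(β + X)` of `P`. -/
noncomputable def mvTaylor (β : σ → R) : MvPolynomial σ R →ₐ[R] MvPolynomial σ R :=
  aeval fun i => X i + C (β i)

theorem hasse_X_mul_of_le (i : σ) (I : σ →₀ ℕ) (P : MvPolynomial σ R) :
    hasse (I + Finsupp.single i 1) (X i * P) =
      X i * hasse (I + Finsupp.single i 1) P + hasse I P := by
  classical
  ext K
  rw [coeff_add, coeff_hasse, coeff_hasse, coeff_X_mul', coeff_X_mul']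
  rw [if_pos (by simp [Finsupp.mem_support_iff])]
  rw [← add_assoc, add_tsub_cancel_right]
  split_ifs with h
  · obtain ⟨K', rfl⟩ : ∃ K', K = K' + Finsupp.single i 1 := ⟨K - Finsupp.single i 1, by
      rw [tsub_add_cancel_of_le]
      rw [Finsupp.single_le_iff]
      exact Nat.one_le_iff_ne_zero.mpr (Finsupp.mem_support_iff.mp h)⟩
    rw [add_tsub_cancel_right, coeff_hasse,
      show K' + (I + Finsupp.single i 1) = K' + Finsupp.single i 1 + I by
        rw [add_assoc, add_comm I], ← add_mul, ← Nat.cast_add]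
    congr 2
    simp only [multiChoose]
    rw [← Finset.mul_prod_erase _ _ (Finset.mem_univ i),
      ← Finset.mul_prod_erase _ (fun j => ((K' + Finsupp.single i 1 + I : σ →₀ ℕ) j).choose
        ((I + Finsupp.single i 1 : σ →₀ ℕ) j)) (Finset.mem_univ i),
      ← Finset.mul_prod_erase _ (fun j => ((K' + Finsupp.single i 1 + I : σ →₀ ℕ) j).choose (I j))
        (Finset.mem_univ i)]
    have : ∀ x ∈ Finset.univ.erase i, ((K' + Finsupp.single i 1 + I + Finsupp.single i 1 :
        σ →₀ ℕ) x).choose ((I + Finsupp.single i 1 : σ →₀ ℕ) x) =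
        ((K' + Finsupp.single i 1 + I : σ →₀ ℕ) x).choose ((I : σ →₀ ℕ) x) ∧
        ((K' + Finsupp.single i 1 + I : σ →₀ ℕ) x).choose ((I + Finsupp.single i 1 : σ →₀ ℕ) x) =
        ((K' + Finsupp.single i 1 + I : σ →₀ ℕ) x).choose ((I : σ →₀ ℕ) x) := by
      intro j hj
      have hj : j ≠ i := Finset.ne_of_mem_erase hj
      simp [Finsupp.single_eq_of_ne hj]
    rw [Finset.prod_congr rfl fun x hx => (this x hx).1,
      Finset.prod_congr rfl fun x hx => (this x hx).2, ← add_mul]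
    congr 1
    simp only [Finsupp.add_apply, Finsupp.single_eq_same]
    rw [Nat.choose_succ_succ]; ring
  · rw [zero_add]
    have hK : K i = 0 := by simpa [Finsupp.mem_support_iff] using h
    congr 2
    simp only [multiChoose]
    refine Finset.prod_congr rfl fun j _ => ?_
    by_cases hj : j = i
    · subst hj; simp [hK]
    · simp [Finsupp.single_eq_of_ne hj]

theorem hasse_X_mul_of_eq_zero {i : σ} {I : σ →₀ ℕ} (h : I i = 0) (P : MvPolynomial σ R) :
    hasse I (X i * P) = X i * hasse I P := by
  classical
  ext K
  rw [coeff_hasse, coeff_X_mul', coeff_X_mul']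
  have : i ∈ (K + I).support ↔ i ∈ K.support := by simp [h]
  simp only [this]
  split_ifs with hK
  · obtain ⟨K', rfl⟩ : ∃ K', K = K' + Finsupp.single i 1 := ⟨K - Finsupp.single i 1, by
      rw [tsub_add_cancel_of_le]
      rw [Finsupp.single_le_iff]
      exact Nat.one_le_iff_ne_zero.mpr (Finsupp.mem_support_iff.mp hK)⟩
    rw [add_tsub_cancel_right, coeff_hasse, add_right_comm, add_tsub_cancel_right]
    congr 2
    simp only [multiChoose]
    refine Finset.prod_congr rfl fun j _ => ?_
    by_cases hj : j = i
    · subst hj; simp [h]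
    · simp [Finsupp.single_eq_of_ne hj]
  · rw [mul_zero]

theorem coeff_mvTaylor (β : σ → R) (P : MvPolynomial σ R) :
    ∀ K, coeff K (mvTaylor β P) = eval β (hasse K P) := by
  classical
  induction P using MvPolynomial.induction_on with
  | C a =>
    intro K
    have : hasse K (C a : MvPolynomial σ R) = if K = 0 then C a else 0 := by
      ext J
      rw [coeff_hasse, coeff_C]
      split_ifs with h1 h2 h2
      · subst h2
        rw [add_zero] at h1
        rw [← h1, coeff_C, if_pos rfl]; simp [multiChoose]
      · exact absurd (add_eq_zero.mp h1.symm).2 h2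
      · subst h2; rw [coeff_C, if_neg (by simpa using h1), mul_zero]
      · simp
    rw [this]
    simp only [mvTaylor, aeval_C, algebraMap_eq, coeff_C]
    by_cases h : K = 0
    · rw [if_pos h.symm, if_pos h, eval_C]
    · rw [if_neg (Ne.symm h), if_neg h, map_zero]
  | add p q hp hq => intro K; rw [map_add, coeff_add, hp, hq, hasse_add, map_add]
  | mul_X p i hp =>
    intro K
    rw [map_mul, mul_comm p (X i), mul_comm]
    simp only [mvTaylor, aeval_X] at hp ⊢
    rw [add_mul, coeff_add, coeff_C_mul, coeff_X_mul', hp]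
    split_ifs with h
    · obtain ⟨K', rfl⟩ : ∃ K', K = K' + Finsupp.single i 1 := ⟨K - Finsupp.single i 1, by
        rw [tsub_add_cancel_of_le]
        rw [Finsupp.single_le_iff]
        exact Nat.one_le_iff_ne_zero.mpr (Finsupp.mem_support_iff.mp h)⟩
      rw [add_tsub_cancel_right, hp, hasse_X_mul_of_le]
      simp; ring
    · rw [hasse_X_mul_of_eq_zero (by simpa using h), map_mul, eval_X, zero_add, hp]

theorem coeff_mvTaylor_hasse (β : σ → R) (I J : σ →₀ ℕ) (P : MvPolynomial σ R) :
    coeff J (mvTaylor β (hasse I P)) =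
      multiChoose (I + J) I * coeff (I + J) (mvTaylor β P) := by
  rw [coeff_mvTaylor, hasse_hasse, map_mul, eval_C, coeff_mvTaylor]

theorem degreeOf_hasse_le (i : σ) (I : σ →₀ ℕ) (P : MvPolynomial σ R) :
    degreeOf i (hasse I P) ≤ degreeOf i P := by
  rw [degreeOf_le_iff]
  intro K hK
  have h : K + I ∈ P.support := by
    rw [mem_support_iff, coeff_hasse] at hK
    exact mem_support_iff.mpr (right_ne_zero_of_mul hK)
  have := degreeOf_le_iff.mp (le_refl (degreeOf i P)) _ h
  simp only [Finsupp.add_apply] at this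
  omega

end Hasse

section WeightedOrder

variable {σ R : Type*} [Fintype σ] [CommRing R]

/-- The weight of an exponent vector relative to a vector `r` of degrees. -/
noncomputable def weight (r : σ → ℕ) (I : σ →₀ ℕ) : ℝ := ∑ i, (I i : ℝ) / r i

theorem weight_add (r : σ → ℕ) (I J : σ →₀ ℕ) : weight r (I + J) = weight r I + weight r J := by
  simp [weight, add_div, Finset.sum_add_distrib]

theorem weight_nonneg (r : σ → ℕ) (I : σ →₀ ℕ) : 0 ≤ weight r I :=
  Finset.sum_nonneg fun _ _ => by positivity

/-- `P` vanishes at `β` to weighted order at least `a`. -/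
def OrderGE (r : σ → ℕ) (β : σ → R) (a : ℝ) (P : MvPolynomial σ R) : Prop :=
  ∀ I, coeff I (mvTaylor β P) ≠ 0 → a ≤ weight r I

theorem OrderGE.mul {r : σ → ℕ} {β : σ → R} {a b : ℝ} {P Q : MvPolynomial σ R}
    (hP : OrderGE r β a P) (hQ : OrderGE r β b Q) : OrderGE r β (a + b) (P * Q) := by
  classical
  intro I hI
  rw [map_mul, coeff_mul] at hI
  obtain ⟨x, hx, hne⟩ := Finset.exists_ne_zero_of_sum_ne_zero hI
  rw [← Finset.HasAntidiagonal.mem_antidiagonal.mp hx, weight_add]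
  exact add_le_add (hP _ (left_ne_zero_of_mul hne)) (hQ _ (right_ne_zero_of_mul hne))

theorem orderGE_zero (r : σ → ℕ) (β : σ → R) (P : MvPolynomial σ R) : OrderGE r β 0 P :=
  fun I _ => weight_nonneg r I

theorem OrderGE.prod {r : σ → ℕ} {β : σ → R} {ι : Type*} (s : Finset ι) {a : ι → ℝ}
    {P : ι → MvPolynomial σ R} (h : ∀ i ∈ s, OrderGE r β (a i) (P i)) :
    OrderGE r β (∑ i ∈ s, a i) (∏ i ∈ s, P i) := by
  classical
  induction s using Finset.induction_on with
  | empty => simpa using orderGE_zero r β _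
  | insert x s hx ih =>
    rw [Finset.sum_insert hx, Finset.prod_insert hx]
    exact (h x (Finset.mem_insert_self x s)).mul
      (ih fun i hi => h i (Finset.mem_insert_of_mem hi))

theorem OrderGE.sum {r : σ → ℕ} {β : σ → R} {ι : Type*} (s : Finset ι) {a : ℝ}
    {P : ι → MvPolynomial σ R} (h : ∀ i ∈ s, OrderGE r β a (P i)) :
    OrderGE r β a (∑ i ∈ s, P i) := by
  intro I hI
  rw [map_sum, coeff_sum] at hI
  obtain ⟨x, hx, hne⟩ := Finset.exists_ne_zero_of_sum_ne_zero hI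
  exact h x hx I hne

theorem OrderGE.det {r : σ → ℕ} {β : σ → R} {k : ℕ} {a : Fin k → ℝ}
    {M : Matrix (Fin k) (Fin k) (MvPolynomial σ R)} (h : ∀ i j, OrderGE r β (a j) (M i j)) :
    OrderGE r β (∑ j, a j) M.det := by
  rw [Matrix.det_apply]
  refine OrderGE.sum _ fun s _ => ?_
  have h1 := OrderGE.prod Finset.univ (fun j (_ : j ∈ Finset.univ) => h (s j) j)
  intro I hI
  apply h1 I
  intro h0
  apply hI
  rw [Units.smul_def, map_zsmul, coeff_smul, h0, smul_zero]

theorem OrderGE.hasse {r : σ → ℕ} {β : σ → R} {a : ℝ} {P : MvPolynomial σ R}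
    (hP : OrderGE r β a P) (I : σ →₀ ℕ) : OrderGE r β (a - weight r I) (hasse I P) := by
  intro J hJ
  rw [coeff_mvTaylor_hasse] at hJ
  have := hP _ (right_ne_zero_of_mul hJ)
  rw [weight_add] at this
  linarith

end WeightedOrder

section Length

variable {σ : Type*}

/-- The sum of the absolute values of the coefficients. -/
noncomputable def polyLength (P : MvPolynomial σ ℤ) : ℝ := ∑ J ∈ P.support, |((coeff J P : ℤ) : ℝ)|

theorem polyLength_eq_sum {P : MvPolynomial σ ℤ} {s : Finset (σ →₀ ℕ)} (h : P.support ⊆ s) :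
    polyLength P = ∑ J ∈ s, |((coeff J P : ℤ) : ℝ)| :=
  Finset.sum_subset h fun J _ hJ => by rw [notMem_support_iff.mp hJ]; simp

theorem polyLength_nonneg (P : MvPolynomial σ ℤ) : 0 ≤ polyLength P :=
  Finset.sum_nonneg fun _ _ => abs_nonneg _

theorem abs_coeff_le_polyLength (P : MvPolynomial σ ℤ) (J : σ →₀ ℕ) :
    |((coeff J P : ℤ) : ℝ)| ≤ polyLength P := by
  by_cases h : J ∈ P.support
  · exact Finset.single_le_sum (f := fun J => |((coeff J P : ℤ) : ℝ)|) (fun _ _ => abs_nonneg _) h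
  · rw [notMem_support_iff.mp h]; simpa using polyLength_nonneg P

theorem one_le_polyLength {P : MvPolynomial σ ℤ} (h : P ≠ 0) : 1 ≤ polyLength P := by
  obtain ⟨J, hJ⟩ := ne_zero_iff.mp h
  refine le_trans ?_ (abs_coeff_le_polyLength P J)
  exact_mod_cast Int.one_le_abs hJ

theorem polyLength_zero : polyLength (0 : MvPolynomial σ ℤ) = 0 := by simp [polyLength]

theorem polyLength_add_le (P Q : MvPolynomial σ ℤ) :
    polyLength (P + Q) ≤ polyLength P + polyLength Q := by
  classical
  have hP : P.support ⊆ P.support ∪ Q.support := Finset.subset_union_left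
  have hQ : Q.support ⊆ P.support ∪ Q.support := Finset.subset_union_right
  rw [polyLength_eq_sum hP, polyLength_eq_sum hQ, polyLength_eq_sum support_add,
    ← Finset.sum_add_distrib]
  refine Finset.sum_le_sum fun J _ => ?_
  rw [coeff_add]; push_cast; exact abs_add_le _ _

theorem polyLength_sum_le {ι : Type*} (s : Finset ι) (P : ι → MvPolynomial σ ℤ) :
    polyLength (∑ i ∈ s, P i) ≤ ∑ i ∈ s, polyLength (P i) := by
  classical
  induction s using Finset.induction_on with
  | empty => simp [polyLength_zero]
  | insert x s hx ih =>
    rw [Finset.sum_insert hx, Finset.sum_insert hx]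
    exact (polyLength_add_le _ _).trans (by gcongr)

theorem polyLength_monomial_mul_le (a : σ →₀ ℕ) (c : ℤ) (Q : MvPolynomial σ ℤ) :
    polyLength (monomial a c * Q) ≤ |(c : ℝ)| * polyLength Q := by
  classical
  have hs : (monomial a c * Q).support ⊆ Q.support.map (addLeftEmbedding a) := by
    intro J hJ
    rw [mem_support_iff, coeff_monomial_mul'] at hJ
    split_ifs at hJ with h
    · rw [Finset.mem_map]
      exact ⟨J - a, mem_support_iff.mpr (right_ne_zero_of_mul hJ), add_tsub_cancel_of_le h⟩
    · exact absurd rfl hJ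
  rw [polyLength_eq_sum hs, Finset.sum_map, polyLength, Finset.mul_sum]
  refine Finset.sum_le_sum fun J _ => ?_
  rw [addLeftEmbedding_apply, coeff_monomial_mul]
  push_cast; rw [abs_mul]

theorem polyLength_mul_le (P Q : MvPolynomial σ ℤ) :
    polyLength (P * Q) ≤ polyLength P * polyLength Q := by
  classical
  conv_lhs => rw [P.as_sum, Finset.sum_mul]
  refine (polyLength_sum_le _ _).trans ?_
  conv_rhs => rw [polyLength, Finset.sum_mul]
  exact Finset.sum_le_sum fun J _ => polyLength_monomial_mul_le _ _ _

theorem polyLength_prod_le {ι : Type*} (s : Finset ι) (P : ι → MvPolynomial σ ℤ) :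
    polyLength (∏ i ∈ s, P i) ≤ ∏ i ∈ s, polyLength (P i) := by
  classical
  induction s using Finset.induction_on with
  | empty =>
    rw [Finset.prod_empty, Finset.prod_empty]
    have := polyLength_monomial_mul_le (σ := σ) 0 1 1
    simp only [polyLength]
    rw [support_one, Finset.sum_singleton, coeff_zero_one]; simp
  | insert x s hx ih =>
    rw [Finset.prod_insert hx, Finset.prod_insert hx]
    exact (polyLength_mul_le _ _).trans
      (mul_le_mul_of_nonneg_left ih (polyLength_nonneg _))

theorem polyLength_neg (P : MvPolynomial σ ℤ) : polyLength (-P) = polyLength P := by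
  simp [polyLength, support_neg]

theorem polyLength_det_le {k : ℕ} {M : Matrix (Fin k) (Fin k) (MvPolynomial σ ℤ)} {T : ℝ}
    (h : ∀ i j, polyLength (M i j) ≤ T) : polyLength M.det ≤ (k * T) ^ k := by
  classical
  rw [Matrix.det_apply]
  refine (polyLength_sum_le _ _).trans ?_
  have h1 : ∀ s : Equiv.Perm (Fin k),
      polyLength (Equiv.Perm.sign s • ∏ i, M (s i) i) ≤ T ^ k := by
    intro s
    have h2 : polyLength (Equiv.Perm.sign s • ∏ i, M (s i) i) = polyLength (∏ i, M (s i) i) := by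
      rcases Int.units_eq_one_or (Equiv.Perm.sign s) with h | h <;> rw [h]
      · rw [one_smul]
      · rw [Units.neg_smul, one_smul, polyLength_neg]
    rw [h2]
    refine (polyLength_prod_le _ _).trans ?_
    refine (Finset.prod_le_prod (fun i _ => polyLength_nonneg _) fun i _ => h (s i) i).trans ?_
    simp
  refine (Finset.sum_le_sum fun s _ => h1 s).trans ?_
  rw [Finset.sum_const, Finset.card_univ, Fintype.card_perm, Fintype.card_fin, nsmul_eq_mul,
    mul_pow]
  rcases Nat.eq_zero_or_pos k with rfl | hk
  · simp
  have hT : 0 ≤ T := (polyLength_nonneg _).trans (h ⟨0, hk⟩ ⟨0, hk⟩)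
  gcongr
  exact_mod_cast Nat.factorial_le_pow k

theorem polyLength_hasse_le [Fintype σ] {r : σ → ℕ} {P : MvPolynomial σ ℤ}
    (hr : ∀ i, degreeOf i P ≤ r i) (I : σ →₀ ℕ) :
    polyLength (hasse I P) ≤ 2 ^ (∑ i, r i) * polyLength P := by
  rw [hasse]
  refine (polyLength_sum_le _ _).trans ?_
  conv_rhs => rw [polyLength, Finset.mul_sum]
  refine Finset.sum_le_sum fun J hJ => ?_
  have h1 := polyLength_monomial_mul_le (J - I) (multiChoose J I * coeff J P) 1
  rw [mul_one] at h1
  have h2 : polyLength (1 : MvPolynomial σ ℤ) = 1 := by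
    simp only [polyLength]; rw [support_one]; simp
  rw [h2, mul_one] at h1
  refine h1.trans ?_
  push_cast
  rw [abs_mul, Nat.abs_cast]
  gcongr
  have : multiChoose J I ≤ 2 ^ ∑ i, r i := by
    rw [← Finset.prod_pow_eq_pow_sum, multiChoose]
    refine Finset.prod_le_prod' fun i _ => ?_
    refine (Nat.choose_le_two_pow _ _).trans (Nat.pow_le_pow_right (by norm_num) ?_)
    exact (degreeOf_le_iff.mp (hr i)) J hJ
  exact_mod_cast this

end Length

section MvWronskian

theorem totalDegree_pderiv_lt {σ : Type*} (i : σ) (c : MvPolynomial σ ℚ) (h : pderiv i c ≠ 0) :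
    (pderiv i c).totalDegree < c.totalDegree := by
  classical
  have hkey : ∀ m ∈ (pderiv i c).support, (m.sum fun _ e => e) < c.totalDegree := by
    intro m hm
    rw [mem_support_iff, coeff_pderiv] at hm
    have h2 := le_totalDegree (mem_support_iff.mpr (left_ne_zero_of_mul hm))
    rw [Finsupp.sum_add_index' (by simp) (by simp)] at h2
    rw [Finsupp.sum_single_index rfl] at h2
    omega
  obtain ⟨m0, hm0⟩ := Finset.nonempty_iff_ne_empty.mpr (fun h0 => h (support_eq_empty.mp h0))
  rw [totalDegree, Finset.sup_lt_iff (lt_of_le_of_lt (Nat.zero_le _) (hkey m0 hm0))]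
  exact hkey

theorem mem_range_algebraMap_of_pderiv_eq_zero {σ : Type*} (c : MvPolynomial σ ℚ)
    (h : ∀ i, pderiv i c = 0) : c ∈ Set.range (algebraMap ℚ (MvPolynomial σ ℚ)) := by
  classical
  refine ⟨coeff 0 c, ?_⟩
  rw [algebraMap_eq]
  ext m
  rw [coeff_C]
  split_ifs with hm
  · rw [hm]
  · obtain ⟨i, hi⟩ := Finsupp.ne_iff.mp (Ne.symm hm)
    have h1 := congrArg (coeff (m - Finsupp.single i 1)) (h i)
    rw [coeff_pderiv, coeff_zero, tsub_add_cancel_of_le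
      (Finsupp.single_le_iff.mpr (Nat.one_le_iff_ne_zero.mpr hi))] at h1
    refine ((mul_eq_zero.mp h1).resolve_right ?_).symm
    positivity

theorem exists_wordOp_pderiv_eq {n : ℕ} (w : List (Fin n)) :
    ∃ (I : Fin n →₀ ℕ) (a : ℚ), ∑ h, I h = w.length ∧
      ∀ P : MvPolynomial (Fin n) ℚ, wordOp (fun i => pderiv i) w P = C a * hasse I P := by
  induction w with
  | nil => exact ⟨0, 1, by simp, fun P => by simp [wordOp, hasse_zero_left]⟩
  | cons i w ih =>
    obtain ⟨I, a, h1, h2⟩ := ih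
    refine ⟨I + Finsupp.single i 1, a * ((I i + 1 : ℕ) : ℚ), ?_, fun P => ?_⟩
    · simp [Finset.sum_add_distrib, h1, Finsupp.single_apply]
    · rw [wordOp, h2, pderiv_C_mul, pderiv_hasse, C_mul, mul_assoc]

theorem exists_mv_wronskian_ne_zero {n k : ℕ} (φ : Fin k → MvPolynomial (Fin n) ℚ)
    (hφ : LinearIndependent ℚ φ) :
    ∃ I : Fin k → (Fin n →₀ ℕ), (∀ i, ∑ h, I i h ≤ k - 1) ∧
      (Matrix.of fun i j => hasse (I i) (φ j)).det ≠ 0 := by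
  obtain ⟨w, hw, hdet⟩ := exists_wronskian_ne_zero (fun i : Fin n => pderiv (R := ℚ) i)
    totalDegree totalDegree_pderiv_lt totalDegree_zero
    mem_range_algebraMap_of_pderiv_eq_zero φ hφ
  choose I a hI ha using fun i => exists_wordOp_pderiv_eq (w i)
  refine ⟨I, fun i => (hI i).trans_le (hw i), fun h0 => hdet ?_⟩
  have : (Matrix.of fun i j => wordOp (fun i : Fin n => pderiv (R := ℚ) i) (w i) (φ j)) =
      Matrix.of fun i j => C (a i) * (Matrix.of fun i j => hasse (I i) (φ j)) i j := by
    ext1 i j; simp only [Matrix.of_apply]; exact ha i (φ j)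
  rw [this, Matrix.det_mul_column, h0, mul_zero]

theorem exists_wronskian_hasseDeriv_ne_zero {k : ℕ} (ψ : Fin k → Polynomial ℚ)
    (hψ : LinearIndependent ℚ ψ) :
    ∃ b : Fin k → ℕ, Function.Injective b ∧ (∀ i, b i ≤ k - 1) ∧
      (Matrix.of fun i j => Polynomial.hasseDeriv (b j) (ψ i)).det ≠ 0 := by
  obtain ⟨w, hw, hdet⟩ := exists_wronskian_ne_zero
    (fun _ : Unit => (Polynomial.derivative' : Derivation ℚ (Polynomial ℚ) (Polynomial ℚ)))
    Polynomial.natDegree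
    (fun _ c hc => Polynomial.natDegree_derivative_lt fun h => hc (by
      rw [Polynomial.eq_C_of_natDegree_eq_zero h]; simp))
    Polynomial.natDegree_zero
    (fun c hc => ⟨c.coeff 0, (Polynomial.eq_C_of_natDegree_eq_zero
      (Polynomial.derivative_eq_zero.mp (hc ()))).symm⟩) ψ hψ
  have hword : ∀ (w : List Unit) (f : Polynomial ℚ), wordOp
      (fun _ : Unit => (Polynomial.derivative' : Derivation ℚ (Polynomial ℚ) (Polynomial ℚ))) w f =
      Polynomial.C (w.length.factorial : ℚ) * Polynomial.hasseDeriv w.length f := by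
    intro w f
    have h1 : wordOp (fun _ : Unit =>
        (Polynomial.derivative' : Derivation ℚ (Polynomial ℚ) (Polynomial ℚ))) w f =
        Polynomial.derivative^[w.length] f := by
      induction w with
      | nil => rfl
      | cons u w ih =>
        rw [wordOp, ih, List.length_cons, Function.iterate_succ_apply']; rfl
    rw [h1, ← Polynomial.factorial_smul_hasseDeriv]
    simp [nsmul_eq_mul]
  have hM : (Matrix.of fun i j => wordOp (fun _ : Unit =>
      (Polynomial.derivative' : Derivation ℚ (Polynomial ℚ) (Polynomial ℚ))) (w i) (ψ j)) =
      Matrix.of fun i j => Polynomial.C ((w i).length.factorial : ℚ) *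
        (Matrix.of fun i j => Polynomial.hasseDeriv (w i).length (ψ j)) i j := by
    ext1 i j; simp only [Matrix.of_apply]; exact hword (w i) (ψ j)
  rw [hM, Matrix.det_mul_column] at hdet
  have hdet' := right_ne_zero_of_mul hdet
  refine ⟨fun i => (w i).length, ?_, hw, ?_⟩
  · intro i j hij
    by_contra hne
    apply hdet'
    apply Matrix.det_zero_of_row_eq hne
    ext1 l
    simp only [Matrix.of_apply]
    simp only at hij
    rw [hij]
  · rw [← Matrix.det_transpose]; exact hdet'

end MvWronskian

section Splitting

theorem finSuccEquiv_hasse_cons {n : ℕ} {R : Type*} [CommRing R] (j : ℕ) (I : Fin n →₀ ℕ)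
    (P : MvPolynomial (Fin (n + 1)) R) (m : ℕ) (M : Fin n →₀ ℕ) :
    coeff M ((finSuccEquiv R n (hasse (I.cons j) P)).coeff m) =
      ((m + j).choose j : R) * (multiChoose (M + I) I : R) *
        coeff (M + I) ((finSuccEquiv R n P).coeff (m + j)) := by
  rw [finSuccEquiv_coeff_coeff, finSuccEquiv_coeff_coeff, coeff_hasse]
  have h : M.cons m + I.cons j = (M + I).cons (m + j) := by
    ext i
    refine Fin.cases ?_ (fun i => ?_) i <;> simp
  rw [h]
  congr 1
  rw [multiChoose, Fin.prod_univ_succ]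
  simp [multiChoose]

theorem exists_tensor_decomposition {n : ℕ} (Q : Polynomial (MvPolynomial (Fin n) ℚ)) (r : ℕ)
    (hr : Q.natDegree ≤ r) (hQ : Q ≠ 0) :
    ∃ (k : ℕ) (φ : Fin k → MvPolynomial (Fin n) ℚ) (ψ : Fin k → Polynomial ℚ), 0 < k ∧ k ≤ r + 1 ∧
      LinearIndependent ℚ φ ∧ LinearIndependent ℚ ψ ∧
      ∀ a, Q.coeff a = ∑ l, (ψ l).coeff a • φ l := by
  classical
  let s : Set (MvPolynomial (Fin n) ℚ) := ((Finset.range (r + 1)).image Q.coeff : Finset _)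
  obtain ⟨b, hbs, hspan, hli⟩ := exists_linearIndependent ℚ s
  have hbf : b.Finite := (Finset.finite_toSet _).subset hbs
  have : Fintype b := hbf.fintype
  let k := Fintype.card b
  let e : Fin k ≃ b := (Fintype.equivFin b).symm
  let φ : Fin k → MvPolynomial (Fin n) ℚ := fun l => (e l : MvPolynomial (Fin n) ℚ)
  have hφ : LinearIndependent ℚ φ := hli.comp e e.injective
  have hrange : Set.range φ = b := by
    ext x
    constructor
    · rintro ⟨l, rfl⟩; exact (e l).2
    · intro hx; exact ⟨e.symm ⟨x, hx⟩, by simp [φ]⟩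
  have hmem : ∀ a, ∃ c : Fin k → ℚ, ∑ l, c l • φ l = Q.coeff a := by
    intro a
    rw [← Submodule.mem_span_range_iff_exists_fun, hrange, hspan]
    by_cases ha : a < r + 1
    · apply Submodule.subset_span
      simp only [s, Finset.coe_image]
      exact ⟨a, by simpa using ha, rfl⟩
    · rw [Polynomial.coeff_eq_zero_of_natDegree_lt (by omega)]; exact zero_mem _
  choose c hc using hmem
  let ψ : Fin k → Polynomial ℚ := fun l => ∑ a ∈ Finset.range (r + 1), Polynomial.monomial a (c a l)
  have hψc : ∀ l a, (ψ l).coeff a = if a < r + 1 then c a l else 0 := by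
    intro l a
    simp [ψ, Polynomial.coeff_monomial]
  refine ⟨k, φ, ψ, ?_, ?_, hφ, ?_, ?_⟩
  · by_contra hk
    have hk0 : k = 0 := by omega
    apply hQ
    ext1 a
    rw [← hc a, Polynomial.coeff_zero]
    apply Finset.sum_eq_zero
    intro l _
    exact (Fin.cast hk0 l).elim0
  · have h1 : k = hbf.toFinset.card := by simp [k, Set.toFinset_card]
    have h2 : hbf.toFinset ⊆ (Finset.range (r + 1)).image Q.coeff := by
      intro x hx
      have := hbs (hbf.mem_toFinset.mp hx)
      exact_mod_cast this
    rw [h1]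
    refine (Finset.card_le_card h2).trans (Finset.card_image_le.trans ?_)
    simp
  · rw [Fintype.linearIndependent_iff]
    intro x hx l'
    have hl' : φ l' ∈ s := hbs (e l').2
    simp only [s, Finset.coe_image, Set.mem_image, Finset.coe_range, Set.mem_Iio] at hl'
    obtain ⟨a, ha, hal⟩ := hl'
    have hd : ∀ l, c a l = if l = l' then 1 else 0 := by
      have h1 : ∑ l, (c a l - if l = l' then 1 else 0) • φ l = 0 := by
        simp only [sub_smul, Finset.sum_sub_distrib, hc a, hal]
        simp
      intro l
      have := Fintype.linearIndependent_iff.mp hφ _ h1 l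
      linarith
    have h2 := congrArg (fun f => Polynomial.coeff f a) hx
    simp only [Polynomial.finsetSum_coeff, Polynomial.coeff_smul, smul_eq_mul, hψc, if_pos ha,
      hd, Polynomial.coeff_zero] at h2
    simpa using h2
  · intro a
    rw [← hc a]
    refine Finset.sum_congr rfl fun l _ => ?_
    rw [hψc]
    split_ifs with ha
    · rfl
    · have h1 : Q.coeff a = 0 := Polynomial.coeff_eq_zero_of_natDegree_lt (by omega)
      have := Fintype.linearIndependent_iff.mp hφ _ ((hc a).trans h1) l
      rw [this]

theorem exists_split_wronskian {n : ℕ} (P : MvPolynomial (Fin (n + 1)) ℚ) (r : ℕ)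
    (hr : degreeOf 0 P ≤ r) (hP : P ≠ 0) :
    ∃ (k : ℕ) (b : Fin k → ℕ) (I : Fin k → (Fin n →₀ ℕ)) (U : MvPolynomial (Fin n) ℚ)
      (V : Polynomial ℚ), 0 < k ∧ k ≤ r + 1 ∧ Function.Injective b ∧ (∀ i, b i ≤ k - 1) ∧
      (∀ i, ∑ h, I i h ≤ k - 1) ∧ U ≠ 0 ∧ V ≠ 0 ∧
      finSuccEquiv ℚ n (Matrix.of fun i j => hasse ((I i).cons (b j)) P).det =
        Polynomial.C U * V.map C := by
  obtain ⟨k, φ, ψ, hk, hkr, hφ, hψ, hQ⟩ := exists_tensor_decomposition (finSuccEquiv ℚ n P) r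
    ((natDegree_finSuccEquiv P).trans_le hr)
    (by simpa using hP)
  obtain ⟨I, hI, hU⟩ := exists_mv_wronskian_ne_zero φ hφ
  obtain ⟨b, hbinj, hb, hV⟩ := exists_wronskian_hasseDeriv_ne_zero ψ hψ
  refine ⟨k, b, I, _, _, hk, hkr, hbinj, hb, hI, hU, hV, ?_⟩
  have h1 : (finSuccEquiv ℚ n).toRingHom.mapMatrix
      (Matrix.of fun i j => hasse ((I i).cons (b j)) P) =
      (Polynomial.C : _ →+* Polynomial (MvPolynomial (Fin n) ℚ)).mapMatrix
        (Matrix.of fun i j => hasse (I i) (φ j)) *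
      (Polynomial.mapRingHom (C : ℚ →+* MvPolynomial (Fin n) ℚ)).mapMatrix
        (Matrix.of fun i j => Polynomial.hasseDeriv (b j) (ψ i)) := by
    ext i j m M
    simp only [RingHom.mapMatrix_apply, Matrix.map_apply, Matrix.of_apply, Matrix.mul_apply,
      Polynomial.finsetSum_coeff, Polynomial.coeff_C_mul, Polynomial.coe_mapRingHom,
      Polynomial.coeff_map, coeff_sum]
    have h2 : coeff M (((finSuccEquiv ℚ n).toRingHom (hasse ((I i).cons (b j)) P)).coeff m) =
      coeff M (((finSuccEquiv ℚ n) (hasse ((I i).cons (b j)) P)).coeff m) := rfl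
    rw [h2, finSuccEquiv_hasse_cons, hQ, coeff_sum, Finset.mul_sum]
    refine Finset.sum_congr rfl fun l _ => ?_
    rw [Polynomial.hasseDeriv_coeff, coeff_smul, mul_comm (hasse _ _), coeff_C_mul, coeff_hasse,
      smul_eq_mul]
    ring
  have h3 := congrArg Matrix.det h1
  rw [Matrix.det_mul, ← RingHom.map_det, ← RingHom.map_det, ← RingHom.map_det] at h3
  exact h3

end Splitting

section RothLemma

theorem finSuccEquiv_hasse_cons_of_eq {n : ℕ} {W : MvPolynomial (Fin (n + 1)) ℚ}
    {U : MvPolynomial (Fin n) ℚ} {V : Polynomial ℚ}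
    (h : finSuccEquiv ℚ n W = Polynomial.C U * V.map C) (l : ℕ) (J : Fin n →₀ ℕ) :
    finSuccEquiv ℚ n (hasse (J.cons l) W) =
      Polynomial.C (hasse J U) * (Polynomial.hasseDeriv l V).map C := by
  ext m M
  rw [finSuccEquiv_hasse_cons, h, Polynomial.coeff_C_mul, Polynomial.coeff_C_mul,
    Polynomial.coeff_map, Polynomial.coeff_map, mul_comm U, mul_comm (hasse J U), coeff_C_mul,
    coeff_C_mul, coeff_hasse, Polynomial.hasseDeriv_coeff]
  ring

theorem eval_hasse_cons_of_eq {n : ℕ} {W : MvPolynomial (Fin (n + 1)) ℚ}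
    {U : MvPolynomial (Fin n) ℚ} {V : Polynomial ℚ}
    (h : finSuccEquiv ℚ n W = Polynomial.C U * V.map C) (l : ℕ) (J : Fin n →₀ ℕ)
    (β : Fin (n + 1) → ℚ) :
    eval β (hasse (J.cons l) W) =
      eval (β ∘ Fin.succ) (hasse J U) * (Polynomial.hasseDeriv l V).eval (β 0) := by
  have hβ : β = Fin.cons (β 0) (β ∘ Fin.succ) := (Fin.cons_self_tail β).symm
  conv_lhs => rw [hβ]
  rw [eval_eq_eval_mv_eval', finSuccEquiv_hasse_cons_of_eq h, Polynomial.map_mul,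
    Polynomial.map_C, Polynomial.map_map, Polynomial.eval_mul, Polynomial.eval_C]
  congr 2
  have : ((eval (β ∘ Fin.succ)).comp C : ℚ →+* ℚ) = RingHom.id ℚ := Subsingleton.elim _ _
  rw [this, Polynomial.map_id]

theorem exists_taylor_coeff_ne_zero (V : Polynomial ℤ) (hV : V ≠ 0) (β : ℚ) :
    ∃ l : ℕ, (Polynomial.hasseDeriv l (V.map (Int.castRingHom ℚ))).eval β ≠ 0 ∧
      ((β.den : ℝ)) ^ l ≤ |(V.leadingCoeff : ℝ)| := by
  have hVQ : V.map (Int.castRingHom ℚ) ≠ 0 :=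
    (Polynomial.map_ne_zero_iff (RingHom.injective_int _)).mpr hV
  set l := Polynomial.rootMultiplicity β (V.map (Int.castRingHom ℚ)) with hl
  refine ⟨l, ?_, ?_⟩
  · rw [← Polynomial.taylor_coeff, hl, Polynomial.rootMultiplicity_eq_natTrailingDegree]
    rw [← Polynomial.taylor_apply]
    have h1 : Polynomial.taylor β (V.map (Int.castRingHom ℚ)) ≠ 0 := by
      intro h0
      exact hVQ (Polynomial.taylor_injective β (by rw [h0, map_zero]))
    exact Polynomial.trailingCoeff_nonzero_iff_nonzero.mpr h1
  · let A : Polynomial ℤ := Polynomial.C (β.den : ℤ) * Polynomial.X + Polynomial.C (-β.num)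
    have hA : A.IsPrimitive := by
      intro c hc
      rw [Polynomial.C_dvd_iff_dvd_coeff] at hc
      have h0 := hc 0
      have h1 := hc 1
      simp only [A, Polynomial.coeff_add, Polynomial.coeff_C_mul, Polynomial.coeff_X_zero,
        Polynomial.coeff_X_one, Polynomial.coeff_C_zero, Polynomial.coeff_C_succ, mul_zero,
        zero_add, mul_one, add_zero, dvd_neg] at h0 h1
      have hcop : IsCoprime (β.num) (β.den : ℤ) := by
        rw [Int.isCoprime_iff_gcd_eq_one]; exact β.reduced
      exact hcop.isUnit_of_dvd' h0 h1
    have hApow : ∀ m : ℕ, (A ^ m).IsPrimitive := by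
      intro m
      induction m with
      | zero => rw [pow_zero]; exact Polynomial.isPrimitive_one
      | succ m ih => rw [pow_succ]; exact ih.mul hA
    have hdvd : A ^ l ∣ V := by
      rw [Polynomial.IsPrimitive.Int.dvd_iff_map_cast_dvd_map_cast _ _ (hApow l),
        Polynomial.map_pow]
      have hA2 : A.map (Int.castRingHom ℚ) =
          Polynomial.C (β.den : ℚ) * (Polynomial.X - Polynomial.C β) := by
        have : (β.den : ℚ) * β = β.num := Rat.den_mul_eq_num β
        simp only [A, Polynomial.map_add, Polynomial.map_mul, Polynomial.map_C, Polynomial.map_X,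
          mul_sub, ← Polynomial.C_mul, this]
        simp [sub_eq_add_neg]
      rw [hA2, mul_pow, ← Polynomial.C_pow]
      have hu : IsUnit (Polynomial.C ((β.den : ℚ) ^ l)) := by
        rw [Polynomial.isUnit_C]
        exact IsUnit.mk0 _ (pow_ne_zero _ (by exact_mod_cast β.den_nz))
      rw [hu.mul_left_dvd]
      exact (Polynomial.le_rootMultiplicity_iff hVQ).mp le_rfl
    obtain ⟨Q, hQ⟩ := hdvd
    have hlead : V.leadingCoeff = (β.den : ℤ) ^ l * Q.leadingCoeff := by
      rw [hQ, Polynomial.leadingCoeff_mul, Polynomial.leadingCoeff_pow,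
        Polynomial.leadingCoeff_linear (by exact_mod_cast β.den_nz)]
    have hQ0 : Q.leadingCoeff ≠ 0 := by
      intro h0
      rw [h0, mul_zero] at hlead
      exact hV (Polynomial.leadingCoeff_eq_zero.mp hlead)
    rw [hlead]
    push_cast
    rw [abs_mul, abs_pow, Nat.abs_cast]
    have : (1 : ℝ) ≤ |(Q.leadingCoeff : ℝ)| := by exact_mod_cast Int.one_le_abs hQ0
    nlinarith [pow_nonneg (Nat.cast_nonneg (α := ℝ) β.den) l]

theorem polyLength_coeff_finSuccEquiv_le {n : ℕ} (W : MvPolynomial (Fin (n + 1)) ℤ) (m : ℕ) :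
    polyLength ((finSuccEquiv ℤ n W).coeff m) ≤ polyLength W := by
  classical
  have hinj : Function.Injective (fun M : Fin n →₀ ℕ => M.cons m) := fun a b h =>
    Finsupp.cons_right_injective m h
  have h1 : polyLength ((finSuccEquiv ℤ n W).coeff m) =
      ∑ J ∈ ((finSuccEquiv ℤ n W).coeff m).support.map ⟨_, hinj⟩,
        |((coeff J W : ℤ) : ℝ)| := by
    rw [Finset.sum_map, polyLength]
    refine Finset.sum_congr rfl fun M _ => ?_
    rw [finSuccEquiv_coeff_coeff]; rfl
  rw [h1]
  refine Finset.sum_le_sum_of_subset_of_nonneg ?_ fun _ _ _ => abs_nonneg _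
  intro J hJ
  obtain ⟨M, hM, rfl⟩ := Finset.mem_map.mp hJ
  rw [mem_support_iff, finSuccEquiv_coeff_coeff] at hM
  exact mem_support_iff.mpr hM

theorem degreeOf_det_le {σ : Type*} {k : ℕ} {M : Matrix (Fin k) (Fin k) (MvPolynomial σ ℤ)}
    {h : σ} {r : ℕ} (hM : ∀ i j, degreeOf h (M i j) ≤ r) : degreeOf h M.det ≤ k * r := by
  classical
  rw [Matrix.det_apply]
  refine (degreeOf_sum_le _ _ _).trans (Finset.sup_le fun s _ => ?_)
  have h1 : degreeOf h (∏ i, M (s i) i) ≤ k * r := by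
    refine (degreeOf_prod_le _ _ _).trans ?_
    refine (Finset.sum_le_sum fun i _ => hM (s i) i).trans ?_
    simp
  rcases Int.units_eq_one_or (Equiv.Perm.sign s) with h | h <;> rw [h]
  · rwa [one_smul]
  · rw [Units.neg_smul, one_smul]
    rw [degreeOf_le_iff] at h1 ⊢
    intro m hm
    rw [support_neg] at hm
    exact h1 m hm

theorem le_sum_max_sub {k r : ℕ} (hr : 0 < r) (hkr : k ≤ r + 1) {b : Fin k → ℕ}
    (hinj : Function.Injective b) (hb : ∀ i, b i ≤ k - 1) {s : ℝ} (hs : 0 < s) (hs1 : s ≤ 1) :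
    k * s ^ 2 / 8 ≤ ∑ j, max (s - b j / r) 0 := by
  classical
  have himg : Finset.univ.image b = Finset.range k := by
    apply Finset.eq_of_subset_of_card_le
    · intro x hx
      obtain ⟨i, _, rfl⟩ := Finset.mem_image.mp hx
      have := hb i
      have := i.2
      exact Finset.mem_range.mpr (by omega)
    · rw [Finset.card_image_of_injective _ hinj]; simp
  have h1 : ∑ j, max (s - b j / r) 0 = ∑ j ∈ Finset.range k, max (s - (j : ℝ) / r) 0 := by
    rw [← himg, Finset.sum_image (fun _ _ _ _ h => hinj h)]
  rw [h1]
  have hr' : (0 : ℝ) < r := by exact_mod_cast hr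
  have hr1 : (1 : ℝ) ≤ r := by exact_mod_cast hr
  have hkr' : (k : ℝ) ≤ r + 1 := by exact_mod_cast hkr
  let t := ⌊s * r / 2⌋₊
  have ht : s * r / 2 < t + 1 := Nat.lt_floor_add_one _
  have hsub : Finset.range (min k (t + 1)) ⊆ Finset.range k := by
    intro x; simp only [Finset.mem_range]; omega
  have hc : s * k / 4 ≤ ((min k (t + 1) : ℕ) : ℝ) := by
    rcases min_cases k (t + 1) with ⟨h, _⟩ | ⟨h, _⟩ <;> rw [h]
    · have : (0 : ℝ) ≤ k := Nat.cast_nonneg k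
      nlinarith
    · push_cast; nlinarith
  calc k * s ^ 2 / 8 = (s * k / 4) * (s / 2) := by ring
    _ ≤ ((min k (t + 1) : ℕ) : ℝ) * (s / 2) := by gcongr
    _ = ∑ j ∈ Finset.range (min k (t + 1)), s / 2 := by simp
    _ ≤ ∑ j ∈ Finset.range (min k (t + 1)), max (s - (j : ℝ) / r) 0 := by
      refine Finset.sum_le_sum fun j hj => ?_
      refine le_max_of_le_left ?_
      have hj1 : j ≤ t := by
        have := Finset.mem_range.mp hj
        omega
      have hj2 : (j : ℝ) ≤ s * r / 2 :=
        (Nat.cast_le.mpr hj1).trans (Nat.floor_le (by positivity))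
      have : (j : ℝ) / r ≤ s / 2 := by
        rw [div_le_iff₀ hr']; linarith
      linarith
    _ ≤ _ := Finset.sum_le_sum_of_subset_of_nonneg hsub fun _ _ _ => le_max_right _ _

theorem exists_weight_le_eval_hasse_ne_zero (n : ℕ) : ∀ ε : ℝ, 0 < ε → ∃ ω : ℝ, 0 < ω ∧
    ∀ (r : Fin n → ℕ) (β : Fin n → ℚ) (L : ℝ) (P : MvPolynomial (Fin n) ℤ), 0 < L →
      (∀ h, 0 < r h) → (∀ h, L ≤ r h * Real.log (β h).den) →
      (∀ i j, i < j → (r i : ℝ) ≤ ω * r j) → P ≠ 0 → (∀ i, degreeOf i P ≤ r i) →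
      Real.log (polyLength P) ≤ ω * L → (∑ h, (r h : ℝ)) ≤ ω * L →
      ∃ I, weight r I ≤ ε ∧ eval β (hasse I (map (Int.castRingHom ℚ) P)) ≠ 0 := by
  induction n with
  | zero =>
    intro ε hε
    refine ⟨1, one_pos, fun r β L P _ _ _ _ hP _ _ _ => ⟨0, ?_, ?_⟩⟩
    · simpa [weight] using hε.le
    · rw [hasse_zero_left, eq_C_of_isEmpty P, map_C, eval_C]
      rw [eq_C_of_isEmpty P] at hP
      simpa using hP
  | succ n ih =>
    have main : ∀ ε : ℝ, 0 < ε → ε ≤ 1 → ∃ ω : ℝ, 0 < ω ∧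
      ∀ (r : Fin (n + 1) → ℕ) (β : Fin (n + 1) → ℚ) (L : ℝ) (P : MvPolynomial (Fin (n + 1)) ℤ),
        0 < L → (∀ h, 0 < r h) → (∀ h, L ≤ r h * Real.log (β h).den) →
        (∀ i j, i < j → (r i : ℝ) ≤ ω * r j) → P ≠ 0 → (∀ i, degreeOf i P ≤ r i) →
        Real.log (polyLength P) ≤ ω * L → (∑ h, (r h : ℝ)) ≤ ω * L →
        ∃ I, weight r I ≤ ε ∧ eval β (hasse I (map (Int.castRingHom ℚ) P)) ≠ 0 := by
      intro ε hε hε1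
      obtain ⟨ω', hω', H⟩ := ih (ε ^ 2 / 128) (by positivity)
      refine ⟨min (ω' / 4) (ε ^ 2 / 512), by positivity, ?_⟩
      set ω := min (ω' / 4) (ε ^ 2 / 512) with hω
      have hω0 : 0 < ω := by positivity
      have hω1 : ω ≤ ω' / 4 := min_le_left _ _
      have hω2 : ω ≤ ε ^ 2 / 512 := min_le_right _ _
      intro r β L P hL hr hLr hrr hP hdeg hlen hsum
      by_contra! hcon
      have hPQ : map (Int.castRingHom ℚ) P ≠ 0 := by
        rw [Ne, map_eq_zero_iff _ (map_injective _ (RingHom.injective_int _))]; exact hP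
      have hordP : OrderGE r β ε (map (Int.castRingHom ℚ) P) := by
        intro I hI
        rw [coeff_mvTaylor] at hI
        by_contra! hlt
        exact hI (hcon I hlt.le)
      obtain ⟨k, b, I, U, V, hk, hkr, hbinj, hb, hI, hU, hV, hUV⟩ :=
        exists_split_wronskian (map (Int.castRingHom ℚ) P) (r 0)
          ((degreeOf_le_iff.mpr fun m hm => degreeOf_le_iff.mp (hdeg 0) m
            (support_map_subset _ _ hm))) hPQ
      set W : MvPolynomial (Fin (n + 1)) ℤ :=
        (Matrix.of fun i j => hasse ((I i).cons (b j)) P).det with hW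
      have hWQ : map (Int.castRingHom ℚ) W = (Matrix.of fun i j =>
          hasse ((I i).cons (b j)) (map (Int.castRingHom ℚ) P)).det := by
        rw [hW, RingHom.map_det]
        congr 1
        ext1 i j
        simp only [RingHom.mapMatrix_apply, Matrix.map_apply, Matrix.of_apply]
        rw [hasse_map]
      rw [← hWQ] at hUV
      have hk1 : (1 : ℝ) ≤ k := by exact_mod_cast hk
      have hr0 : (0 : ℝ) < r 0 := by exact_mod_cast hr 0
      have hr0sum : (r 0 : ℝ) ≤ ∑ h, (r h : ℝ) :=
        Finset.single_le_sum (f := fun h => (r h : ℝ)) (fun _ _ => Nat.cast_nonneg _)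
          (Finset.mem_univ 0)
      -- the order of vanishing of the Wronskian
      have hordW : OrderGE r β (∑ j, max (ε - ω - b j / r 0) 0) (map (Int.castRingHom ℚ) W) := by
        rw [hWQ]
        refine OrderGE.det fun i j => ?_
        simp only [Matrix.of_apply]
        intro J hJ
        refine max_le ?_ (weight_nonneg r J)
        have h1 := hordP.hasse ((I i).cons (b j)) J hJ
        have h2 : weight r ((I i).cons (b j)) ≤ b j / r 0 + ω := by
          rw [weight, Fin.sum_univ_succ]
          simp only [Finsupp.cons_zero, Finsupp.cons_succ]
          gcongr
          calc ∑ h : Fin n, ((I i) h : ℝ) / r h.succ ≤ ∑ h : Fin n, ((I i) h : ℝ) * (ω / r 0) := by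
                refine Finset.sum_le_sum fun h _ => ?_
                rw [div_eq_mul_inv]
                gcongr
                have h3 := hrr 0 h.succ (Fin.succ_pos h)
                have h4 : (0 : ℝ) < r h.succ := by exact_mod_cast hr _
                rw [inv_eq_one_div, div_le_div_iff₀ h4 hr0]; linarith
            _ = ((∑ h, (I i) h : ℕ) : ℝ) * (ω / r 0) := by
                rw [← Finset.sum_mul]; push_cast; rfl
            _ ≤ r 0 * (ω / r 0) := by
                gcongr
                exact (hI i).trans (by omega)
            _ = ω := by field_simp
        linarith
      -- the size of the Wronskian
      have hlenW : polyLength W ≤ Real.exp (3 * ω * (k * L)) := by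
        have h1 : ∀ i j, polyLength ((Matrix.of fun i j => hasse ((I i).cons (b j)) P) i j) ≤
            2 ^ (∑ i, r i) * polyLength P := fun i j => polyLength_hasse_le hdeg _
        refine (polyLength_det_le h1).trans ?_
        have hP1 := one_le_polyLength hP
        have h2 : (k : ℝ) ≤ Real.exp (ω * L) := by
          have := Real.add_one_le_exp (ω * L)
          have : (k : ℝ) ≤ r 0 + 1 := by exact_mod_cast hkr
          linarith
        have h3 : (2 : ℝ) ^ (∑ i, r i) ≤ Real.exp (ω * L) := by
          have h4 : (2 : ℝ) ≤ Real.exp 1 := by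
            have := Real.add_one_le_exp (1 : ℝ); linarith
          calc (2 : ℝ) ^ (∑ i, r i) ≤ (Real.exp 1) ^ (∑ i, r i) := by gcongr
            _ = Real.exp ((∑ i, r i : ℕ) : ℝ) := by rw [← Real.exp_nat_mul, mul_one]
            _ ≤ _ := by
              apply Real.exp_le_exp.mpr
              push_cast; exact hsum
        have h4 : polyLength P ≤ Real.exp (ω * L) := by
          rw [← Real.exp_log (show 0 < polyLength P by linarith)]
          exact Real.exp_le_exp.mpr hlen
        calc ((k : ℝ) * (2 ^ (∑ i, r i) * polyLength P)) ^ k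
            ≤ (Real.exp (ω * L) * (Real.exp (ω * L) * Real.exp (ω * L))) ^ k := by
              gcongr
          _ = Real.exp (3 * ω * (k * L)) := by
              rw [← Real.exp_add, ← Real.exp_add, ← Real.exp_nat_mul]; congr 1; ring
      -- the factor in the remaining variables
      obtain ⟨m, hm⟩ : ∃ m, V.coeff m ≠ 0 := by
        by_contra! h0
        exact hV (Polynomial.ext (by simpa using h0))
      obtain ⟨M, hM⟩ := ne_zero_iff.mp hU
      have hcoef : ∀ (m : ℕ) (M : Fin n →₀ ℕ),
          ((coeff (M.cons m) W : ℤ) : ℚ) = coeff M U * V.coeff m := by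
        intro m M
        have h1 := congrArg (fun f => coeff M (Polynomial.coeff f m)) hUV
        simp only [finSuccEquiv_coeff_coeff, coeff_map, Polynomial.coeff_C_mul,
          Polynomial.coeff_map, mul_comm U, coeff_C_mul] at h1
        rw [mul_comm]; exact h1
      let U' := (finSuccEquiv ℤ n W).coeff m
      have hU'map : map (Int.castRingHom ℚ) U' = C (V.coeff m) * U := by
        ext M
        rw [coeff_map, coeff_C_mul, finSuccEquiv_coeff_coeff]
        have := hcoef m M
        rw [mul_comm] at this
        exact this
      have hU'0 : U' ≠ 0 := by
        intro h0
        rw [h0, map_zero] at hU'map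
        have := mul_ne_zero (C_ne_zero.mpr hm) hU
        exact this hU'map.symm
      have hlenU' : polyLength U' ≤ Real.exp (3 * ω * (k * L)) :=
        (polyLength_coeff_finSuccEquiv_le W m).trans hlenW
      have hkL : 0 < (k : ℝ) * L := by positivity
      obtain ⟨J, hJ, hJne⟩ := H (fun h => k * r h.succ) (β ∘ Fin.succ) (k * L) U'
        hkL (fun h => Nat.mul_pos hk (hr _))
        (fun h => by
          have := mul_le_mul_of_nonneg_left (hLr h.succ) (Nat.cast_nonneg (α := ℝ) k)
          push_cast; simp only [Function.comp_apply]; linarith)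
        (fun i j hij => by
          have h1 := hrr i.succ j.succ (Fin.succ_lt_succ_iff.mpr hij)
          have h2 : (r i.succ : ℝ) ≤ ω' * r j.succ := by
            refine h1.trans ?_
            have : ω ≤ ω' := by linarith
            gcongr
          have := mul_le_mul_of_nonneg_left h2 (Nat.cast_nonneg (α := ℝ) k)
          push_cast; linarith)
        hU'0
        (fun i => (degreeOf_coeff_finSuccEquiv W i m).trans
          (degreeOf_det_le fun a c => (degreeOf_hasse_le _ _ _).trans (hdeg _)))
        (by
          have h1 := Real.log_le_log
            (lt_of_lt_of_le one_pos (one_le_polyLength hU'0)) hlenU'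
          rw [Real.log_exp] at h1
          refine h1.trans ?_
          gcongr
          linarith)
        (by
          push_cast
          rw [← Finset.mul_sum]
          have h1 : ∑ i : Fin n, (r i.succ : ℝ) ≤ ω * L := by
            rw [Fin.sum_univ_succ] at hsum
            linarith
          have h2 : ω * L ≤ ω' * L := by
            gcongr; linarith
          have := mul_le_mul_of_nonneg_left (h1.trans h2) (Nat.cast_nonneg (α := ℝ) k)
          linarith)
      have hJU : eval (β ∘ Fin.succ) (hasse J U) ≠ 0 := by
        rw [hU'map, hasse_C_mul, map_mul] at hJne
        exact right_ne_zero_of_mul hJne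
      -- the factor in the first variable
      let V' : Polynomial ℤ :=
        ∑ m ∈ Finset.range (V.natDegree + 1), Polynomial.monomial m (coeff (M.cons m) W)
      have hV'c : ∀ m, V'.coeff m = coeff (M.cons m) W := by
        intro m
        simp only [V', Polynomial.finsetSum_coeff, Polynomial.coeff_monomial,
          Finset.sum_ite_eq', Finset.mem_range]
        split_ifs with h
        · rfl
        · have h1 := hcoef m M
          rw [Polynomial.coeff_eq_zero_of_natDegree_lt (by omega), mul_zero] at h1
          exact_mod_cast h1.symm
      have hV'map : V'.map (Int.castRingHom ℚ) = Polynomial.C (coeff M U) * V := by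
        ext m
        rw [Polynomial.coeff_map, Polynomial.coeff_C_mul, hV'c]
        exact hcoef m M
      have hV'0 : V' ≠ 0 := by
        intro h0
        rw [h0, Polynomial.map_zero] at hV'map
        exact mul_ne_zero (Polynomial.C_ne_zero.mpr hM) hV hV'map.symm
      obtain ⟨l, hl, hlden⟩ := exists_taylor_coeff_ne_zero V' hV'0 (β 0)
      have hlV : (Polynomial.hasseDeriv l V).eval (β 0) ≠ 0 := by
        rw [hV'map, ← Polynomial.smul_eq_C_mul, map_smul, Polynomial.eval_smul] at hl
        exact right_ne_zero_of_mul hl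
      have hl2 : (l : ℝ) ≤ 3 * ω * k * r 0 := by
        have h1 : ((β 0).den : ℝ) ^ l ≤ Real.exp (3 * ω * (k * L)) := by
          refine hlden.trans (le_trans ?_ hlenW)
          rw [Polynomial.leadingCoeff, hV'c]
          exact abs_coeff_le_polyLength W _
        have hden : (0 : ℝ) < (β 0).den := by exact_mod_cast (β 0).den_pos
        have h2 := Real.log_le_log (pow_pos hden l) h1
        rw [Real.log_exp, Real.log_pow] at h2
        have h3 : (l : ℝ) * L ≤ l * (r 0 * Real.log (β 0).den) :=
          mul_le_mul_of_nonneg_left (hLr 0) (Nat.cast_nonneg l)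
        have h4 : (l : ℝ) * L ≤ (3 * ω * k * r 0) * L := by
          calc (l : ℝ) * L ≤ r 0 * (l * Real.log (β 0).den) := by linarith
            _ ≤ r 0 * (3 * ω * (k * L)) := by gcongr
            _ = _ := by ring
        exact le_of_mul_le_mul_right h4 hL
      have hne : coeff (J.cons l) (mvTaylor β (map (Int.castRingHom ℚ) W)) ≠ 0 := by
        rw [coeff_mvTaylor, eval_hasse_cons_of_eq hUV]
        exact mul_ne_zero hJU hlV
      have hfin := hordW _ hne
      have hw : weight r (J.cons l) = l / r 0 + k * weight (fun h => k * r h.succ) J := by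
        rw [weight, Fin.sum_univ_succ, weight, Finset.mul_sum]
        simp only [Finsupp.cons_zero, Finsupp.cons_succ]
        congr 1
        refine Finset.sum_congr rfl fun h _ => ?_
        have : (r h.succ : ℝ) ≠ 0 := by exact_mod_cast (hr h.succ).ne'
        push_cast
        field_simp
      have hs : 0 < ε - ω := by nlinarith
      have hlow := le_sum_max_sub (hr 0) hkr hbinj hb hs (by linarith)
      have h5 : (l : ℝ) / r 0 ≤ 3 * ω * k := by
        rw [div_le_iff₀ hr0]; exact hl2
      have h6 : (k : ℝ) * weight (fun h => k * r h.succ) J ≤ k * (ε ^ 2 / 128) := by gcongr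
      have h7 : (k : ℝ) * (ε - ω) ^ 2 / 8 ≤ k * (3 * ω + ε ^ 2 / 128) := by
        linarith
      have h8 : (ε - ω) ^ 2 / 8 ≤ 3 * ω + ε ^ 2 / 128 := by
        have : (k : ℝ) * ((ε - ω) ^ 2 / 8) ≤ k * (3 * ω + ε ^ 2 / 128) := by linarith
        exact le_of_mul_le_mul_left this (by linarith)
      have h9 : ε / 2 ≤ ε - ω := by nlinarith
      nlinarith
    intro ε hε
    obtain ⟨ω, hω, H⟩ := main (min ε 1) (by positivity) (min_le_right _ _)
    refine ⟨ω, hω, fun r β L P h1 h2 h3 h4 h5 h6 h7 h8 => ?_⟩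
    obtain ⟨I, hI, hI2⟩ := H r β L P h1 h2 h3 h4 h5 h6 h7 h8
    exact ⟨I, hI.trans (min_le_left _ _), hI2⟩

end RothLemma

section AuxiliaryPolynomial

theorem exists_int_vec_small {ι κ : Type*} [Fintype ι] [Fintype κ] (A : Matrix ι κ ℤ) {T : ℝ}
    (hT : 1 ≤ T) (hA : ∀ i j, |(A i j : ℝ)| ≤ T) (hcard : 2 * Fintype.card ι ≤ Fintype.card κ)
    (hκ : 0 < Fintype.card κ) :
    ∃ t : κ → ℤ, t ≠ 0 ∧ A.mulVec t = 0 ∧ ∀ j, |(t j : ℝ)| ≤ Fintype.card κ * T := by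
  let _ := Matrix.seminormedAddCommGroup (m := ι) (n := κ) (α := ℤ)
  have hκ1 : (1 : ℝ) ≤ Fintype.card κ := by exact_mod_cast hκ
  rcases Nat.eq_zero_or_pos (Fintype.card ι) with h0 | h0
  · refine ⟨1, ?_, ?_, fun j => ?_⟩
    · obtain ⟨j⟩ := Fintype.card_pos_iff.mp hκ
      intro h; exact one_ne_zero (congrFun h j)
    · ext i; exact ((Fintype.card_eq_zero_iff.mp h0).false i).elim
    · simp only [Pi.one_apply, Int.cast_one, abs_one]; nlinarith
  · obtain ⟨t, ht0, ht, hn⟩ := Int.Matrix.exists_ne_zero_int_vec_norm_le A (by omega) h0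
    refine ⟨t, ht0, ht, fun j => ?_⟩
    have hn1 : ‖A‖ ≤ T := (Matrix.norm_le_iff (by linarith)).mpr fun i j => by
      rw [Int.norm_eq_abs]; exact hA i j
    have h1 : |(t j : ℝ)| ≤ ‖t‖ := by
      rw [← Int.norm_eq_abs]; exact norm_le_pi_norm t j
    refine h1.trans (hn.trans ?_)
    have hb : 1 ≤ (Fintype.card κ : ℝ) * max 1 ‖A‖ := by
      nlinarith [le_max_left (1 : ℝ) ‖A‖]
    have hc : (2 * Fintype.card ι : ℝ) ≤ Fintype.card κ := by exact_mod_cast hcard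
    have h0' : (0 : ℝ) < Fintype.card ι := by exact_mod_cast h0
    calc ((Fintype.card κ : ℝ) * max 1 ‖A‖) ^ ((Fintype.card ι : ℝ) /
          (Fintype.card κ - Fintype.card ι))
        ≤ ((Fintype.card κ : ℝ) * max 1 ‖A‖) ^ (1 : ℝ) := by
          apply Real.rpow_le_rpow_of_exponent_le hb
          rw [div_le_one (by linarith)]; linarith
      _ = (Fintype.card κ : ℝ) * max 1 ‖A‖ := Real.rpow_one _
      _ ≤ _ := by
          gcongr
          exact max_le hT hn1

theorem exists_pow_eq_sum (α : ℝ) (hα : IsIntegral ℤ α) :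
    ∃ (D : ℕ) (K : ℝ), 0 < D ∧ 1 ≤ K ∧ ∀ N : ℕ, ∃ a : Fin D → ℤ,
      (∀ l, |(a l : ℝ)| ≤ K ^ N) ∧ α ^ N = ∑ l, (a l : ℝ) * α ^ (l : ℕ) := by
  obtain ⟨p, hp, hpα⟩ := hα
  -- multiplying by `X` avoids the degenerate case of degree zero
  let D := p.natDegree + 1
  let q : Polynomial ℤ := Polynomial.X * p
  have hq : q.Monic := Polynomial.monic_X.mul hp
  have hqd : q.natDegree = p.natDegree + 1 := Polynomial.natDegree_X_mul hp.ne_zero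
  have hroot : α ^ (p.natDegree + 1) = ∑ l : Fin (p.natDegree + 1),
      ((-q.coeff l : ℤ) : ℝ) * α ^ (l : ℕ) := by
    have h1 : Polynomial.eval₂ (algebraMap ℤ ℝ) α q = 0 := by
      simp only [q, Polynomial.eval₂_mul, hpα, mul_zero]
    rw [hq.as_sum, Polynomial.eval₂_add, Polynomial.eval₂_finsetSum] at h1
    simp only [Polynomial.eval₂_mul, Polynomial.eval₂_pow, Polynomial.eval₂_X,
      Polynomial.eval₂_C, hqd, Finset.sum_range, algebraMap_int_eq] at h1
    simp only [eq_intCast] at h1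
    simp only [Int.cast_neg, neg_mul, Finset.sum_neg_distrib]
    linarith
  let K : ℝ := 1 + ∑ l : Fin (p.natDegree + 1), |((-q.coeff l : ℤ) : ℝ)|
  have hK : 1 ≤ K := by
    have : 0 ≤ ∑ l : Fin (p.natDegree + 1), |((-q.coeff l : ℤ) : ℝ)| :=
      Finset.sum_nonneg fun _ _ => abs_nonneg _
    simp only [K]; linarith
  refine ⟨p.natDegree + 1, K, Nat.succ_pos _, hK, fun N => ?_⟩
  induction N with
  | zero =>
    refine ⟨Pi.single 0 1, fun l => ?_, ?_⟩
    · rw [pow_zero]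
      by_cases h : l = 0
      · subst h; simp
      · simp [Pi.single_eq_of_ne h]
    · simp [Fin.sum_univ_succ]
  | succ N ih =>
    obtain ⟨a, ha, hN⟩ := ih
    let a' : Fin (p.natDegree + 1) → ℤ := fun l =>
      (if h : (l : ℕ) = 0 then 0 else a ⟨l - 1, by omega⟩) +
        a (Fin.last _) * (-q.coeff l)
    refine ⟨a', fun l => ?_, ?_⟩
    · have h1 : |((a (Fin.last _) : ℤ) : ℝ) * ((-q.coeff l : ℤ) : ℝ)| ≤
          K ^ N * |((-q.coeff l : ℤ) : ℝ)| := by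
        rw [abs_mul]; exact mul_le_mul_of_nonneg_right (ha _) (abs_nonneg _)
      have h2 : |((if h : (l : ℕ) = 0 then 0 else a ⟨l - 1, by omega⟩ : ℤ) : ℝ)| ≤ K ^ N := by
        split_ifs
        · simp; positivity
        · exact ha _
      have h3 : |((-q.coeff l : ℤ) : ℝ)| ≤ K - 1 := by
        have := Finset.single_le_sum (f := fun l : Fin (p.natDegree + 1) =>
          |((-q.coeff l : ℤ) : ℝ)|) (fun _ _ => abs_nonneg _) (Finset.mem_univ l)
        simp only [K]; linarith
      have h4 : K ^ N * |((-q.coeff l : ℤ) : ℝ)| ≤ K ^ N * (K - 1) := by gcongr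
      simp only [a']
      rw [Int.cast_add, Int.cast_mul]
      refine (abs_add_le _ _).trans ?_
      rw [pow_succ]; linarith
    · rw [pow_succ, hN, Fin.sum_univ_castSucc, add_mul, Finset.sum_mul]
      have h1 : (a (Fin.last p.natDegree) : ℝ) * α ^ ((Fin.last p.natDegree : Fin _) : ℕ) * α =
          a (Fin.last p.natDegree) * α ^ (p.natDegree + 1) := by
        rw [Fin.val_last]; ring
      rw [h1, hroot, Finset.mul_sum]
      simp only [a']
      simp only [Int.cast_add, Int.cast_mul, add_mul, Finset.sum_add_distrib]
      congr 1
      · rw [Fin.sum_univ_succ]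
        rw [dif_pos (Fin.val_zero _), Int.cast_zero, zero_mul, zero_add]
        refine Finset.sum_congr rfl fun l _ => ?_
        rw [dif_neg (by simp)]
        simp only [Fin.val_succ, Nat.add_sub_cancel]
        rw [pow_succ, ← mul_assoc]
        rfl
      · refine Finset.sum_congr rfl fun l _ => ?_
        ring

theorem eval_const_hasse {m : ℕ} (α : ℝ) (I : Fin m →₀ ℕ) (P : MvPolynomial (Fin m) ℤ)
    {s : Finset (Fin m →₀ ℕ)} (hs : P.support ⊆ s) :
    eval (fun _ => α) (hasse I (map (Int.castRingHom ℝ) P)) =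
      ∑ J ∈ s, ((coeff J P : ℤ) : ℝ) * ((multiChoose J I : ℝ) * α ^ (∑ h, (J h - I h))) := by
  rw [hasse_map, hasse, map_sum, map_sum]
  rw [← Finset.sum_subset hs (fun J _ hJ => by rw [notMem_support_iff.mp hJ]; simp)]
  refine Finset.sum_congr rfl fun J _ => ?_
  rw [map_monomial, eval_monomial, Finsupp.prod_fintype _ _ (by simp),
    Finset.prod_pow_eq_pow_sum]
  simp only [Finsupp.tsub_apply, eq_intCast]
  push_cast; ring

theorem exists_auxiliary_polynomial (α : ℝ) (hα : IsIntegral ℤ α) :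
    ∃ (D : ℕ) (K : ℝ), 0 < D ∧ 1 ≤ K ∧ ∀ (m : ℕ) (r : Fin m → ℕ) (S : Finset (Fin m →₀ ℕ)),
      2 * (D * S.card) ≤ ∏ h, (r h + 1) → ∃ P : MvPolynomial (Fin m) ℤ, P ≠ 0 ∧
        (∀ h, degreeOf h P ≤ r h) ∧ polyLength P ≤ K ^ (∑ h, r h) ∧
        ∀ I ∈ S, eval (fun _ => α) (hasse I (map (Int.castRingHom ℝ) P)) = 0 := by
  classical
  obtain ⟨D, A, hD, hA, hpow⟩ := exists_pow_eq_sum α hα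
  choose a ha hαa using hpow
  refine ⟨D, 2 * (2 * (2 * A)), hD, by linarith, fun m r S hS => ?_⟩
  let κ := ∀ h : Fin m, Fin (r h + 1)
  let toF : κ → (Fin m →₀ ℕ) := fun j => Finsupp.equivFunOnFinite.symm fun h => (j h : ℕ)
  have hinj : Function.Injective toF := by
    intro j j' h
    have := Finsupp.equivFunOnFinite.symm.injective h
    funext i
    exact Fin.ext (congrFun this i)
  have hcardκ : Fintype.card κ = ∏ h, (r h + 1) := by simp [κ, Fintype.card_pi]
  let s : Finset (Fin m →₀ ℕ) := Finset.univ.map ⟨toF, hinj⟩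
  let M : Matrix (S × Fin D) κ ℤ := Matrix.of fun il j =>
    multiChoose (toF j) il.1 * a (∑ h, (toF j h - (il.1 : Fin m →₀ ℕ) h)) il.2
  have hle : ∀ j h, toF j h ≤ r h := fun j h => Nat.lt_succ_iff.mp (j h).2
  have hMle : ∀ i j, |(M i j : ℝ)| ≤ (2 * A) ^ (∑ h, r h) := by
    intro i j
    simp only [M, Matrix.of_apply]
    push_cast
    rw [abs_mul, Nat.abs_cast, mul_pow]
    have h1 : multiChoose (toF j) i.1 ≤ 2 ^ ∑ h, r h := by
      rw [← Finset.prod_pow_eq_pow_sum, multiChoose]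
      refine Finset.prod_le_prod' fun h _ => ?_
      exact (Nat.choose_le_two_pow _ _).trans (Nat.pow_le_pow_right (by norm_num) (hle j h))
    have h2 : |(a (∑ h, (toF j h - (i.1 : Fin m →₀ ℕ) h)) i.2 : ℝ)| ≤ A ^ (∑ h, r h) := by
      refine (ha _ _).trans (pow_le_pow_right₀ hA ?_)
      exact Finset.sum_le_sum fun h _ => (Nat.sub_le _ _).trans (hle j h)
    gcongr
    exact_mod_cast h1
  obtain ⟨t, ht0, htM, ht⟩ := exists_int_vec_small M (one_le_pow₀ (by linarith)) hMle
    (by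
      rw [hcardκ, Fintype.card_prod, Fintype.card_coe, Fintype.card_fin, mul_comm S.card]
      exact hS)
    (by rw [hcardκ]; positivity)
  let P : MvPolynomial (Fin m) ℤ := ∑ j, monomial (toF j) (t j)
  have hPc : ∀ j, coeff (toF j) P = t j := by
    intro j
    simp only [P, coeff_sum, coeff_monomial]
    rw [Finset.sum_eq_single j (fun b _ hb => if_neg fun h => hb (hinj h))
      (fun h => absurd (Finset.mem_univ j) h), if_pos rfl]
  have hPs : P.support ⊆ s := by
    intro J hJ
    rw [mem_support_iff] at hJ
    simp only [P, coeff_sum, coeff_monomial] at hJ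
    obtain ⟨j, _, hj⟩ := Finset.exists_ne_zero_of_sum_ne_zero hJ
    have : toF j = J := by
      by_contra h; exact hj (if_neg h)
    exact Finset.mem_map.mpr ⟨j, Finset.mem_univ j, this⟩
  refine ⟨P, ?_, ?_, ?_, ?_⟩
  · intro h0
    apply ht0
    funext j
    rw [← hPc j, h0]; simp
  · intro h
    rw [degreeOf_le_iff]
    intro J hJ
    obtain ⟨j, _, rfl⟩ := Finset.mem_map.mp (hPs hJ)
    exact hle j h
  · rw [polyLength_eq_sum hPs, Finset.sum_map]
    have h1 : ∀ j : κ, |((coeff (toF j) P : ℤ) : ℝ)| ≤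
        Fintype.card κ * (2 * A) ^ (∑ h, r h) := by
      intro j; rw [hPc]; exact ht j
    refine (Finset.sum_le_sum fun j _ => h1 j).trans ?_
    rw [Finset.sum_const, Finset.card_univ, nsmul_eq_mul, mul_pow 2 (2 * (2 * A)),
      mul_pow 2 (2 * A)]
    have h2 : (Fintype.card κ : ℝ) ≤ 2 ^ (∑ h, r h) := by
      rw [hcardκ, ← Finset.prod_pow_eq_pow_sum]
      push_cast
      refine Finset.prod_le_prod (fun _ _ => by positivity) fun h _ => ?_
      exact_mod_cast Nat.lt_two_pow_self (n := r h)
    gcongr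
  · intro I hI
    rw [eval_const_hasse α I P hPs, Finset.sum_map]
    simp only [Function.Embedding.coeFn_mk]
    have h1 : ∀ l : Fin D, ∑ j, (M (⟨I, hI⟩, l) j : ℝ) * t j = 0 := by
      intro l
      have := congrFun htM (⟨I, hI⟩, l)
      simp only [Matrix.mulVec, dotProduct, Pi.zero_apply] at this
      exact_mod_cast this
    have h2 : ∀ j, ((coeff (toF j) P : ℤ) : ℝ) * ((multiChoose (toF j) I : ℝ) *
        α ^ (∑ h, (toF j h - I h))) =
        ∑ l : Fin D, ((M (⟨I, hI⟩, l) j : ℝ) * t j) * α ^ (l : ℕ) := by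
      intro j
      rw [hPc, hαa, Finset.mul_sum, Finset.mul_sum]
      refine Finset.sum_congr rfl fun l _ => ?_
      simp only [M, Matrix.of_apply]
      push_cast; ring
    rw [Finset.sum_congr rfl fun j _ => h2 j, Finset.sum_comm]
    refine Finset.sum_eq_zero fun l _ => ?_
    rw [← Finset.sum_mul, h1, zero_mul]

end AuxiliaryPolynomial

section Counting

theorem sum_sq_sum_le {ι : Type*} [Fintype ι] {m : ℕ} (x : ι → Fin m → ℝ) {c : ℝ}
    (hoff : ∀ h h', h ≠ h' → ∑ j, x j h * x j h' = 0) (hdiag : ∀ h, ∑ j, x j h * x j h ≤ c) :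
    ∑ j, (∑ h, x j h) ^ 2 ≤ m * c := by
  simp only [sq, Finset.sum_mul_sum]
  rw [Finset.sum_comm]
  have h1 : ∀ h : Fin m, ∑ j, ∑ h', x j h * x j h' ≤ c := by
    intro h
    rw [Finset.sum_comm, Finset.sum_eq_single h (fun h' _ hne => hoff h h' hne.symm)
      (fun hh => absurd (Finset.mem_univ h) hh)]
    exact hdiag h
  refine (Finset.sum_le_sum fun h _ => h1 h).trans ?_
  rw [Finset.sum_const, Finset.card_univ, Fintype.card_fin, nsmul_eq_mul]

theorem sum_sq_sum_sub_le {m : ℕ} (r : Fin m → ℕ) (hr : ∀ h, 0 < r h) :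
    ∑ j : (∀ h, Fin (r h + 1)), (∑ h, (((j h : ℕ) : ℝ) / r h - 1 / 2)) ^ 2 ≤
      (∏ h, ((r h : ℝ) + 1)) * (m / 4) := by
  classical
  have hoff : ∀ h h' : Fin m, h ≠ h' → ∑ j : (∀ h, Fin (r h + 1)),
      (((j h : ℕ) : ℝ) / r h - 1 / 2) * (((j h' : ℕ) : ℝ) / r h' - 1 / 2) = 0 := by
    intro h h' hne
    let e : (∀ h, Fin (r h + 1)) → (∀ h, Fin (r h + 1)) :=
      fun j => Function.update j h (Fin.rev (j h))
    have he : Function.Involutive e := by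
      intro j; simp [e]
    have h1 := (he.toPerm).sum_comp Finset.univ (fun j : (∀ h, Fin (r h + 1)) =>
      (((j h : ℕ) : ℝ) / r h - 1 / 2) * (((j h' : ℕ) : ℝ) / r h' - 1 / 2)) (by simp)
    have h2 : ∀ j : (∀ h, Fin (r h + 1)), ((((e j) h : ℕ) : ℝ) / r h - 1 / 2) *
        ((((e j) h' : ℕ) : ℝ) / r h' - 1 / 2) =
        -((((j h : ℕ) : ℝ) / r h - 1 / 2) * (((j h' : ℕ) : ℝ) / r h' - 1 / 2)) := by
      intro j
      have h3 : (e j) h' = j h' := Function.update_of_ne hne.symm _ _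
      have h4 : (((e j) h : ℕ) : ℝ) = r h - ((j h : ℕ) : ℝ) := by
        have : (j h : ℕ) ≤ r h := Nat.lt_succ_iff.mp (j h).2
        simp only [e, Function.update_self, Fin.val_rev]
        rw [Nat.add_sub_add_right, Nat.cast_sub this]
      have h5 : (r h : ℝ) ≠ 0 := by exact_mod_cast (hr h).ne'
      rw [h3, h4, sub_div, div_self h5]; ring
    have h6 : ∑ j : (∀ h, Fin (r h + 1)), ((((e j) h : ℕ) : ℝ) / r h - 1 / 2) *
        ((((e j) h' : ℕ) : ℝ) / r h' - 1 / 2) = _ := h1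
    rw [Finset.sum_congr rfl fun j _ => h2 j, Finset.sum_neg_distrib] at h6
    linarith
  have hdiag : ∀ h : Fin m, ∑ j : (∀ h, Fin (r h + 1)),
      (((j h : ℕ) : ℝ) / r h - 1 / 2) * (((j h : ℕ) : ℝ) / r h - 1 / 2) ≤
        (∏ h, ((r h : ℝ) + 1)) * (1 / 4) := by
    intro h
    have h1 : ∀ j : (∀ h, Fin (r h + 1)),
        (((j h : ℕ) : ℝ) / r h - 1 / 2) * (((j h : ℕ) : ℝ) / r h - 1 / 2) ≤ 1 / 4 := by
      intro j
      have h5 : (0 : ℝ) < r h := by exact_mod_cast hr h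
      have h6 : ((j h : ℕ) : ℝ) / r h ≤ 1 := by
        rw [div_le_one h5]; exact_mod_cast Nat.lt_succ_iff.mp (j h).2
      have h7 : 0 ≤ ((j h : ℕ) : ℝ) / r h := by positivity
      nlinarith
    refine (Finset.sum_le_sum fun j _ => h1 j).trans ?_
    rw [Finset.sum_const, Finset.card_univ, Fintype.card_pi, nsmul_eq_mul]
    simp
  refine (sum_sq_sum_le (fun (j : ∀ h, Fin (r h + 1)) h => ((j h : ℕ) : ℝ) / r h - 1 / 2)
    hoff hdiag).trans (le_of_eq ?_)
  ring

theorem exists_finset_weight_le {m : ℕ} (r : Fin m → ℕ) (hr : ∀ h, 0 < r h) {ε : ℝ} (hε : 0 < ε) :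
    ∃ S : Finset (Fin m →₀ ℕ), (S.card : ℝ) * (4 * ε ^ 2 * m) ≤ ∏ h, ((r h : ℝ) + 1) ∧
      ∀ I : Fin m →₀ ℕ, (∀ h, I h ≤ r h) → weight r I ≤ m * (1 / 2 - ε) → I ∈ S := by
  classical
  let toF : (∀ h, Fin (r h + 1)) → (Fin m →₀ ℕ) :=
    fun j => Finsupp.equivFunOnFinite.symm fun h => (j h : ℕ)
  let S' : Finset (∀ h, Fin (r h + 1)) :=
    Finset.univ.filter fun j => weight r (toF j) ≤ m * (1 / 2 - ε)
  refine ⟨S'.image toF, ?_, ?_⟩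
  · rcases Nat.eq_zero_or_pos m with rfl | hm
    · simp
    have hm' : (0 : ℝ) < m := by exact_mod_cast hm
    have h1 : ∀ j ∈ S', (ε * m) ^ 2 ≤ (∑ h, (((j h : ℕ) : ℝ) / r h - 1 / 2)) ^ 2 := by
      intro j hj
      have h2 : ∑ h, (((j h : ℕ) : ℝ) / r h) ≤ m * (1 / 2 - ε) := (Finset.mem_filter.mp hj).2
      rw [Finset.sum_sub_distrib, Finset.sum_const, Finset.card_univ, Fintype.card_fin,
        nsmul_eq_mul]
      have : 0 < ε * m := by positivity
      nlinarith
    have h2 : (S'.card : ℝ) * (ε * m) ^ 2 ≤ (∏ h, ((r h : ℝ) + 1)) * (m / 4) := by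
      refine le_trans ?_ (sum_sq_sum_sub_le r hr)
      have h3 := Finset.card_nsmul_le_sum S' _ _ h1
      rw [nsmul_eq_mul] at h3
      exact h3.trans (Finset.sum_le_univ_sum_of_nonneg fun j => sq_nonneg _)
    have h3 : ((S'.image toF).card : ℝ) ≤ S'.card := by exact_mod_cast Finset.card_image_le
    have h4 : (S'.card : ℝ) * (4 * ε ^ 2 * m) ≤ ∏ h, ((r h : ℝ) + 1) := by
      have h5 : ((S'.card : ℝ) * (4 * ε ^ 2 * m)) * (m / 4) ≤
          (∏ h, ((r h : ℝ) + 1)) * (m / 4) := by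
        calc _ = (S'.card : ℝ) * (ε * m) ^ 2 := by ring
          _ ≤ _ := h2
      exact le_of_mul_le_mul_right h5 (by positivity)
    refine le_trans ?_ h4
    gcongr
  · intro I hI hw
    let j : ∀ h, Fin (r h + 1) := fun h => ⟨I h, Nat.lt_succ_iff.mpr (hI h)⟩
    have hj : toF j = I := by ext h; rfl
    rw [← hj]
    exact Finset.mem_image_of_mem _ (Finset.mem_filter.mpr ⟨Finset.mem_univ j, by rwa [hj]⟩)

end Counting

section Roth

theorem one_le_abs_eval_mul_prod_den {m : ℕ} {r : Fin m → ℕ} {G : MvPolynomial (Fin m) ℤ}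
    (hr : ∀ h, degreeOf h G ≤ r h) (β : Fin m → ℚ)
    (h0 : eval β (map (Int.castRingHom ℚ) G) ≠ 0) :
    1 ≤ |((eval β (map (Int.castRingHom ℚ) G) : ℚ) : ℝ)| * ∏ h, ((β h).den : ℝ) ^ r h := by
  have h1 : ∃ N : ℤ, eval β (map (Int.castRingHom ℚ) G) * ∏ h, ((β h).den : ℚ) ^ r h = N := by
    refine ⟨∑ J ∈ G.support, coeff J G * ∏ h, ((β h).num ^ J h * ((β h).den : ℤ) ^ (r h - J h)), ?_⟩
    rw [eval_map, eval₂_eq', Finset.sum_mul]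
    push_cast
    refine Finset.sum_congr rfl fun J hJ => ?_
    rw [mul_assoc, ← Finset.prod_mul_distrib, eq_intCast]
    congr 1
    refine Finset.prod_congr rfl fun h _ => ?_
    have hle : J h ≤ r h := (degreeOf_le_iff.mp (hr h)) J hJ
    have h2 : ((β h).num : ℚ) = β h * (β h).den := (Rat.mul_den_eq_num _).symm
    rw [h2, mul_pow, mul_assoc, ← pow_add, Nat.add_sub_cancel' hle]
  obtain ⟨N, hN⟩ := h1
  have hpos : (0 : ℝ) < ∏ h, ((β h).den : ℝ) ^ r h :=
    Finset.prod_pos fun h _ => pow_pos (by exact_mod_cast (β h).den_pos) _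
  have hN0 : N ≠ 0 := by
    rintro rfl
    rw [Int.cast_zero, mul_eq_zero] at hN
    rcases hN with hN | hN
    · exact h0 hN
    · exact (Finset.prod_ne_zero_iff.mpr fun h _ =>
        pow_ne_zero _ (by exact_mod_cast (β h).den_nz)) hN
  have h2 : ((eval β (map (Int.castRingHom ℚ) G) : ℚ) : ℝ) * ∏ h, ((β h).den : ℝ) ^ r h = N := by
    exact_mod_cast congrArg (fun x : ℚ => (x : ℝ)) hN
  rw [← abs_of_pos hpos, ← abs_mul, h2]
  exact_mod_cast Int.one_le_abs hN0

theorem abs_eval_le_polyLength {m : ℕ} {r : Fin m → ℕ} {G : MvPolynomial (Fin m) ℤ}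
    (hr : ∀ h, degreeOf h G ≤ r h) (α : ℝ) :
    |eval (fun _ => α) (map (Int.castRingHom ℝ) G)| ≤
      polyLength G * max 1 |α| ^ (∑ h, r h) := by
  rw [eval_map, eval₂_eq', polyLength, Finset.sum_mul]
  refine (Finset.abs_sum_le_sum_abs _ _).trans (Finset.sum_le_sum fun J hJ => ?_)
  rw [abs_mul, eq_intCast, Finset.prod_pow_eq_pow_sum, abs_pow]
  gcongr
  calc |α| ^ (∑ h, J h) ≤ max 1 |α| ^ (∑ h, J h) := by gcongr; exact le_max_right _ _
    _ ≤ _ := pow_le_pow_right₀ (le_max_left _ _)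
      (Finset.sum_le_sum fun h _ => (degreeOf_le_iff.mp (hr h)) J hJ)

theorem hasse_eq_zero_of_not_le {m : ℕ} {r : Fin m → ℕ} {G : MvPolynomial (Fin m) ℝ}
    (hr : ∀ h, degreeOf h G ≤ r h) {J : Fin m →₀ ℕ} (hJ : ¬ ∀ h, J h ≤ r h) :
    hasse J G = 0 := by
  push Not at hJ
  obtain ⟨h, hh⟩ := hJ
  ext K
  rw [coeff_hasse, coeff_zero]
  have : coeff (K + J) G = 0 := by
    by_contra hne
    have := (degreeOf_le_iff.mp (hr h)) _ (mem_support_iff.mpr hne)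
    rw [Finsupp.add_apply] at this
    omega
  rw [this, mul_zero]

theorem abs_eval_hasse_le {m : ℕ} {r : Fin m → ℕ} {P : MvPolynomial (Fin m) ℤ}
    (hr : ∀ h, degreeOf h P ≤ r h) (α : ℝ) (I : Fin m →₀ ℕ) (β : Fin m → ℝ) {T : ℝ}
    (hT : ∀ J : Fin m →₀ ℕ, (∀ h, (I + J) h ≤ r h) →
      eval (fun _ => α) (hasse (I + J) (map (Int.castRingHom ℝ) P)) ≠ 0 →
      ∏ h, |β h - α| ^ J h ≤ T) (hT0 : 0 ≤ T) :
    |eval β (hasse I (map (Int.castRingHom ℝ) P))| ≤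
      (8 * max 1 |α|) ^ (∑ h, r h) * polyLength P * T := by
  classical
  set PR := map (Int.castRingHom ℝ) P with hPR
  have hrR : ∀ h, degreeOf h PR ≤ r h := by
    intro h
    rw [degreeOf_le_iff]
    intro J hJ
    exact (degreeOf_le_iff.mp (hr h)) J (support_map_subset _ _ hJ)
  set H := mvTaylor (fun _ => α) (hasse I PR) with hH
  have hev : eval β (hasse I PR) = eval (fun h => β h - α) H := by
    have : (eval (fun h => β h - α)).comp (mvTaylor (fun _ : Fin m => α)).toRingHom = eval β := by
      apply MvPolynomial.ringHom_ext
      · intro c; simp [mvTaylor]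
      · intro i; simp [mvTaylor]
    rw [← this]; rfl
  let toF : (∀ h, Fin (r h + 1)) → (Fin m →₀ ℕ) :=
    fun j => Finsupp.equivFunOnFinite.symm fun h => (j h : ℕ)
  let s : Finset (Fin m →₀ ℕ) := Finset.univ.image toF
  have hcoeff : ∀ J, coeff J H = (multiChoose (I + J) I : ℝ) *
      eval (fun _ => α) (hasse (I + J) PR) := by
    intro J
    rw [hH, coeff_mvTaylor_hasse, coeff_mvTaylor]
  have hzero : ∀ J, (¬ ∀ h, (I + J) h ≤ r h) → coeff J H = 0 := by
    intro J hJ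
    rw [hcoeff, hasse_eq_zero_of_not_le hrR hJ, map_zero, mul_zero]
  have hs : H.support ⊆ s := by
    intro J hJ
    have hJr : ∀ h, (I + J) h ≤ r h := by
      by_contra hn
      exact mem_support_iff.mp hJ (hzero J hn)
    refine Finset.mem_image.mpr ⟨fun h => ⟨J h, ?_⟩, Finset.mem_univ _, ?_⟩
    · have := hJr h
      rw [Finsupp.add_apply] at this
      omega
    · ext h; rfl
  have hterm : ∀ J, |coeff J H * ∏ h, (β h - α) ^ J h| ≤
      (4 * max 1 |α|) ^ (∑ h, r h) * polyLength P * T := by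
    intro J
    have hnn : 0 ≤ (4 * max 1 |α|) ^ (∑ h, r h) * polyLength P * T := by
      have := polyLength_nonneg P
      positivity
    by_cases hJ : ∀ h, (I + J) h ≤ r h
    swap
    · rw [hzero J hJ, zero_mul, abs_zero]; exact hnn
    by_cases h0 : eval (fun _ => α) (hasse (I + J) PR) = 0
    · rw [hcoeff, h0, mul_zero, zero_mul, abs_zero]; exact hnn
    rw [abs_mul, hcoeff, abs_mul, Nat.abs_cast, Finset.abs_prod]
    simp only [abs_pow]
    have h1 : (multiChoose (I + J) I : ℝ) ≤ 2 ^ (∑ h, r h) := by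
      have : multiChoose (I + J) I ≤ 2 ^ ∑ h, r h := by
        rw [← Finset.prod_pow_eq_pow_sum, multiChoose]
        refine Finset.prod_le_prod' fun h _ => ?_
        exact (Nat.choose_le_two_pow _ _).trans (Nat.pow_le_pow_right (by norm_num) (hJ h))
      exact_mod_cast this
    have h2 : |eval (fun _ => α) (hasse (I + J) PR)| ≤
        (2 ^ (∑ h, r h) * polyLength P) * max 1 |α| ^ (∑ h, r h) := by
      rw [hPR, hasse_map]
      refine (abs_eval_le_polyLength
        (fun h => (degreeOf_hasse_le h (I + J) P).trans (hr h)) α).trans ?_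
      gcongr
      exact polyLength_hasse_le hr _
    have hl := polyLength_nonneg P
    calc _ ≤ 2 ^ (∑ h, r h) * ((2 ^ (∑ h, r h) * polyLength P) * max 1 |α| ^ (∑ h, r h)) * T := by
          gcongr
          exact hT J hJ h0
      _ = _ := by
          rw [show (4 : ℝ) = 2 * 2 by norm_num, mul_pow, mul_pow]; ring
  rw [hev, eval_eq', Finset.sum_subset hs (fun J _ hJ => by
    rw [notMem_support_iff.mp hJ, zero_mul])]
  refine (Finset.abs_sum_le_sum_abs _ _).trans ((Finset.sum_le_sum fun J _ => hterm J).trans ?_)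
  rw [Finset.sum_const, nsmul_eq_mul]
  have hcard : (s.card : ℝ) ≤ 2 ^ (∑ h, r h) := by
    have : s.card ≤ 2 ^ ∑ h, r h := by
      refine Finset.card_image_le.trans ?_
      rw [Finset.card_univ, Fintype.card_pi, ← Finset.prod_pow_eq_pow_sum]
      refine Finset.prod_le_prod' fun h _ => ?_
      rw [Fintype.card_fin]
      exact Nat.lt_two_pow_self
    exact_mod_cast this
  have := polyLength_nonneg P
  calc _ ≤ 2 ^ (∑ h, r h) * ((4 * max 1 |α|) ^ (∑ h, r h) * polyLength P * T) := by gcongr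
    _ = _ := by
      rw [show (8 : ℝ) * max 1 |α| = 2 * (4 * max 1 |α|) by ring, mul_pow 2]; ring

/-- A property of rationals holding for unboundedly large denominators holds along sequences of
denominators growing arbitrarily fast. -/
theorem exists_gap_sequence {p : ℚ → Prop} (hp : ∀ N : ℝ, ∃ x : ℚ, p x ∧ N < x.den) (ℓ G : ℝ)
    (hG : 1 ≤ G) :
    ∃ f : ℕ → ℚ, (∀ n, p (f n)) ∧ (∀ n, ℓ ≤ Real.log (f n).den) ∧
      ∀ n n', n < n' → G * Real.log (f n).den ≤ Real.log (f n').den := by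
  choose g hg hgN using hp
  let f : ℕ → ℚ := fun n => Nat.rec (g (Real.exp ℓ))
    (fun _ x => g (Real.exp (G * Real.log x.den))) n
  have hlog : ∀ t : ℝ, t ≤ Real.log (g (Real.exp t)).den := by
    intro t
    rw [Real.le_log_iff_exp_le (by exact_mod_cast (g _).den_pos)]
    exact (hgN _).le
  have hpos : ∀ n, 0 ≤ Real.log (f n).den := fun n => Real.log_natCast_nonneg _
  have hstep : ∀ n, G * Real.log (f n).den ≤ Real.log (f (n + 1)).den := fun n => hlog _
  have hmono : Monotone fun n => Real.log (f n).den := monotone_nat_of_le_succ fun n => by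
    have := hstep n
    nlinarith [hpos n]
  refine ⟨f, fun n => ?_, fun n => ?_, fun n n' h => ?_⟩
  · cases n with
    | zero => exact hg _
    | succ n => exact hg _
  · exact (hlog ℓ).trans (hmono (Nat.zero_le n))
  · exact (hstep n).trans (hmono h)

set_option maxHeartbeats 1000000 in
theorem roth_of_isIntegral (α : ℝ) (hα : IsIntegral ℤ α) {δ : ℝ} (hδ : 0 < δ) :
    ∃ N : ℝ, ∀ x : ℚ, |x - α| ≤ (x.den : ℝ) ^ (-(2 + δ)) → (x.den : ℝ) ≤ N := by
  by_contra hcon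
  push Not at hcon
  obtain ⟨D, K, hD, hK, haux⟩ := exists_auxiliary_polynomial α hα
  obtain ⟨ε, hε, hε1, hεδ⟩ : ∃ ε : ℝ, 0 < ε ∧ ε ≤ 1 ∧ 1 + 2 * ε < (2 + δ) * (1 / 2 - 2 * ε) := by
    refine ⟨δ / (8 * (3 + δ)), by positivity, ?_, ?_⟩
    · rw [div_le_one (by positivity)]; linarith
    · have h : δ / (8 * (3 + δ)) * (8 * (3 + δ)) = δ := by field_simp
      nlinarith [show 0 < δ / (8 * (3 + δ)) by positivity,
        show 0 < δ / (8 * (3 + δ)) * δ by positivity]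
  obtain ⟨m, hm⟩ := exists_nat_gt ((D : ℝ) / (2 * ε ^ 2))
  have hm0 : (0 : ℝ) < m := lt_of_le_of_lt (by positivity) hm
  obtain ⟨ω, hω, hroth⟩ := exists_weight_le_eval_hasse_ne_zero m (ε * m) (by positivity)
  let M : ℝ := 1 + Real.log K + Real.log (8 * max 1 |α|)
  have hlogK : 0 ≤ Real.log K := Real.log_nonneg hK
  have hlogA : 0 ≤ Real.log (8 * max 1 |α|) :=
    Real.log_nonneg (by nlinarith [le_max_left 1 |α|])
  let σ : ℝ := min ω (ε * m)
  have hσ : 0 < σ := lt_min hω (by positivity)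
  have hM : 1 ≤ M := by simp only [M]; linarith
  obtain ⟨f, hf, hfℓ, hfG⟩ := exists_gap_sequence hcon (2 * m * M / σ) (2 / ω + 1)
    (by have : 0 < 2 / ω := by positivity
        linarith)
  let β : Fin m → ℚ := fun h => f (m - 1 - h)
  let q : Fin m → ℝ := fun h => Real.log (β h).den
  have hqℓ : ∀ h, 2 * m * M / σ ≤ q h := fun h => hfℓ _
  have hℓ : 0 < 2 * m * M / σ := by positivity
  have hq0 : ∀ h, 0 < q h := fun h => hℓ.trans_le (hqℓ h)
  let R : ℝ := (∑ h, q h) / ε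
  have hRq : ∀ h, q h ≤ ε * R := by
    intro h
    simp only [R]
    rw [mul_div_cancel₀ _ hε.ne']
    exact Finset.single_le_sum (f := q) (fun h _ => (hq0 h).le) (Finset.mem_univ h)
  have hm1 : 0 < m := by exact_mod_cast hm0
  have hR : 0 < R := by
    have h1 := (hq0 ⟨0, hm1⟩).trans_le (hRq ⟨0, hm1⟩)
    exact pos_of_mul_pos_right h1 hε.le
  have hRq' : ∀ h, q h ≤ R := fun h => (hRq h).trans (by nlinarith)
  let r : Fin m → ℕ := fun h => ⌈R / q h⌉₊
  have hr_ge : ∀ h, R ≤ r h * q h := by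
    intro h
    rw [← div_le_iff₀ (hq0 h)]; exact Nat.le_ceil _
  have hr_lt : ∀ h, (r h : ℝ) ≤ R / q h + 1 := fun h =>
    (Nat.ceil_lt_add_one (div_nonneg hR.le (hq0 h).le)).le
  have hr_le : ∀ h, (r h : ℝ) ≤ 2 * (R / q h) := by
    intro h
    have : 1 ≤ R / q h := by rw [le_div_iff₀ (hq0 h)]; linarith [hRq' h]
    linarith [hr_lt h]
  have hr0 : ∀ h, 0 < r h := fun h => Nat.ceil_pos.mpr (div_pos hR (hq0 h))
  have hsum : (∑ h, (r h : ℝ)) * M ≤ σ * R := by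
    have h1 : ∀ h, (r h : ℝ) ≤ 2 * (R / (2 * m * M / σ)) := by
      intro h
      refine (hr_le h).trans ?_
      gcongr
      exact hqℓ h
    have h2 : ∑ h, (r h : ℝ) ≤ m * (2 * (R / (2 * m * M / σ))) := by
      refine (Finset.sum_le_sum fun h _ => h1 h).trans ?_
      simp
    calc (∑ h, (r h : ℝ)) * M ≤ m * (2 * (R / (2 * m * M / σ))) * M := by gcongr
      _ = σ * R := by field_simp
  have hsum0 : 0 ≤ ∑ h, (r h : ℝ) := Finset.sum_nonneg fun _ _ => Nat.cast_nonneg _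
  have hgap : ∀ i j : Fin m, i < j → (r i : ℝ) ≤ ω * r j := by
    intro i j hij
    have h1 : (2 / ω + 1) * q j ≤ q i := hfG _ _ (by have := j.2; have : (i : ℕ) < j := hij; omega)
    have h2 : 2 / ω * q j ≤ q i := by linarith [hq0 j]
    have h3 : 2 * q j ≤ ω * q i := by
      calc 2 * q j = ω * (2 / ω * q j) := by field_simp
        _ ≤ _ := by gcongr
    have h4 : (r i : ℝ) * q i ≤ 2 * R := by
      have := mul_le_mul_of_nonneg_right (hr_le i) (hq0 i).le
      rwa [mul_assoc, div_mul_cancel₀ _ (hq0 i).ne'] at this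
    have h5 := hr_ge j
    have h6 : (r i : ℝ) * q i * q j ≤ ω * r j * q i * q j := by
      calc (r i : ℝ) * q i * q j ≤ 2 * R * q j := by gcongr
        _ = R * (2 * q j) := by ring
        _ ≤ (r j * q j) * (ω * q i) := by
          gcongr
        _ = _ := by ring
    exact le_of_mul_le_mul_right (le_of_mul_le_mul_right h6 (hq0 j)) (hq0 i)
  obtain ⟨S, hScard, hS⟩ := exists_finset_weight_le r hr0 hε
  obtain ⟨P, hP0, hPr, hPl, hPS⟩ := haux m r S (by
    have h1 : (2 * (D : ℝ)) ≤ 4 * ε ^ 2 * m := by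
      rw [div_lt_iff₀ (by positivity)] at hm
      linarith
    have h2 : (2 * ((D : ℝ) * S.card)) ≤ ∏ h, ((r h : ℝ) + 1) := by
      refine le_trans ?_ hScard
      nlinarith [Nat.cast_nonneg (α := ℝ) S.card]
    exact_mod_cast h2)
  have hlogP : Real.log (polyLength P) ≤ (∑ h, (r h : ℝ)) * Real.log K := by
    have h1 := Real.log_le_log (by linarith [one_le_polyLength hP0]) hPl
    rw [Real.log_pow] at h1
    push_cast at h1
    exact h1
  obtain ⟨I, hIw, hI0⟩ := hroth r β R P hR hr0 hr_ge hgap hP0 hPr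
    (by
      refine hlogP.trans (le_trans ?_ (hsum.trans ?_))
      · gcongr; simp only [M]; linarith
      · gcongr; exact min_le_left _ _)
    (by
      refine le_trans ?_ (hsum.trans (mul_le_mul_of_nonneg_right (min_le_left _ _) hR.le))
      nlinarith)
  have hlow := one_le_abs_eval_mul_prod_den (r := r) (G := hasse I P)
    (fun h => (degreeOf_hasse_le h I P).trans (hPr h)) β (by rwa [← hasse_map])
  have hcast : ((eval β (map (Int.castRingHom ℚ) (hasse I P)) : ℚ) : ℝ) =
      eval (fun h => ((β h : ℚ) : ℝ)) (hasse I (map (Int.castRingHom ℝ) P)) := by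
    rw [hasse_map, eval_map, eval_map, eval₂_eq', eval₂_eq']
    push_cast
    simp
  let T : ℝ := Real.exp (-(2 + δ) * R * (m * (1 / 2 - 2 * ε)))
  have hup := abs_eval_hasse_le hPr α I (fun h => ((β h : ℚ) : ℝ)) (T := T) (by
    intro J hJr hJ0
    have hw : m * (1 / 2 - ε) < weight r (I + J) := by
      by_contra hle
      exact hJ0 (hPS _ (hS _ hJr (not_lt.mp hle)))
    rw [weight_add] at hw
    have h1 : ∀ h ∈ Finset.univ, |((β h : ℚ) : ℝ) - α| ^ J h ≤
        Real.exp (-(2 + δ) * R * ((J h : ℝ) / r h)) := by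
      intro h _
      have hden : (0 : ℝ) < (β h).den := by exact_mod_cast (β h).den_pos
      have h2 : |((β h : ℚ) : ℝ) - α| ≤ Real.exp (-(2 + δ) * q h) := by
        refine (hf _).trans (le_of_eq ?_)
        rw [Real.rpow_def_of_pos hden, mul_comm]
      calc |((β h : ℚ) : ℝ) - α| ^ J h ≤ Real.exp (-(2 + δ) * q h) ^ J h := by gcongr
        _ = Real.exp (J h * (-(2 + δ) * q h)) := by rw [← Real.exp_nat_mul]
        _ ≤ _ := by
          apply Real.exp_le_exp.mpr
          have hr0' : (0 : ℝ) < r h := by exact_mod_cast hr0 h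
          have h3 : R * ((J h : ℝ) / r h) ≤ J h * q h := by
            rw [mul_div_assoc', div_le_iff₀ hr0']
            nlinarith [hr_ge h, Nat.cast_nonneg (α := ℝ) (J h)]
          nlinarith
    refine (Finset.prod_le_prod (fun _ _ => by positivity) h1).trans ?_
    rw [← Real.exp_sum, ← Finset.mul_sum]
    apply Real.exp_le_exp.mpr
    have h4 : m * (1 / 2 - 2 * ε) ≤ ∑ h, (J h : ℝ) / r h := by
      have : weight r J = ∑ h, (J h : ℝ) / r h := rfl
      rw [← this]; linarith
    have h5 : 0 < (2 + δ) * R := by positivity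
    nlinarith) (Real.exp_pos _).le
  have hden : ∏ h, ((β h).den : ℝ) ^ r h ≤ Real.exp ((1 + ε) * m * R) := by
    have h1 : ∀ h ∈ Finset.univ, ((β h).den : ℝ) ^ r h ≤ Real.exp ((1 + ε) * R) := by
      intro h _
      have hden : (0 : ℝ) < (β h).den := by exact_mod_cast (β h).den_pos
      rw [← Real.exp_log hden, ← Real.exp_nat_mul]
      apply Real.exp_le_exp.mpr
      have := mul_le_mul_of_nonneg_right (hr_lt h) (hq0 h).le
      rw [add_mul, div_mul_cancel₀ _ (hq0 h).ne'] at this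
      have h6 := hRq h
      have : (r h : ℝ) * q h ≤ (1 + ε) * R := by linarith
      exact this
    refine (Finset.prod_le_prod (fun _ _ => by positivity) h1).trans ?_
    rw [Finset.prod_const, Finset.card_univ, Fintype.card_fin, ← Real.exp_nat_mul]
    apply Real.exp_le_exp.mpr
    apply le_of_eq; ring
  rw [hcast] at hlow
  have hconst : (8 * max 1 |α|) ^ (∑ h, r h) * polyLength P ≤ Real.exp (ε * m * R) := by
    have hA : 0 < 8 * max 1 |α| := by positivity
    have hPpos : 0 < polyLength P := by linarith [one_le_polyLength hP0]
    rw [← Real.log_le_iff_le_exp (by positivity), Real.log_mul (by positivity) hPpos.ne',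
      Real.log_pow]
    push_cast
    have h1 : σ * R ≤ ε * m * R := mul_le_mul_of_nonneg_right (min_le_right _ _) hR.le
    have h2 : (∑ h, (r h : ℝ)) * M = ∑ h, (r h : ℝ) + (∑ h, (r h : ℝ)) * Real.log K +
      (∑ h, (r h : ℝ)) * Real.log (8 * max 1 |α|) := by simp only [M]; ring
    linarith
  have hfinal : (1 : ℝ) ≤ Real.exp (ε * m * R) * T * Real.exp ((1 + ε) * m * R) := by
    refine hlow.trans ?_
    gcongr
    refine hup.trans ?_
    gcongr
  simp only [T] at hfinal
  rw [← Real.exp_add, ← Real.exp_add, Real.one_le_exp_iff] at hfinal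
  have : 0 < m * R := by positivity
  nlinarith

end Roth

section RothAlgebraic

theorem exists_pos_le_abs_sub_intCast (x : ℝ) :
    ∃ c : ℝ, 0 < c ∧ ∀ n : ℤ, (n : ℝ) ≠ x → c ≤ |n - x| := by
  by_cases h : Int.fract x = 0
  · refine ⟨1, one_pos, fun n hn => ?_⟩
    have hx : x = (⌊x⌋ : ℝ) := by have := Int.floor_add_fract x; linarith
    rw [hx] at hn ⊢
    have : n - ⌊x⌋ ≠ 0 := fun h0 => hn (by exact_mod_cast sub_eq_zero.mp h0)
    exact_mod_cast Int.one_le_abs this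
  · have h0 : 0 < Int.fract x := lt_of_le_of_ne (Int.fract_nonneg x) (Ne.symm h)
    have h1 := Int.fract_lt_one x
    refine ⟨min (Int.fract x) (1 - Int.fract x), lt_min h0 (by linarith), fun n _ => ?_⟩
    have hx := Int.floor_add_fract x
    rcases le_or_gt n ⌊x⌋ with hn | hn
    · have : (n : ℝ) ≤ ⌊x⌋ := by exact_mod_cast hn
      refine (min_le_left _ _).trans (le_trans ?_ (neg_le_abs _))
      linarith
    · have : (⌊x⌋ : ℝ) + 1 ≤ n := by exact_mod_cast hn
      refine (min_le_right _ _).trans (le_trans ?_ (le_abs_self _))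
      linarith

/-- **Roth's theorem**. -/
theorem exists_le_abs_div_sub_of_isAlgebraic (θ : ℝ) (hθ : IsAlgebraic ℤ θ) {δ : ℝ} (hδ : 0 < δ) :
    ∃ c : ℝ, 0 < c ∧ ∀ p q : ℤ, q ≠ 0 → (p : ℝ) / q ≠ θ →
      c * |(q : ℝ)| ^ (-(2 + δ)) ≤ |(p : ℝ) / q - θ| := by
  obtain ⟨a, ha0, ha⟩ := hθ.exists_integral_multiple
  obtain ⟨N, hN⟩ := roth_of_isIntegral (a • θ) ha hδ
  have haθ : a • θ = (a : ℝ) * θ := by simp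
  rw [haθ] at hN
  obtain ⟨M, hM⟩ := exists_nat_ge N
  obtain ⟨c, hc, hcn⟩ := exists_pos_le_abs_sub_intCast (M.factorial * ((a : ℝ) * θ))
  have hA : (1 : ℝ) ≤ |(a : ℝ)| := by exact_mod_cast Int.one_le_abs ha0
  have hF : (1 : ℝ) ≤ M.factorial := by
    exact_mod_cast Nat.one_le_iff_ne_zero.mpr (Nat.factorial_ne_zero M)
  refine ⟨min (1 / |(a : ℝ)|) (c / (|(a : ℝ)| * M.factorial)), by positivity,
    fun p q hq hne => ?_⟩
  by_contra! hlt
  have hq1 : (1 : ℝ) ≤ |(q : ℝ)| := by exact_mod_cast Int.one_le_abs hq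
  have hpow : |(q : ℝ)| ^ (-(2 + δ)) ≤ 1 := Real.rpow_le_one_of_one_le_of_nonpos hq1 (by linarith)
  have hpow0 : 0 < |(q : ℝ)| ^ (-(2 + δ)) := Real.rpow_pos_of_pos (by linarith) _
  let x : ℚ := Rat.divInt (a * p) q
  have hx : (x : ℝ) - a * θ = a * ((p : ℝ) / q - θ) := by
    simp only [x]; rw [Rat.divInt_eq_div]; push_cast; ring
  have hdvd : (x.den : ℤ) ∣ q := Rat.den_dvd _ _
  have hden : (x.den : ℝ) ≤ |(q : ℝ)| := by
    have h1 := Int.le_of_dvd (abs_pos.mpr hq) ((dvd_abs _ _).mpr hdvd)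
    exact_mod_cast h1
  have hden0 : (0 : ℝ) < x.den := by exact_mod_cast x.den_pos
  have hxN := hN x (by
    rw [hx, abs_mul]
    calc |(a : ℝ)| * |(p : ℝ) / q - θ| ≤ |(a : ℝ)| * (1 / |(a : ℝ)| * |(q : ℝ)| ^ (-(2 + δ))) := by
          gcongr
          exact hlt.le.trans (mul_le_mul_of_nonneg_right (min_le_left _ _) hpow0.le)
      _ = |(q : ℝ)| ^ (-(2 + δ)) := by field_simp
      _ ≤ _ := Real.rpow_le_rpow_of_nonpos hden0 hden (by linarith))
  have hxM : x.den ≤ M := by exact_mod_cast hxN.trans hM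
  obtain ⟨e, he⟩ := Nat.dvd_factorial x.den_pos hxM
  have hint : (M.factorial : ℝ) * x = ((e * x.num : ℤ) : ℝ) := by
    have h1 : (M.factorial : ℚ) * x = ((e * x.num : ℤ) : ℚ) := by
      rw [he]; push_cast
      rw [mul_comm (x.den : ℚ), mul_assoc, Rat.den_mul_eq_num]
    exact_mod_cast congrArg (fun y : ℚ => (y : ℝ)) h1
  have hxne : (x : ℝ) - a * θ ≠ 0 := by
    rw [hx]
    exact mul_ne_zero (by exact_mod_cast ha0) (sub_ne_zero.mpr hne)
  have h2 := hcn (e * x.num) (by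
    rw [← hint]
    intro h
    exact hxne (sub_eq_zero.mpr (mul_left_cancel₀ (by positivity) h)))
  rw [← hint, ← mul_sub, hx, abs_mul, abs_mul, abs_of_pos (by positivity : (0 : ℝ) < M.factorial)]
    at h2
  have h3 : |(p : ℝ) / q - θ| < c / (|(a : ℝ)| * M.factorial) := by
    refine hlt.trans_le ?_
    calc _ ≤ c / (|(a : ℝ)| * M.factorial) * |(q : ℝ)| ^ (-(2 + δ)) := by
          gcongr; exact min_le_right _ _
      _ ≤ c / (|(a : ℝ)| * M.factorial) * 1 := by gcongr
      _ = _ := mul_one _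
  rw [lt_div_iff₀ (by positivity)] at h3
  linarith

end RothAlgebraic

section NearCurve

/-- The affine abscissa of the projective point `(v 0 : v 1 : v 2)`. -/
noncomputable def absc (v : Fin 3 → ℤ) : ℝ := (v 1 : ℝ) / v 0

/-- The affine ordinate of the projective point `(v 0 : v 1 : v 2)`. -/
noncomputable def ordi (v : Fin 3 → ℤ) : ℝ := (v 2 : ℝ) / v 0

/-- The determinant of three integer vectors. -/
def det3 (u v w : Fin 3 → ℤ) : ℤ :=
  u 0 * (v 1 * w 2 - v 2 * w 1) - u 1 * (v 0 * w 2 - v 2 * w 0) + u 2 * (v 0 * w 1 - v 1 * w 0)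

/-- A primitive vector of height comparable to `B` which is close to the graph of `f`. -/
structure NearCurve (f : ℝ → ℝ) (c e B : ℝ) (v : Fin 3 → ℤ) : Prop where
  primitive : Int.gcd (v 0) (Int.gcd (v 1) (v 2)) = 1
  abs_coord_le : ∀ i, |(v i : ℝ)| ≤ B
  le_zero : c * B ≤ v 0
  near : |ordi v - f (absc v)| ≤ e

/-- The determinant of the points `(1, xᵢ, f xᵢ)`. -/
def dd (f : ℝ → ℝ) (x y z : ℝ) : ℝ := (y - x) * (f z - f x) - (z - x) * (f y - f x)

theorem eq_of_primitive_of_proportional {v w : Fin 3 → ℤ}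
    (hv : Int.gcd (v 0) (Int.gcd (v 1) (v 2)) = 1) (hw : Int.gcd (w 0) (Int.gcd (w 1) (w 2)) = 1)
    (hv0 : 0 < v 0) (hw0 : 0 < w 0) (h1 : v 1 * w 0 = w 1 * v 0) (h2 : v 2 * w 0 = w 2 * v 0) :
    v = w := by
  have key : ∀ a b : Fin 3 → ℤ, Int.gcd (a 0) (Int.gcd (a 1) (a 2)) = 1 →
      a 1 * b 0 = b 1 * a 0 → a 2 * b 0 = b 2 * a 0 → a 0 ∣ b 0 := by
    intro a b ha h1 h2
    have e1 := Int.gcd_eq_gcd_ab (a 0) (Int.gcd (a 1) (a 2))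
    have e2 := Int.gcd_eq_gcd_ab (a 1) (a 2)
    rw [ha] at e1
    set s := Int.gcdA (a 0) (Int.gcd (a 1) (a 2))
    set t := Int.gcdB (a 0) (Int.gcd (a 1) (a 2))
    rw [e2] at e1
    set s' := Int.gcdA (a 1) (a 2)
    set t' := Int.gcdB (a 1) (a 2)
    push_cast at e1
    refine ⟨b 0 * s + b 1 * s' * t + b 2 * t' * t, ?_⟩
    calc b 0 = 1 * b 0 := (one_mul _).symm
      _ = _ := by
        rw [e1]
        linear_combination t * s' * h1 + t * t' * h2
  have h0 : v 0 = w 0 := Int.dvd_antisymm hv0.le hw0.le (key v w hv h1 h2)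
    (key w v hw h1.symm h2.symm)
  rw [h0] at h1 h2
  funext i
  fin_cases i
  · exact h0
  · exact mul_right_cancel₀ hw0.ne' h1
  · exact mul_right_cancel₀ hw0.ne' h2

variable {f : ℝ → ℝ} {c e B : ℝ}

namespace NearCurve

theorem pos {v : Fin 3 → ℤ} (h : NearCurve f c e B v) (hc : 0 < c) (hB : 0 < B) :
    0 < (v 0 : ℝ) := lt_of_lt_of_le (mul_pos hc hB) h.le_zero

theorem mul_absc {v : Fin 3 → ℤ} (h : 0 < (v 0 : ℝ)) : (v 0 : ℝ) * absc v = v 1 :=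
  mul_div_cancel₀ _ h.ne'

theorem mul_ordi {v : Fin 3 → ℤ} (h : 0 < (v 0 : ℝ)) : (v 0 : ℝ) * ordi v = v 2 :=
  mul_div_cancel₀ _ h.ne'

theorem le_abs_sub_mul {v w : Fin 3 → ℤ} (hv : NearCurve f c e B v) (hw : NearCurve f c e B w)
    (hc : 0 < c) (hB : 0 < B) {k : ℤ} (hk : k ∣ v 0 * w 1 - v 1 * w 0) (hne : absc v ≠ absc w) :
    |(k : ℝ)| ≤ |absc w - absc v| * B ^ 2 := by
  have hv0 := hv.pos hc hB
  have hw0 := hw.pos hc hB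
  have h1 : ((v 0 * w 1 - v 1 * w 0 : ℤ) : ℝ) = v 0 * w 0 * (absc w - absc v) := by
    push_cast
    rw [← mul_absc hv0, ← mul_absc hw0]; ring
  have hne0 : v 0 * w 1 - v 1 * w 0 ≠ 0 := by
    intro h0
    rw [h0, Int.cast_zero, eq_comm, mul_eq_zero] at h1
    rcases h1 with h1 | h1
    · exact (mul_pos hv0 hw0).ne' h1
    · exact hne (sub_eq_zero.mp h1).symm
  have h2 : |(k : ℝ)| ≤ |((v 0 * w 1 - v 1 * w 0 : ℤ) : ℝ)| := by
    have := Int.le_of_dvd (abs_pos.mpr hne0) ((abs_dvd_abs _ _).mpr hk)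
    exact_mod_cast this
  rw [h1, abs_mul, abs_mul] at h2
  calc |(k : ℝ)| ≤ |(v 0 : ℝ)| * |(w 0 : ℝ)| * |absc w - absc v| := h2
    _ ≤ B * B * |absc w - absc v| := by
      gcongr
      · exact hv.abs_coord_le 0
      · exact hw.abs_coord_le 0
    _ = _ := by ring

theorem one_le_abs_sub_mul {v w : Fin 3 → ℤ} (hv : NearCurve f c e B v) (hw : NearCurve f c e B w)
    (hc : 0 < c) (hB : 0 < B) (hne : absc v ≠ absc w) : 1 ≤ |absc w - absc v| * B ^ 2 := by
  simpa using le_abs_sub_mul hv hw hc hB (one_dvd _) hne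

theorem eq_of_absc_eq {v w : Fin 3 → ℤ} (hv : NearCurve f c e B v) (hw : NearCurve f c e B w)
    (hc : 0 < c) (hB : 0 < B) (he : 2 * e * B ^ 2 < 1) (h : absc v = absc w) : v = w := by
  have hv0 := hv.pos hc hB
  have hw0 := hw.pos hc hB
  have h2 : v 2 * w 0 = w 2 * v 0 := by
    by_contra hne
    have h3 : ((v 2 * w 0 - w 2 * v 0 : ℤ) : ℝ) = v 0 * w 0 * (ordi v - ordi w) := by
      push_cast
      rw [← mul_ordi hv0, ← mul_ordi hw0]; ring
    have h4 : (1 : ℝ) ≤ |((v 2 * w 0 - w 2 * v 0 : ℤ) : ℝ)| := by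
      exact_mod_cast Int.one_le_abs (sub_ne_zero.mpr hne)
    have h5 : |ordi v - ordi w| ≤ 2 * e := by
      have a1 := abs_le.mp hv.near
      have a2 := abs_le.mp hw.near
      rw [h] at a1
      rw [abs_le]; constructor <;> linarith
    rw [h3, abs_mul, abs_mul] at h4
    have : |(v 0 : ℝ)| * |(w 0 : ℝ)| * |ordi v - ordi w| ≤ B * B * (2 * e) := by
      gcongr
      · exact hv.abs_coord_le 0
      · exact hw.abs_coord_le 0
    nlinarith
  refine eq_of_primitive_of_proportional hv.primitive hw.primitive (by exact_mod_cast hv0)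
    (by exact_mod_cast hw0) ?_ h2
  have : (v 1 : ℝ) * w 0 = w 1 * v 0 := by rw [← mul_absc hv0, ← mul_absc hw0, h]; ring
  exact_mod_cast this

theorem det3_eq {u v w : Fin 3 → ℤ} (hu : 0 < (u 0 : ℝ)) (hv : 0 < (v 0 : ℝ))
    (hw : 0 < (w 0 : ℝ)) : (det3 u v w : ℝ) = u 0 * v 0 * w 0 *
      ((absc v - absc u) * (ordi w - ordi u) - (absc w - absc u) * (ordi v - ordi u)) := by
  simp only [det3]
  push_cast
  rw [← mul_absc hv, ← mul_absc hw, ← mul_absc hu, ← mul_ordi hv, ← mul_ordi hw, ← mul_ordi hu]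
  ring

/-- The ordinates may be replaced by the values of `f` in the determinant at a small cost. -/
theorem abs_sub_dd_le {u v w : Fin 3 → ℤ} (hu : NearCurve f c e B u) (hv : NearCurve f c e B v)
    (hw : NearCurve f c e B w) :
    |(absc v - absc u) * (ordi w - ordi u) - (absc w - absc u) * (ordi v - ordi u) -
      dd f (absc u) (absc v) (absc w)| ≤
      2 * e * (|absc v - absc u| + |absc w - absc u|) := by
  have h1 := abs_le.mp hu.near
  have h2 := abs_le.mp hv.near
  have h3 := abs_le.mp hw.near
  have e1 : (absc v - absc u) * (ordi w - ordi u) - (absc w - absc u) * (ordi v - ordi u) -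
      dd f (absc u) (absc v) (absc w) =
      (absc v - absc u) * ((ordi w - f (absc w)) - (ordi u - f (absc u))) -
      (absc w - absc u) * ((ordi v - f (absc v)) - (ordi u - f (absc u))) := by
    simp only [dd]; ring
  rw [e1]
  have h4 : |(ordi w - f (absc w)) - (ordi u - f (absc u))| ≤ 2 * e := by
    rw [abs_le]; constructor <;> linarith
  have h5 : |(ordi v - f (absc v)) - (ordi u - f (absc u))| ≤ 2 * e := by
    rw [abs_le]; constructor <;> linarith
  refine (abs_sub _ _).trans ?_
  rw [abs_mul, abs_mul]
  nlinarith [abs_nonneg (absc v - absc u), abs_nonneg (absc w - absc u)]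

end NearCurve

theorem abs_dd_le {f' : ℝ → ℝ} {I : Set ℝ} {M : ℝ}
    (hM : ∀ x ∈ I, ∀ y ∈ I, |f y - f x - f' x * (y - x)| ≤ M * |y - x| ^ 2)
    {x y z : ℝ} (hx : x ∈ I) (hy : y ∈ I) (hz : z ∈ I) :
    |dd f x y z| ≤ M * (|y - x| * |z - x| * (|y - x| + |z - x|)) := by
  have h1 := hM x hx y hy
  have h2 := hM x hx z hz
  have e1 : dd f x y z = (y - x) * (f z - f x - f' x * (z - x)) -
      (z - x) * (f y - f x - f' x * (y - x)) := by simp only [dd]; ring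
  rw [e1]
  refine (abs_sub _ _).trans ?_
  rw [abs_mul, abs_mul]
  have h3 := mul_le_mul_of_nonneg_left h2 (abs_nonneg (y - x))
  have h4 := mul_le_mul_of_nonneg_left h1 (abs_nonneg (z - x))
  nlinarith

theorem NearCurve.abs_det3_le {f' : ℝ → ℝ} {I : Set ℝ} {M : ℝ}
    (hM : ∀ x ∈ I, ∀ y ∈ I, |f y - f x - f' x * (y - x)| ≤ M * |y - x| ^ 2)
    {u v w : Fin 3 → ℤ} (hu : NearCurve f c e B u) (hv : NearCurve f c e B v)
    (hw : NearCurve f c e B w) (hc : 0 < c) (hB : 0 < B)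
    (hx : absc u ∈ I) (hy : absc v ∈ I) (hz : absc w ∈ I) :
    |(det3 u v w : ℝ)| ≤ B ^ 3 * (M * (|absc v - absc u| * |absc w - absc u| *
      (|absc v - absc u| + |absc w - absc u|)) +
      2 * e * (|absc v - absc u| + |absc w - absc u|)) := by
  rw [NearCurve.det3_eq (hu.pos hc hB) (hv.pos hc hB) (hw.pos hc hB), abs_mul]
  have h1 : |(absc v - absc u) * (ordi w - ordi u) - (absc w - absc u) * (ordi v - ordi u)| ≤
      M * (|absc v - absc u| * |absc w - absc u| * (|absc v - absc u| + |absc w - absc u|)) +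
      2 * e * (|absc v - absc u| + |absc w - absc u|) := by
    have h2 := abs_le.mp (NearCurve.abs_sub_dd_le hu hv hw)
    have h3 := abs_le.mp (abs_dd_le hM hx hy hz)
    rw [abs_le]; constructor <;> linarith
  have h4 : |(u 0 : ℝ) * v 0 * w 0| ≤ B ^ 3 := by
    rw [abs_mul, abs_mul]
    calc |(u 0 : ℝ)| * |(v 0 : ℝ)| * |(w 0 : ℝ)| ≤ B * B * B := by
          gcongr
          · exact hu.abs_coord_le 0
          · exact hv.abs_coord_le 0
          · exact hw.abs_coord_le 0
      _ = B ^ 3 := by ring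
  exact mul_le_mul h4 h1 (abs_nonneg _) (by positivity)

theorem card_le_of_cells {α : Type*} (S : Finset α) (x : α → ℝ) {u v ℓ : ℝ} (n : ℕ)
    (huv : u ≤ v) (hℓ : 0 < ℓ)
    (hS : ∀ a ∈ S, x a ∈ Set.Icc u v)
    (hn : ∀ T ⊆ S, (∀ a ∈ T, ∀ b ∈ T, |x a - x b| ≤ ℓ) → T.card ≤ n) :
    (S.card : ℝ) ≤ n * ((v - u) / ℓ + 1) := by
  classical
  let g : α → ℕ := fun a => ⌊(x a - u) / ℓ⌋₊
  have hnn : ∀ a ∈ S, 0 ≤ (x a - u) / ℓ := fun a ha =>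
    div_nonneg (by linarith [(hS a ha).1]) hℓ.le
  have h1 : S.card ≤ n * (Finset.range (⌊(v - u) / ℓ⌋₊ + 1)).card := by
    refine Finset.card_le_mul_card_image_of_maps_to (f := g) (fun a ha => ?_) n fun b _ => ?_
    · rw [Finset.mem_range, Nat.lt_succ_iff]
      refine Nat.floor_le_floor ?_
      gcongr
      exact (hS a ha).2
    · refine hn _ (Finset.filter_subset _ _) fun a ha a' ha' => ?_
      obtain ⟨ha, hab⟩ := Finset.mem_filter.mp ha
      obtain ⟨ha', hab'⟩ := Finset.mem_filter.mp ha'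
      have e1 := (Nat.floor_eq_iff (hnn a ha)).mp hab
      have e2 := (Nat.floor_eq_iff (hnn a' ha')).mp hab'
      have h3 : |(x a - u) / ℓ - (x a' - u) / ℓ| ≤ 1 := by
        rw [abs_le]; constructor <;> linarith [e1.1, e1.2, e2.1, e2.2]
      rw [← sub_div, abs_div, abs_of_pos hℓ, div_le_one hℓ] at h3
      simpa using h3
  rw [Finset.card_range] at h1
  have h2 : ((⌊(v - u) / ℓ⌋₊ : ℕ) : ℝ) ≤ (v - u) / ℓ :=
    Nat.floor_le (div_nonneg (by linarith) hℓ.le)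
  calc (S.card : ℝ) ≤ n * ((⌊(v - u) / ℓ⌋₊ : ℝ) + 1) := by exact_mod_cast h1
    _ ≤ _ := by gcongr

/-- Few points near a curve lie above a short interval when no three of them are collinear. -/
theorem card_le_of_det3_ne_zero {f' : ℝ → ℝ} {I : Set ℝ} {M : ℝ}
    (hM : ∀ x ∈ I, ∀ y ∈ I, |f y - f x - f' x * (y - x)| ≤ M * |y - x| ^ 2) (hM0 : 0 ≤ M)
    (hc : 0 < c) (hB : 0 < B) (he : 0 ≤ e) {c₀ : ℝ} (hc₀ : 0 < c₀)
    (hsmall : 2 * M * c₀ ^ 3 + 4 * e * c₀ * B ^ 2 < 1) (S : Finset (Fin 3 → ℤ))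
    (hS : ∀ v ∈ S, NearCurve f c e B v ∧ absc v ∈ I)
    (hdet : ∀ u ∈ S, ∀ v ∈ S, ∀ w ∈ S, u ≠ v → u ≠ w → v ≠ w → det3 u v w ≠ 0)
    {a b : ℝ} (hab : a ≤ b) (hSab : ∀ v ∈ S, absc v ∈ Set.Icc a b) :
    (S.card : ℝ) ≤ 2 * ((b - a) * B / c₀ + 1) := by
  have hℓ : 0 < c₀ / B := div_pos hc₀ hB
  have h := card_le_of_cells S absc 2 hab hℓ hSab fun T hTS hT => by
    by_contra! hcard
    obtain ⟨u, v, w, hu, hv, hw, huv, huw, hvw⟩ := Finset.two_lt_card_iff.mp hcard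
    have hd := hdet u (hTS hu) v (hTS hv) w (hTS hw) huv huw hvw
    have h1 : (1 : ℝ) ≤ |(det3 u v w : ℝ)| := by exact_mod_cast Int.one_le_abs hd
    have h2 := NearCurve.abs_det3_le hM (hS u (hTS hu)).1 (hS v (hTS hv)).1 (hS w (hTS hw)).1 hc hB
      (hS u (hTS hu)).2 (hS v (hTS hv)).2 (hS w (hTS hw)).2
    have hx := hT v hv u hu
    have hy := hT w hw u hu
    have h3 : B ^ 3 * (M * (|absc v - absc u| * |absc w - absc u| *
      (|absc v - absc u| + |absc w - absc u|)) +
      2 * e * (|absc v - absc u| + |absc w - absc u|)) ≤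
      B ^ 3 * (M * (c₀ / B * (c₀ / B) * (c₀ / B + c₀ / B)) + 2 * e * (c₀ / B + c₀ / B)) := by
      gcongr
    have h4 : B ^ 3 * (M * (c₀ / B * (c₀ / B) * (c₀ / B + c₀ / B)) +
        2 * e * (c₀ / B + c₀ / B)) = 2 * M * c₀ ^ 3 + 4 * e * c₀ * B ^ 2 := by
      field_simp; ring
    linarith
  refine h.trans (le_of_eq ?_)
  rw [div_div_eq_mul_div]; norm_num

end NearCurve

section Collinear

variable {f : ℝ → ℝ} {c e B : ℝ}

theorem exists_primitive_relation {u v w : Fin 3 → ℤ} (hd : det3 u v w = 0)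
    (hne : u 0 * v 1 - u 1 * v 0 ≠ 0) :
    ∃ h : Fin 3 → ℤ, h 2 ≠ 0 ∧ (h 0 * u 0 + h 1 * u 1 + h 2 * u 2 = 0) ∧
      (h 0 * v 0 + h 1 * v 1 + h 2 * v 2 = 0) ∧ (h 0 * w 0 + h 1 * w 1 + h 2 * w 2 = 0) ∧
      ∃ r s t : ℤ, r * h 0 + s * h 1 + t * h 2 = 1 := by
  set n0 := u 1 * v 2 - u 2 * v 1 with hn0
  set n1 := u 2 * v 0 - u 0 * v 2 with hn1
  set n2 := u 0 * v 1 - u 1 * v 0 with hn2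
  obtain ⟨g, hg⟩ : ∃ g : ℤ, g = (Int.gcd n0 (Int.gcd n1 n2) : ℕ) := ⟨_, rfl⟩
  have d0 : g ∣ n0 := hg ▸ Int.gcd_dvd_left _ _
  have d12 : g ∣ (Int.gcd n1 n2 : ℕ) := hg ▸ Int.gcd_dvd_right _ _
  have d1 : g ∣ n1 := d12.trans (Int.gcd_dvd_left _ _)
  have d2 : g ∣ n2 := d12.trans (Int.gcd_dvd_right _ _)
  obtain ⟨h0, e0⟩ := d0
  obtain ⟨h1, e1⟩ := d1
  obtain ⟨h2, e2⟩ := d2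
  have hg0 : g ≠ 0 := by
    rintro h; rw [h, zero_mul] at e2; exact hne e2
  have b1 := Int.gcd_eq_gcd_ab n0 (Int.gcd n1 n2)
  have b2 := Int.gcd_eq_gcd_ab n1 n2
  rw [← hg] at b1
  rw [b2] at b1
  refine ⟨![h0, h1, h2], ?_, ?_, ?_, ?_, ?_⟩
  · intro h
    have h' : h2 = 0 := h
    rw [h', mul_zero] at e2; exact hne e2
  · apply mul_left_cancel₀ hg0
    simp only [Matrix.cons_val]
    linear_combination (-u 0) * e0 - u 1 * e1 - u 2 * e2 + (u 0 * hn0 + u 1 * hn1 + u 2 * hn2)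
  · apply mul_left_cancel₀ hg0
    simp only [Matrix.cons_val]
    linear_combination (-v 0) * e0 - v 1 * e1 - v 2 * e2 + (v 0 * hn0 + v 1 * hn1 + v 2 * hn2)
  · apply mul_left_cancel₀ hg0
    simp only [Matrix.cons_val]
    simp only [det3] at hd
    linear_combination (-w 0) * e0 - w 1 * e1 - w 2 * e2 + (w 0 * hn0 + w 1 * hn1 + w 2 * hn2) + hd
  · refine ⟨Int.gcdA n0 (Int.gcd n1 n2), Int.gcdA n1 n2 * Int.gcdB n0 (Int.gcd n1 n2),
      Int.gcdB n1 n2 * Int.gcdB n0 (Int.gcd n1 n2), ?_⟩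
    apply mul_left_cancel₀ hg0
    simp only [Matrix.cons_val]
    rw [b2]
    set s := n0.gcdA (n1 * n1.gcdA n2 + n2 * n1.gcdB n2)
    set t := n0.gcdB (n1 * n1.gcdA n2 + n2 * n1.gcdB n2)
    linear_combination (-1) * b1 - s * e0 - (n1.gcdA n2) * t * e1 - (n1.gcdB n2) * t * e2

theorem dvd_of_relation {h v w : Fin 3 → ℤ} {r s t : ℤ} (hb : r * h 0 + s * h 1 + t * h 2 = 1)
    (hv : h 0 * v 0 + h 1 * v 1 + h 2 * v 2 = 0) (hw : h 0 * w 0 + h 1 * w 1 + h 2 * w 2 = 0) :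
    h 2 ∣ v 0 * w 1 - v 1 * w 0 := by
  refine ⟨r * (v 1 * w 2 - v 2 * w 1) + s * (v 2 * w 0 - v 0 * w 2) +
    t * (v 0 * w 1 - v 1 * w 0), ?_⟩
  linear_combination (-(v 0 * w 1 - v 1 * w 0)) * hb + (r * w 1 - s * w 0) * hv
    - (r * v 1 - s * v 0) * hw

/-- If `det3` vanishes then the determinant on the curve is controlled by the error. -/
theorem NearCurve.abs_dd_le_of_det3_eq_zero {u v w : Fin 3 → ℤ} (hu : NearCurve f c e B u)
    (hv : NearCurve f c e B v) (hw : NearCurve f c e B w) (hc : 0 < c) (hB : 0 < B)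
    (hd : det3 u v w = 0) : |dd f (absc u) (absc v) (absc w)| ≤
      2 * e * (|absc v - absc u| + |absc w - absc u|) := by
  have h1 := NearCurve.det3_eq (hu.pos hc hB) (hv.pos hc hB) (hw.pos hc hB)
  rw [hd, Int.cast_zero, eq_comm, mul_eq_zero] at h1
  have h2 := h1.resolve_left
    (mul_pos (mul_pos (hu.pos hc hB) (hv.pos hc hB)) (hw.pos hc hB)).ne'
  have h3 := NearCurve.abs_sub_dd_le hu hv hw
  rw [h2, zero_sub, abs_neg] at h3
  exact h3

/-- Three collinear points near the curve force a weak lower bound on the error. -/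
theorem NearCurve.mul_sq_le_of_det3_eq_zero {u v w : Fin 3 → ℤ} (hu : NearCurve f c e B u)
    (hv : NearCurve f c e B v) (hw : NearCurve f c e B w) (hc : 0 < c) (hB : 0 < B)
    (hd : det3 u v w = 0) (huv : absc u ≠ absc v) (huw : absc u ≠ absc w) (hvw : absc v ≠ absc w)
    {κ q : ℝ} (hκ : 0 ≤ κ) (hq : 0 ≤ q)
    (hdd : κ * |(absc v - absc u) * (absc w - absc u) * (absc w - absc v)| ≤
      |dd f (absc u) (absc v) (absc w)|)
    (h1 : q ≤ |absc v - absc u| * B ^ 2) (h2 : q ≤ |absc w - absc u| * B ^ 2)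
    (h3 : q ≤ |absc w - absc v| * B ^ 2) : κ * q ^ 2 ≤ 4 * e * B ^ 4 := by
  have h := hdd.trans (NearCurve.abs_dd_le_of_det3_eq_zero hu hv hw hc hB hd)
  have he : 0 ≤ e := (abs_nonneg _).trans hu.near
  rw [abs_mul, abs_mul] at h
  have p1 : 0 < |absc v - absc u| := abs_pos.mpr (sub_ne_zero.mpr huv.symm)
  have p2 : 0 < |absc w - absc u| := abs_pos.mpr (sub_ne_zero.mpr huw.symm)
  have p3 : 0 < |absc w - absc v| := abs_pos.mpr (sub_ne_zero.mpr hvw.symm)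
  set a := |absc v - absc u|
  set b := |absc w - absc u|
  set d := |absc w - absc v|
  have key : ∀ x y : ℝ, 0 < x → 0 < y → y ≤ x → κ * (x * y * d) ≤ 2 * e * (x + y) →
      q ≤ y * B ^ 2 → κ * q ^ 2 ≤ 4 * e * B ^ 4 := by
    intro x y hx hy hyx hh hqy
    have i1 : κ * (y * d) ≤ 4 * e := by
      have : x * (κ * (y * d)) ≤ x * (4 * e) := by nlinarith
      exact le_of_mul_le_mul_left this hx
    calc κ * q ^ 2 ≤ κ * ((y * B ^ 2) * (d * B ^ 2)) := by
          rw [sq]; gcongr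
      _ = κ * (y * d) * B ^ 4 := by ring
      _ ≤ 4 * e * B ^ 4 := by gcongr
  rcases le_total b a with hba | hab
  · exact key a b p1 p2 hba (by linarith) h2
  · exact key b a p2 p1 hab (by nlinarith) h1

theorem det3_ne_zero_of_dd_bound {κ : ℝ} (hκ : 0 < κ) (hc : 0 < c) (hB : 0 < B)
    (hsmall : 4 * e * B ^ 4 < κ)
    {u v w : Fin 3 → ℤ} (hu : NearCurve f c e B u)
    (hv : NearCurve f c e B v) (hw : NearCurve f c e B w)
    (huv : absc u ≠ absc v) (huw : absc u ≠ absc w) (hvw : absc v ≠ absc w)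
    (hdd : κ * |(absc v - absc u) * (absc w - absc u) * (absc w - absc v)| ≤
      |dd f (absc u) (absc v) (absc w)|) : det3 u v w ≠ 0 := by
  intro hd
  have := NearCurve.mul_sq_le_of_det3_eq_zero hu hv hw hc hB hd huv huw hvw hκ.le zero_le_one hdd
    (NearCurve.one_le_abs_sub_mul hu hv hc hB huv) (NearCurve.one_le_abs_sub_mul hu hw hc hB huw)
    (NearCurve.one_le_abs_sub_mul hv hw hc hB hvw)
  linarith

set_option maxHeartbeats 2000000 in
/-- Near an inflection point with algebraic tangent, collinear triples of points lie on the
tangent. -/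
theorem exists_det3_ne_zero_of_flex {I : Set ℝ} {a θ μ₀ K κ δ : ℝ} {k : ℕ}
    (hθ : IsAlgebraic ℤ θ) (hμ : IsAlgebraic ℤ μ₀) (hκ : 0 < κ) (hK : 0 ≤ K) (hδ : 0 < δ)
    (hδk : δ * k ≤ 2) (hδ1 : δ ≤ 1) (hI : ∀ x ∈ I, |x - a| ≤ 1)
    (hdd : ∀ x ∈ I, ∀ y ∈ I, ∀ z ∈ I,
      κ * |(y - x) * (z - x) * (z - y)| * |x - a| ^ k ≤ |dd f x y z|)
    (hr : ∀ x ∈ I, ∀ y ∈ I, |y - a| ≤ |x - a| →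
      |(f x - θ * x) - (f y - θ * y)| ≤ K * |x - a| ^ (k + 1) * |x - y|)
    (hr0 : ∀ x ∈ I, |f x - (θ * x + μ₀)| ≤ K * |x - a| ^ (k + 1)) (hc : 0 < c) :
    ∃ η, 0 < η ∧ ∀ e B : ℝ, 1 ≤ B → e * B ^ (4 + 2 * δ) ≤ η → ∀ u v w : Fin 3 → ℤ,
      NearCurve f c e B u → NearCurve f c e B v → NearCurve f c e B w →
      absc u ∈ I → absc v ∈ I → absc w ∈ I →
      absc u ≠ absc v → absc u ≠ absc w → absc v ≠ absc w →
      ordi u ≠ θ * absc u + μ₀ → det3 u v w ≠ 0 := by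
  obtain ⟨c₁, hc₁, hroth₁⟩ := exists_le_abs_div_sub_of_isAlgebraic θ hθ hδ
  obtain ⟨c₂, hc₂, hroth₂⟩ := exists_le_abs_div_sub_of_isAlgebraic μ₀ hμ hδ
  set R : ℝ := 4 * K / κ + 8 with hR
  have hRpos : 0 < R := by positivity
  set R' : ℝ := R * (|a| + 3) with hR'
  have hR'pos : 0 < R' := by positivity
  refine ⟨min (κ / 4) (min (c₁ / (2 * R)) (c₂ / (2 * R'))), by positivity, ?_⟩
  -- it suffices to treat the case where the first point is farthest from the flex
  have main : ∀ e B : ℝ, 1 ≤ B →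
      e * B ^ (4 + 2 * δ) ≤ min (κ / 4) (min (c₁ / (2 * R)) (c₂ / (2 * R'))) →
      ∀ u v w : Fin 3 → ℤ, NearCurve f c e B u → NearCurve f c e B v → NearCurve f c e B w →
      absc u ∈ I → absc v ∈ I → absc w ∈ I →
      absc u ≠ absc v → absc u ≠ absc w → absc v ≠ absc w →
      |absc v - a| ≤ |absc u - a| → |absc w - a| ≤ |absc u - a| → det3 u v w = 0 →
      (ordi u = θ * absc u + μ₀ ∧ ordi v = θ * absc v + μ₀ ∧ ordi w = θ * absc w + μ₀) := by
    intro e B hB1 hη u v w hu hv hw hIu hIv hIw huv huw hvw hvu hwu hd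
    have hB : 0 < B := by linarith
    have he : 0 ≤ e := (abs_nonneg _).trans hu.near
    have hu0 := hu.pos hc hB
    have hv0 := hv.pos hc hB
    have hw0 := hw.pos hc hB
    have hne : u 0 * v 1 - u 1 * v 0 ≠ 0 := by
      intro h0
      have : (u 0 : ℝ) * v 1 - u 1 * v 0 = 0 := by exact_mod_cast h0
      rw [← NearCurve.mul_absc hu0, ← NearCurve.mul_absc hv0] at this
      have h1 : (u 0 : ℝ) * v 0 * (absc v - absc u) = 0 := by linarith
      rcases mul_eq_zero.mp h1 with h1 | h1
      · exact (mul_pos hu0 hv0).ne' h1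
      · exact huv (sub_eq_zero.mp h1).symm
    obtain ⟨h, hh2, hhu, hhv, hhw, r, s, t, hbez⟩ := exists_primitive_relation hd hne
    set q : ℝ := |(h 2 : ℝ)| with hqdef
    have hq1 : 1 ≤ q := by
      have := Int.one_le_abs hh2
      rw [hqdef]; exact_mod_cast this
    have hq0 : 0 < q := by linarith
    have quv := NearCurve.le_abs_sub_mul hu hv hc hB (dvd_of_relation hbez hhu hhv) huv
    have quw := NearCurve.le_abs_sub_mul hu hw hc hB (dvd_of_relation hbez hhu hhw) huw
    have qvw := NearCurve.le_abs_sub_mul hv hw hc hB (dvd_of_relation hbez hhv hhw) hvw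
    have hh2R : (h 2 : ℝ) ≠ 0 := by exact_mod_cast hh2
    set l : ℝ := ((-h 1 : ℤ) : ℝ) / (h 2 : ℤ) with hl
    set m : ℝ := ((-h 0 : ℤ) : ℝ) / (h 2 : ℤ) with hm
    have hline : ∀ x : Fin 3 → ℤ, 0 < (x 0 : ℝ) → h 0 * x 0 + h 1 * x 1 + h 2 * x 2 = 0 →
        ordi x = l * absc x + m := by
      intro x hx hx'
      have h' : (h 0 : ℝ) * x 0 + h 1 * x 1 + h 2 * x 2 = 0 := by exact_mod_cast hx'
      rw [hl, hm, ordi, absc]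
      push_cast
      field_simp
      linarith
    have lu := hline u hu0 hhu
    have lv := hline v hv0 hhv
    have lw := hline w hw0 hhw
    set X : ℝ := |absc u - a| with hX
    have hX0 : 0 ≤ X := abs_nonneg _
    have hX1 : X ≤ 1 := hI _ hIu
    have hη1 : e * B ^ (4 + 2 * δ) ≤ κ / 4 := hη.trans (min_le_left _ _)
    have hη2 : e * B ^ (4 + 2 * δ) ≤ c₁ / (2 * R) :=
      hη.trans ((min_le_right _ _).trans (min_le_left _ _))
    have hη3 : e * B ^ (4 + 2 * δ) ≤ c₂ / (2 * R') :=
      hη.trans ((min_le_right _ _).trans (min_le_right _ _))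
    set E : ℝ := e * B ^ (4 + 2 * δ) with hE
    have hE0 : 0 ≤ E := by positivity
    have heB4 : e * B ^ 4 ≤ E := by
      rw [hE]
      gcongr
      rw [← Real.rpow_natCast]
      exact Real.rpow_le_rpow_of_exponent_le hB1 (by push_cast; linarith)
    have hkey := NearCurve.mul_sq_le_of_det3_eq_zero hu hv hw hc hB hd huv huw hvw
      (κ := κ * X ^ k) (by positivity) hq0.le (by
        have := hdd _ hIu _ hIv _ hIw
        calc κ * X ^ k * |(absc v - absc u) * (absc w - absc u) * (absc w - absc v)|
            = _ := by ring
          _ ≤ _ := this) quv quw qvw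
    -- `X ^ k ≤ (4 / κ) E q⁻²`
    have hXk : X ^ k * q ^ 2 ≤ 4 / κ * E := by
      rw [div_mul_eq_mul_div, le_div_iff₀ hκ]
      have : X ^ k * q ^ 2 * κ = κ * X ^ k * q ^ 2 := by ring
      linarith
    have hXq : X ≤ q ^ (-δ) := by
      by_contra! hlt
      have hqδ : (0 : ℝ) < q ^ (-δ) := by positivity
      have hk0 : k ≠ 0 ∨ k = 0 := (em _).symm
      have h4 : 4 / κ * E ≤ 1 := by
        rw [div_mul_eq_mul_div, div_le_one hκ]; linarith
      rcases Nat.eq_zero_or_pos k with hk | hk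
      · have hlt' := hlt
        rw [hk, pow_zero, one_mul] at hXk
        have hq' : q = 1 := by nlinarith only [hXk, h4, hq1]
        rw [hq', Real.one_rpow] at hlt
        linarith
      · have h1 : (q ^ (-δ)) ^ k < X ^ k := pow_lt_pow_left₀ hlt hqδ.le hk.ne'
        have h2 : q ^ (-2 : ℝ) ≤ (q ^ (-δ)) ^ k := by
          rw [← Real.rpow_natCast, ← Real.rpow_mul hq0.le]
          exact Real.rpow_le_rpow_of_exponent_le hq1 (by linarith)
        have h3 : q ^ (-2 : ℝ) * q ^ 2 = 1 := by
          rw [Real.rpow_neg hq0.le, ← Real.rpow_natCast]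
          push_cast
          exact inv_mul_cancel₀ (by positivity)
        have h5 : q ^ (-2 : ℝ) * q ^ 2 < X ^ k * q ^ 2 :=
          mul_lt_mul_of_pos_right (h2.trans_lt h1) (by positivity)
        linarith
    set Q : ℝ := q ^ (-(2 + δ)) with hQ
    have hQ0 : 0 < Q := by positivity
    have hXk1 : X ^ (k + 1) ≤ 4 / κ * E * Q := by
      have h3 : q ^ (-2 : ℝ) * q ^ 2 = 1 := by
        rw [Real.rpow_neg hq0.le, ← Real.rpow_natCast]
        push_cast
        exact inv_mul_cancel₀ (by positivity)
      have h4 : X ^ k ≤ 4 / κ * E * q ^ (-2 : ℝ) := by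
        have : X ^ k * q ^ 2 * q ^ (-2 : ℝ) ≤ 4 / κ * E * q ^ (-2 : ℝ) := by gcongr
        calc X ^ k = X ^ k * (q ^ (-2 : ℝ) * q ^ 2) := by rw [h3, mul_one]
          _ = X ^ k * q ^ 2 * q ^ (-2 : ℝ) := by ring
          _ ≤ _ := this
      calc X ^ (k + 1) = X ^ k * X := pow_succ _ _
        _ ≤ 4 / κ * E * q ^ (-2 : ℝ) * q ^ (-δ) := by gcongr
        _ = 4 / κ * E * Q := by
          rw [mul_assoc, ← Real.rpow_add hq0, hQ]; congr 2; ring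
    have hqB : q ≤ 2 * B ^ 2 := by
      have : |absc v - absc u| ≤ 2 := by
        calc |absc v - absc u| = |(absc v - a) - (absc u - a)| := by congr 1; ring
          _ ≤ |absc v - a| + |absc u - a| := abs_sub _ _
          _ ≤ 2 := by linarith [hI _ hIv, hI _ hIu]
      exact quv.trans (by gcongr)
    have heq : e * B ^ 2 / q ≤ 4 * E * Q := by
      have h1 : q ^ (1 + δ) ≤ 4 * B ^ (2 + 2 * δ) := by
        calc q ^ (1 + δ) ≤ (2 * B ^ 2) ^ (1 + δ) := by gcongr
          _ = 2 ^ (1 + δ) * (B ^ 2) ^ (1 + δ) := Real.mul_rpow (by norm_num) (by positivity)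
          _ ≤ 2 ^ (2 : ℝ) * (B ^ 2) ^ (1 + δ) := by
            gcongr
            · norm_num
            · linarith
          _ = 4 * B ^ (2 + 2 * δ) := by
            rw [← Real.rpow_natCast B 2, ← Real.rpow_mul hB.le]
            norm_num
            congr 1; ring
      have h2 : q⁻¹ = q ^ (1 + δ) * Q := by
        rw [hQ, ← Real.rpow_add hq0, ← Real.rpow_neg_one]; congr 1; ring
      have h3 : B ^ 2 * B ^ (2 + 2 * δ) = B ^ (4 + 2 * δ) := by
        rw [← Real.rpow_natCast B 2, ← Real.rpow_add hB]; congr 1; push_cast; ring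
      rw [div_eq_mul_inv, h2]
      calc e * B ^ 2 * (q ^ (1 + δ) * Q) ≤ e * B ^ 2 * (4 * B ^ (2 + 2 * δ) * Q) := by gcongr
        _ = 4 * (e * (B ^ 2 * B ^ (2 + 2 * δ))) * Q := by ring
        _ = _ := by rw [h3]
    have hlθ : |l - θ| ≤ R * E * Q := by
      have p1 : 0 < |absc u - absc v| := abs_pos.mpr (sub_ne_zero.mpr huv)
      have h1 : (l - θ) * (absc u - absc v) = (ordi u - f (absc u)) - (ordi v - f (absc v)) +
          ((f (absc u) - θ * absc u) - (f (absc v) - θ * absc v)) := by rw [lu, lv]; ring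
      have h2 : |l - θ| * |absc u - absc v| ≤ 2 * e + K * X ^ (k + 1) * |absc u - absc v| := by
        rw [← abs_mul, h1]
        have i1 := abs_le.mp hu.near
        have i2 := abs_le.mp hv.near
        have i3 := abs_le.mp (hr _ hIu _ hIv hvu)
        rw [abs_le]; constructor <;> linarith
      have h3 : 2 * e ≤ 2 * (e * B ^ 2 / q) * |absc u - absc v| := by
        rw [abs_sub_comm] at quv
        have : 2 * (e * B ^ 2 / q) * |absc u - absc v| =
            2 * e * (|absc u - absc v| * B ^ 2) / q := by
          ring
        rw [this, le_div_iff₀ hq0]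
        gcongr
      have h4 : |l - θ| ≤ 2 * (e * B ^ 2 / q) + K * X ^ (k + 1) := by
        refine le_of_mul_le_mul_right ?_ p1
        linarith
      have h5 : K * X ^ (k + 1) ≤ K * (4 / κ * E * Q) := by gcongr
      calc |l - θ| ≤ 2 * (4 * E * Q) + K * (4 / κ * E * Q) := by linarith
        _ = R * E * Q := by rw [hR]; ring
    have hmμ : |m - μ₀| ≤ R' * E * Q := by
      have h1 : m - μ₀ = (ordi u - f (absc u)) + (f (absc u) - (θ * absc u + μ₀)) -
          (l - θ) * absc u := by rw [lu]; ring
      have h2 : |absc u| ≤ |a| + 1 := by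
        calc |absc u| = |(absc u - a) + a| := by congr 1; ring
          _ ≤ |absc u - a| + |a| := abs_add_le _ _
          _ ≤ _ := by linarith
      have h3 : |(l - θ) * absc u| ≤ R * E * Q * (|a| + 1) := by
        rw [abs_mul]; gcongr
      have h4 := abs_le.mp hu.near
      have h5 := abs_le.mp (hr0 _ hIu)
      have h6 := abs_le.mp h3
      have h7 : e ≤ 2 * (e * B ^ 2 / q) := by
        rw [mul_div_assoc', le_div_iff₀ hq0]
        linarith [mul_le_mul_of_nonneg_left hqB he]
      have h8 : K * X ^ (k + 1) ≤ K * (4 / κ * E * Q) := by gcongr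
      have h9 : |m - μ₀| ≤ e + K * X ^ (k + 1) + R * E * Q * (|a| + 1) := by
        rw [h1, abs_le]; constructor <;> linarith
      have h10 : e + K * X ^ (k + 1) ≤ R * E * Q := by
        have : R * E * Q = K * (4 / κ * E * Q) + 2 * (4 * E * Q) := by rw [hR]; ring
        linarith
      have h11 : 0 ≤ R * E * Q := by positivity
      have h12 : R' * E * Q = R * E * Q * (|a| + 1) + 2 * (R * E * Q) := by rw [hR']; ring
      linarith
    have hl_eq : l = θ := by
      by_contra hlne
      have h1 := hroth₁ (-h 1) (h 2) hh2 hlne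
      have h2 : R * E < c₁ := by
        calc R * E ≤ R * (c₁ / (2 * R)) := by gcongr
          _ = c₁ / 2 := by field_simp
          _ < c₁ := by linarith
      have h3 : R * E * Q < c₁ * Q := by gcongr
      rw [← hqdef, ← hQ, ← hl] at h1
      linarith
    have hm_eq : m = μ₀ := by
      by_contra hlne
      have h1 := hroth₂ (-h 0) (h 2) hh2 hlne
      have h2 : R' * E < c₂ := by
        calc R' * E ≤ R' * (c₂ / (2 * R')) := by gcongr
          _ = c₂ / 2 := by field_simp
          _ < c₂ := by linarith
      have h3 : R' * E * Q < c₂ * Q := by gcongr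
      rw [← hqdef, ← hQ, ← hm] at h1
      linarith
    rw [hl_eq, hm_eq] at lu lv lw
    exact ⟨lu, lv, lw⟩
  intro e B hB1 hη u v w hu hv hw hIu hIv hIw huv huw hvw hoff hd
  by_cases h1 : |absc v - a| ≤ |absc u - a| ∧ |absc w - a| ≤ |absc u - a|
  · exact hoff (main e B hB1 hη u v w hu hv hw hIu hIv hIw huv huw hvw h1.1 h1.2 hd).1
  by_cases h2 : |absc u - a| ≤ |absc v - a| ∧ |absc w - a| ≤ |absc v - a|
  · exact hoff (main e B hB1 hη v u w hv hu hw hIv hIu hIw huv.symm hvw huw h2.1 h2.2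
      (by simp only [det3] at hd ⊢; linarith)).2.1
  have h3 : |absc u - a| ≤ |absc w - a| ∧ |absc v - a| ≤ |absc w - a| := by
    simp only [not_and_or, not_le] at h1 h2
    constructor <;> rcases h1 with h1 | h1 <;> rcases h2 with h2 | h2 <;> linarith
  exact hoff (main e B hB1 hη w u v hw hu hv hIw hIu hIv huw.symm hvw.symm huv h3.1 h3.2
      (by simp only [det3] at hd ⊢; linarith)).2.1

end Collinear

section DDBound

theorem dd_pow_lower {s₁ s₂ s₃ : ℝ} (h0 : 0 ≤ s₁) (h12 : s₁ ≤ s₂) (h23 : s₂ ≤ s₃) (k : ℕ) :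
    (s₂ - s₁) * (s₃ - s₁) * (s₃ - s₂) * s₃ ^ k ≤ dd (fun t => t ^ (k + 2)) s₁ s₂ s₃ := by
  induction k with
  | zero => simp only [dd]; apply le_of_eq; ring
  | succ k ih =>
    have h1 : dd (fun t => t ^ (k + 1 + 2)) s₁ s₂ s₃ =
        s₃ * dd (fun t => t ^ (k + 2)) s₁ s₂ s₃ +
          (s₃ - s₁) * (s₃ - s₂) * (s₂ ^ (k + 2) - s₁ ^ (k + 2)) := by
      simp only [dd]; ring
    have h2 : s₁ ^ (k + 2) ≤ s₂ ^ (k + 2) := by gcongr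
    have h3 : 0 ≤ (s₃ - s₁) * (s₃ - s₂) * (s₂ ^ (k + 2) - s₁ ^ (k + 2)) :=
      mul_nonneg (mul_nonneg (by linarith) (by linarith)) (by linarith)
    have h4 := mul_le_mul_of_nonneg_left ih (show 0 ≤ s₃ by linarith)
    rw [h1, pow_succ]
    linarith

theorem dd_nonneg_of_convexOn {g : ℝ → ℝ} {s : Set ℝ} (hg : ConvexOn ℝ s g) {x y z : ℝ}
    (hx : x ∈ s) (hz : z ∈ s) (hxy : x ≤ y) (hyz : y ≤ z) : 0 ≤ dd g x y z := by
  rcases hxy.eq_or_lt with rfl | hxy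
  · simp [dd]
  rcases hyz.eq_or_lt with rfl | hyz
  · simp [dd]
  have h := hg.slope_mono_adjacent hx hz hxy hyz
  rw [div_le_div_iff₀ (by linarith) (by linarith)] at h
  simp only [dd]
  linarith

/-- The determinant on a graph is bounded below when the second derivative is. -/
theorem dd_lower_of_deriv2 {f f' f'' : ℝ → ℝ} {a b κ : ℝ} {k : ℕ} (hκ : 0 ≤ κ)
    (hf : ∀ x ∈ Set.Icc a b, HasDerivAt f (f' x) x)
    (hf' : ∀ x ∈ Set.Icc a b, HasDerivAt f' (f'' x) x)
    (hf'' : ∀ x ∈ Set.Icc a b, κ * ((k + 2) * (k + 1)) * (x - a) ^ k ≤ f'' x) {x y z : ℝ}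
    (hx : x ∈ Set.Icc a b) (hz : z ∈ Set.Icc a b) (hxy : x ≤ y) (hyz : y ≤ z) :
    κ * ((y - x) * (z - x) * (z - y)) * (z - a) ^ k ≤ dd f x y z := by
  have hconv : ConvexOn ℝ (Set.Icc a b) fun t => f t - κ * (t - a) ^ (k + 2) := by
    refine convexOn_of_hasDerivWithinAt2_nonneg (convex_Icc a b)
      (f' := fun t => f' t - κ * ((k + 2) * (t - a) ^ (k + 1)))
      (f'' := fun t => f'' t - κ * ((k + 2) * ((k + 1) * (t - a) ^ k))) ?_ ?_ ?_ ?_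
    · intro t ht
      exact ((hf t ht).continuousAt.sub (by fun_prop)).continuousWithinAt
    · intro t ht
      refine ((hf t (interior_subset ht)).sub ?_).hasDerivWithinAt
      have := (((hasDerivAt_id' t).sub_const a).fun_pow (k + 2)).const_mul κ
      exact this.congr_deriv (by simp)
    · intro t ht
      refine ((hf' t (interior_subset ht)).sub ?_).hasDerivWithinAt
      have := ((((hasDerivAt_id' t).sub_const a).fun_pow (k + 1)).const_mul
        ((k : ℝ) + 2)).const_mul κ
      exact this.congr_deriv (by simp)
    · intro t ht
      have := hf'' t (interior_subset ht)
      linarith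
  have h1 := dd_nonneg_of_convexOn hconv hx hz hxy hyz
  have h2 : dd f x y z = dd (fun t => f t - κ * (t - a) ^ (k + 2)) x y z +
      κ * dd (fun t => t ^ (k + 2)) (x - a) (y - a) (z - a) := by
    simp only [dd]; ring
  have h3 := mul_le_mul_of_nonneg_left
    (dd_pow_lower (s₁ := x - a) (s₂ := y - a) (s₃ := z - a) (by linarith [hx.1]) (by linarith)
    (by linarith) k) hκ
  rw [h2]
  have h4 : κ * ((y - a - (x - a)) * (z - a - (x - a)) * (z - a - (y - a)) * (z - a) ^ k) =
    κ * ((y - x) * (z - x) * (z - y)) * (z - a) ^ k := by ring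
  linarith

theorem abs_dd_lower {f f' f'' : ℝ → ℝ} {a b κ : ℝ} {k : ℕ} (hκ : 0 ≤ κ)
    (hf : ∀ x ∈ Set.Icc a b, HasDerivAt f (f' x) x)
    (hf' : ∀ x ∈ Set.Icc a b, HasDerivAt f' (f'' x) x)
    (hf'' : ∀ x ∈ Set.Icc a b, κ * ((k + 2) * (k + 1)) * (x - a) ^ k ≤ f'' x) {x y z : ℝ}
    (hx : x ∈ Set.Icc a b) (hy : y ∈ Set.Icc a b) (hz : z ∈ Set.Icc a b) :
    κ * |(y - x) * (z - x) * (z - y)| * |x - a| ^ k ≤ |dd f x y z| := by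
  have key : ∀ x y z p : ℝ, x ∈ Set.Icc a b → z ∈ Set.Icc a b → p ∈ Set.Icc a b → x ≤ y → y ≤ z →
      p ≤ z → κ * |(y - x) * (z - x) * (z - y)| * |p - a| ^ k ≤ |dd f x y z| := by
    intro x y z p hx hz hp hxy hyz hpz
    have h := dd_lower_of_deriv2 hκ hf hf' hf'' hx hz hxy hyz
    rw [abs_of_nonneg (mul_nonneg (mul_nonneg (by linarith) (by linarith)) (by linarith)),
      abs_of_nonneg (show 0 ≤ p - a by linarith [hp.1])]
    refine le_trans ?_ (h.trans (le_abs_self _))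
    have : 0 ≤ (y - x) * (z - x) * (z - y) :=
      mul_nonneg (mul_nonneg (by linarith) (by linarith)) (by linarith)
    have h0 : 0 ≤ p - a := by linarith [hp.1]
    gcongr
  have sw1 : ∀ x y z : ℝ, |dd f x y z| = |dd f y x z| := by
    intro x y z
    rw [← abs_neg]; congr 1; simp only [dd]; ring
  have sw2 : ∀ x y z : ℝ, |dd f x y z| = |dd f x z y| := by
    intro x y z
    rw [← abs_neg]; congr 1; simp only [dd]; ring
  have v1 : ∀ x y z : ℝ, |(y - x) * (z - x) * (z - y)| = |(x - y) * (z - y) * (z - x)| := by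
    intro x y z
    rw [← abs_neg]; congr 1; ring
  have v2 : ∀ x y z : ℝ, |(y - x) * (z - x) * (z - y)| = |(z - x) * (y - x) * (y - z)| := by
    intro x y z
    rw [← abs_neg]; congr 1; ring
  rcases le_total x y with h1 | h1 <;> rcases le_total y z with h2 | h2 <;>
    rcases le_total x z with h3 | h3
  · exact key x y z x hx hz hx h1 h2 h3
  · exact key x y z x hx hz hx h1 h2 (h1.trans h2)
  · rw [sw2, v2]; exact key x z y x hx hy hx h3 h2 h1
  · rw [sw2, v2, sw1, v1]; exact key z x y x hz hy hx h3 h1 h1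
  · rw [sw1, v1]; exact key y x z x hy hz hx h1 h3 h3
  · rw [sw1, v1, sw2, v2]; exact key y z x x hy hx hx h2 h3 le_rfl
  · rw [sw1, v1]; exact key y x z x hy hz hx h1 h3 h3
  · rw [sw1, v1, sw2, v2, sw1, v1]; exact key z y x x hz hx hx h2 h1 le_rfl

theorem dd_neg (f : ℝ → ℝ) (x y z : ℝ) : dd (fun t => -f t) x y z = -dd f x y z := by
  simp only [dd]; ring

end DDBound

section Taylor

/-- Taylor's inequality for a family of iterated derivatives on a segment. -/
theorem abs_sub_taylor_le {D : ℕ → ℝ → ℝ} {lo hi R : ℝ} (n : ℕ)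
    (hD : ∀ j, ∀ x ∈ Set.Icc lo hi, HasDerivAt (D j) (D (j + 1) x) x)
    (hR : ∀ x ∈ Set.Icc lo hi, |D n x| ≤ R) {x y : ℝ} (hx : x ∈ Set.Icc lo hi)
    (hy : y ∈ Set.Icc lo hi) :
    |D 0 y - ∑ j ∈ Finset.range n, D j x * (y - x) ^ j / j.factorial| ≤ R * |y - x| ^ n := by
  induction n generalizing D y with
  | zero => simpa using hR y hy
  | succ n ih =>
    have hsub : Set.uIcc x y ⊆ Set.Icc lo hi := Set.uIcc_subset_Icc hx hy
    have hder : ∀ z ∈ Set.uIcc x y, HasDerivWithinAt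
        (fun y => D 0 y - ∑ j ∈ Finset.range (n + 1), D j x * (y - x) ^ j / j.factorial)
        (D 1 z - ∑ j ∈ Finset.range n, D (j + 1) x * (z - x) ^ j / j.factorial)
        (Set.uIcc x y) z := by
      intro z hz
      refine HasDerivAt.hasDerivWithinAt ((hD 0 z (hsub hz)).fun_sub ?_)
      have h1 : HasDerivAt (fun y => ∑ j ∈ Finset.range (n + 1), D j x * (y - x) ^ j / j.factorial)
          (∑ j ∈ Finset.range (n + 1),
            D j x * ((j : ℝ) * (z - x) ^ (j - 1) * 1) / j.factorial) z :=
        HasDerivAt.fun_sum fun j _ =>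
          ((((hasDerivAt_id' z).sub_const x).fun_pow j).const_mul (D j x)).div_const _
      refine h1.congr_deriv ?_
      rw [Finset.sum_range_succ']
      simp only [Nat.cast_zero, zero_mul, mul_zero, zero_div, add_zero, Nat.add_sub_cancel, mul_one]
      refine Finset.sum_congr rfl fun j _ => ?_
      rw [Nat.factorial_succ]
      push_cast
      field_simp
    have hbd : ∀ z ∈ Set.uIcc x y,
        ‖D 1 z - ∑ j ∈ Finset.range n, D (j + 1) x * (z - x) ^ j / j.factorial‖ ≤
          R * |y - x| ^ n := by
      intro z hz
      rw [Real.norm_eq_abs]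
      refine (ih (D := fun j => D (j + 1)) (fun j => hD (j + 1)) hR (hsub hz)).trans ?_
      have h0 : 0 ≤ R := (abs_nonneg _).trans (hR x hx)
      have h1 : |z - x| ≤ |y - x| := Set.abs_sub_left_of_mem_uIcc hz
      gcongr
    have := Convex.norm_image_sub_le_of_norm_hasDerivWithin_le hder hbd (convex_uIcc x y)
      Set.left_mem_uIcc Set.right_mem_uIcc
    rw [Finset.sum_range_succ' (fun j => D j x * (x - x) ^ j / (j.factorial : ℝ))] at this
    simp only [sub_self, ne_eq, Nat.add_eq_zero_iff, one_ne_zero, and_false, not_false_eq_true,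
      zero_pow, mul_zero, zero_div, Finset.sum_const_zero, pow_zero, mul_one, Nat.factorial_zero,
      Nat.cast_one, div_one, zero_add, sub_zero, Real.norm_eq_abs] at this
    rw [pow_succ, ← mul_assoc]
    exact this

/-- Coefficients of a polynomial are controlled by its values at well spaced points. -/
theorem exists_abs_coeff_le (n : ℕ) (A s : ℝ) (hs : 0 < s) :
    ∃ K : ℝ, 0 < K ∧ ∀ t : Fin n → ℝ, (∀ i, |t i| ≤ A) → (∀ i j, i ≠ j → s ≤ |t i - t j|) →
      ∀ (g : Fin n → ℝ) (δ : ℝ), (∀ i, |∑ j, g j * t i ^ (j : ℕ)| ≤ δ) → ∀ j, |g j| ≤ K * δ := by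
  set X : ℝ := (max A 1) ^ n with hX
  have hA1 : 1 ≤ max A 1 := le_max_right _ _
  have hX1 : 1 ≤ X := one_le_pow₀ hA1
  set P : ℝ := ∏ i : Fin n, ∏ j ∈ Finset.Ioi i, s with hP
  have hP0 : 0 < P := Finset.prod_pos fun i _ => Finset.prod_pos fun j _ => hs
  refine ⟨(n * (n.factorial * X ^ n) + 1) / P, by positivity, ?_⟩
  intro t htA hts g δ hδ j
  set V := Matrix.vandermonde t with hV
  have hdet : P ≤ |V.det| := by
    rw [hV, Matrix.det_vandermonde, Finset.abs_prod]
    refine Finset.prod_le_prod (fun i _ => Finset.prod_nonneg fun j _ => hs.le) fun i _ => ?_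
    rw [Finset.abs_prod]
    refine Finset.prod_le_prod (fun _ _ => hs.le) fun j hj => ?_
    exact hts j i (Finset.mem_Ioi.mp hj).ne'
  have hent : ∀ i k, |V i k| ≤ X := by
    intro i k
    rw [hV, Matrix.vandermonde_apply, abs_pow]
    calc |t i| ^ (k : ℕ) ≤ (max A 1) ^ (k : ℕ) := by
          gcongr; exact (htA i).trans (le_max_left _ _)
      _ ≤ X := pow_le_pow_right₀ hA1 k.2.le
  have hadj : ∀ i k, |V.adjugate i k| ≤ n.factorial * X ^ n := by
    intro i k
    rw [Matrix.adjugate_apply]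
    have := Matrix.det_le (A := V.updateRow k (Pi.single i 1)) (abv := AbsoluteValue.abs) (x := X)
      (fun a b => by
        rw [Matrix.updateRow_apply]
        split_ifs
        · rw [Pi.single_apply]
          split_ifs
          · simpa using hX1
          · simpa using (zero_le_one.trans hX1)
        · exact hent a b)
    simpa using this
  have hmul : V.det * g j = ∑ i, V.adjugate j i * (∑ k, g k * t i ^ (k : ℕ)) := by
    have h1 : V.adjugate.mulVec (V.mulVec g) = V.det • g := by
      rw [Matrix.mulVec_mulVec, Matrix.adjugate_mul, Matrix.smul_mulVec, Matrix.one_mulVec]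
    have h2 := congrFun h1 j
    rw [Pi.smul_apply, smul_eq_mul] at h2
    rw [← h2]
    simp only [Matrix.mulVec, dotProduct, hV, Matrix.vandermonde_apply]
    refine Finset.sum_congr rfl fun i _ => ?_
    congr 1
    exact Finset.sum_congr rfl fun k _ => mul_comm _ _
  have hδ0 : 0 ≤ δ := (abs_nonneg _).trans (hδ j)
  have h3 : |V.det * g j| ≤ n * (n.factorial * X ^ n) * δ := by
    rw [hmul]
    refine (Finset.abs_sum_le_sum_abs _ _).trans ?_
    calc ∑ i, |V.adjugate j i * (∑ k, g k * t i ^ (k : ℕ))|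
        ≤ ∑ _i : Fin n, (n.factorial * X ^ n) * δ := by
          refine Finset.sum_le_sum fun i _ => ?_
          rw [abs_mul]
          exact mul_le_mul (hadj j i) (hδ i) (abs_nonneg _) (by positivity)
      _ = _ := by simp; ring
  rw [abs_mul] at h3
  rw [div_mul_eq_mul_div, le_div_iff₀ hP0]
  calc |g j| * P ≤ |g j| * |V.det| := by gcongr
    _ ≤ n * (n.factorial * X ^ n) * δ := by linarith
    _ ≤ (n * (n.factorial * X ^ n) + 1) * δ := by gcongr; linarith

end Taylor

section Conic

/-- The inhomogeneous quadratic polynomial with coefficients `q`. -/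
def conic {R : Type*} [CommRing R] (q : Fin 6 → R) (x y : R) : R :=
  q 0 + q 1 * x + q 2 * x ^ 2 + q 3 * y + q 4 * (x * y) + q 5 * y ^ 2

/-- The quadratic form with coefficients `q`. -/
def conicForm {R : Type*} [CommRing R] (q : Fin 6 → R) (v : Fin 3 → R) : R :=
  q 0 * v 0 ^ 2 + q 1 * (v 0 * v 1) + q 2 * v 1 ^ 2 + q 3 * (v 0 * v 2) + q 4 * (v 1 * v 2) +
    q 5 * v 2 ^ 2

/-- The coefficients of `q` in the affine coordinates `x = a + t`, `y = y₀ + θ t + w`. -/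
def conicShift {R : Type*} [CommRing R] (q : Fin 6 → R) (a y₀ θ : R) : Fin 6 → R :=
  ![conic q a y₀, q 1 + 2 * q 2 * a + q 3 * θ + q 4 * (y₀ + a * θ) + 2 * q 5 * y₀ * θ,
    q 2 + q 4 * θ + q 5 * θ ^ 2, q 3 + q 4 * a + 2 * q 5 * y₀, q 4 + 2 * q 5 * θ, q 5]

theorem conic_shift {R : Type*} [CommRing R] (q : Fin 6 → R) (a y₀ θ t w : R) :
    conic q (a + t) (y₀ + θ * t + w) = conic (conicShift q a y₀ θ) t w := by
  simp [conic, conicShift]; ring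

theorem abs_le_of_conicShift (q : Fin 6 → ℝ) {a y₀ θ R N : ℝ} (hR : 1 ≤ R) (ha : |a| ≤ R)
    (hy : |y₀| ≤ R) (hθ : |θ| ≤ R) (hN : ∀ i, |conicShift q a y₀ θ i| ≤ N) :
    ∀ i, |q i| ≤ 50 * R ^ 4 * N := by
  have hN0 : 0 ≤ N := (abs_nonneg _).trans (hN 0)
  have h5 : |q 5| ≤ N := by simpa [conicShift] using hN 5
  have h4' : |q 4 + 2 * q 5 * θ| ≤ N := by simpa [conicShift] using hN 4
  have h3' : |q 3 + q 4 * a + 2 * q 5 * y₀| ≤ N := by simpa [conicShift] using hN 3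
  have h2' : |q 2 + q 4 * θ + q 5 * θ ^ 2| ≤ N := by simpa [conicShift] using hN 2
  have h1' : |q 1 + 2 * q 2 * a + q 3 * θ + q 4 * (y₀ + a * θ) + 2 * q 5 * y₀ * θ| ≤ N := by
    simpa [conicShift] using hN 1
  have h0' : |q 0 + q 1 * a + q 2 * a ^ 2 + q 3 * y₀ + q 4 * (a * y₀) + q 5 * y₀ ^ 2| ≤ N := by
    simpa [conicShift, conic] using hN 0
  have mm : ∀ {x y X Y : ℝ}, |x| ≤ X → |y| ≤ Y → |x * y| ≤ X * Y := by
    intro x y X Y hx hy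
    rw [abs_mul]
    exact mul_le_mul hx hy (abs_nonneg _) ((abs_nonneg _).trans hx)
  have hR0 : 0 ≤ R := by linarith
  have p1 : N ≤ R * N := le_mul_of_one_le_left hN0 hR
  have p2 : R * N ≤ R ^ 2 * N := by nlinarith only [mul_nonneg hR0 hN0, hR]
  have p3 : R ^ 2 * N ≤ R ^ 3 * N := by nlinarith only [mul_nonneg (pow_nonneg hR0 2) hN0, hR]
  have p4 : R ^ 3 * N ≤ R ^ 4 * N := by nlinarith only [mul_nonneg (pow_nonneg hR0 3) hN0, hR]
  have h4 : |q 4| ≤ 3 * (R * N) := by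
    have e1 := abs_le.mp (mm h5 hθ)
    have e2 := abs_le.mp h4'
    rw [abs_le]; constructor <;> linarith
  have h3 : |q 3| ≤ 6 * (R ^ 2 * N) := by
    have e1 := abs_le.mp (mm h4 ha)
    have e2 := abs_le.mp (mm h5 hy)
    have e3 := abs_le.mp h3'
    rw [abs_le]; constructor <;> linarith
  have h2 : |q 2| ≤ 5 * (R ^ 2 * N) := by
    have e1 := abs_le.mp (mm h4 hθ)
    have e2 := abs_le.mp (mm (mm h5 hθ) hθ)
    have e3 := abs_le.mp h2'
    rw [abs_le]; constructor <;> linarith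
  have h1 : |q 1| ≤ 25 * (R ^ 3 * N) := by
    have e1 := abs_le.mp (mm h2 ha)
    have e2 := abs_le.mp (mm h3 hθ)
    have e3 := abs_le.mp (mm h4 hy)
    have e4 := abs_le.mp (mm (mm h4 ha) hθ)
    have e5 := abs_le.mp (mm (mm h5 hy) hθ)
    have e6 := abs_le.mp h1'
    rw [abs_le]; constructor <;> linarith
  have h0 : |q 0| ≤ 50 * (R ^ 4 * N) := by
    have e1 := abs_le.mp (mm h1 ha)
    have e2 := abs_le.mp (mm (mm h2 ha) ha)
    have e3 := abs_le.mp (mm h3 hy)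
    have e4 := abs_le.mp (mm (mm h4 ha) hy)
    have e5 := abs_le.mp (mm (mm h5 hy) hy)
    have e6 := abs_le.mp h0'
    rw [abs_le]; constructor <;> linarith
  intro i
  fin_cases i <;> simp only [Fin.zero_eta, Fin.mk_one, Fin.reduceFinMk] <;> linarith

theorem conicForm_eq {v : Fin 3 → ℤ} (q : Fin 6 → ℤ) (hv : 0 < (v 0 : ℝ)) :
    ((conicForm q v : ℤ) : ℝ) = v 0 ^ 2 * conic (fun i => (q i : ℝ)) (absc v) (ordi v) := by
  simp only [conicForm, conic]
  push_cast
  rw [← NearCurve.mul_absc hv, ← NearCurve.mul_ordi hv]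
  ring

/-- The value of a quadratic form at a sum of two zeros in terms of a second difference. -/
theorem conicForm_add_eq {v w : Fin 3 → ℤ} (q : Fin 6 → ℤ) (hv : 0 < (v 0 : ℝ))
    (hw : 0 < (w 0 : ℝ)) (hqv : conicForm q v = 0) (hqw : conicForm q w = 0) :
    ((conicForm q (v + w) : ℤ) : ℝ) = -(v 0 * w 0 * (q 2 * (absc w - absc v) ^ 2 +
      q 4 * ((absc w - absc v) * (ordi w - ordi v)) + q 5 * (ordi w - ordi v) ^ 2)) := by
  have h1 : ((conicForm q v : ℤ) : ℝ) = 0 := by rw [hqv, Int.cast_zero]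
  have h2 : ((conicForm q w : ℤ) : ℝ) = 0 := by rw [hqw, Int.cast_zero]
  have hcv : conic (fun i => (q i : ℝ)) (absc v) (ordi v) = 0 := by
    rw [conicForm_eq q hv] at h1
    exact (mul_eq_zero.mp h1).resolve_left (by positivity)
  have hcw : conic (fun i => (q i : ℝ)) (absc w) (ordi w) = 0 := by
    rw [conicForm_eq q hw] at h2
    exact (mul_eq_zero.mp h2).resolve_left (by positivity)
  simp only [conic] at hcv hcw
  simp only [conicForm, Pi.add_apply]
  push_cast
  rw [← NearCurve.mul_absc hv, ← NearCurve.mul_ordi hv, ← NearCurve.mul_absc hw,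
    ← NearCurve.mul_ordi hw]
  linear_combination (v 0 * (v 0 + w 0)) * hcv + (w 0 * (v 0 + w 0)) * hcw

/-- Through five integral points in general position passes a conic with small second
difference. -/
theorem exists_conic {P : Fin 5 → Fin 3 → ℤ} {D₀ : ℝ}
    (hdet : ∀ i j k, i ≠ j → i ≠ k → j ≠ k → det3 (P i) (P j) (P k) ≠ 0)
    (hD : ∀ i j k, |(det3 (P i) (P j) (P k) : ℝ)| ≤ D₀) :
    ∃ q : Fin 6 → ℤ, q ≠ 0 ∧ (∀ i, conicForm q (P i) = 0) ∧
      |((conicForm q (P 0 + P 1) : ℤ) : ℝ)| ≤ 2 * D₀ ^ 6 := by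
  obtain ⟨l, hl⟩ : ∃ l : Fin 3 → ℤ, ∀ v, det3 v (P 1) (P 2) = l 0 * v 0 + l 1 * v 1 + l 2 * v 2 :=
    ⟨![P 1 1 * P 2 2 - P 1 2 * P 2 1, -(P 1 0 * P 2 2 - P 1 2 * P 2 0),
      P 1 0 * P 2 1 - P 1 1 * P 2 0], fun v => by simp [det3]; ring⟩
  obtain ⟨m, hm⟩ : ∃ l : Fin 3 → ℤ, ∀ v, det3 (P 0) v (P 2) = l 0 * v 0 + l 1 * v 1 + l 2 * v 2 :=
    ⟨![-(P 0 1 * P 2 2 - P 0 2 * P 2 1), (P 0 0 * P 2 2 - P 0 2 * P 2 0),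
      -(P 0 0 * P 2 1 - P 0 1 * P 2 0)], fun v => by simp [det3]; ring⟩
  obtain ⟨n, hn⟩ : ∃ l : Fin 3 → ℤ, ∀ v, det3 (P 0) (P 1) v = l 0 * v 0 + l 1 * v 1 + l 2 * v 2 :=
    ⟨![(P 0 1 * P 1 2 - P 0 2 * P 1 1), -(P 0 0 * P 1 2 - P 0 2 * P 1 0),
      (P 0 0 * P 1 1 - P 0 1 * P 1 0)], fun v => by simp [det3]; ring⟩
  obtain ⟨a₁, ha₁⟩ : ∃ x, x = det3 (P 3) (P 1) (P 2) := ⟨_, rfl⟩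
  obtain ⟨a₂, ha₂⟩ : ∃ x, x = det3 (P 0) (P 3) (P 2) := ⟨_, rfl⟩
  obtain ⟨a₃, ha₃⟩ : ∃ x, x = det3 (P 0) (P 1) (P 3) := ⟨_, rfl⟩
  obtain ⟨b₁, hb₁⟩ : ∃ x, x = det3 (P 4) (P 1) (P 2) := ⟨_, rfl⟩
  obtain ⟨b₂, hb₂⟩ : ∃ x, x = det3 (P 0) (P 4) (P 2) := ⟨_, rfl⟩
  obtain ⟨b₃, hb₃⟩ : ∃ x, x = det3 (P 0) (P 1) (P 4) := ⟨_, rfl⟩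
  obtain ⟨d, hd⟩ : ∃ x, x = det3 (P 0) (P 1) (P 2) := ⟨_, rfl⟩
  set α := a₁ * b₁ * (a₃ * b₂ - a₂ * b₃) with hα
  set β := a₂ * b₂ * (a₁ * b₃ - a₃ * b₁) with hβ
  set γ := a₃ * b₃ * (a₂ * b₁ - a₁ * b₂) with hγ
  obtain ⟨q, hq⟩ : ∃ q : Fin 6 → ℤ, ∀ v, conicForm q v =
      α * (det3 (P 0) v (P 2) * det3 (P 0) (P 1) v) +
      β * (det3 v (P 1) (P 2) * det3 (P 0) (P 1) v) +
      γ * (det3 v (P 1) (P 2) * det3 (P 0) v (P 2)) := by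
    refine ⟨![α * (m 0 * n 0) + β * (l 0 * n 0) + γ * (l 0 * m 0),
      α * (m 0 * n 1 + m 1 * n 0) + β * (l 0 * n 1 + l 1 * n 0) + γ * (l 0 * m 1 + l 1 * m 0),
      α * (m 1 * n 1) + β * (l 1 * n 1) + γ * (l 1 * m 1),
      α * (m 0 * n 2 + m 2 * n 0) + β * (l 0 * n 2 + l 2 * n 0) + γ * (l 0 * m 2 + l 2 * m 0),
      α * (m 1 * n 2 + m 2 * n 1) + β * (l 1 * n 2 + l 2 * n 1) + γ * (l 1 * m 2 + l 2 * m 1),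
      α * (m 2 * n 2) + β * (l 2 * n 2) + γ * (l 2 * m 2)], fun v => ?_⟩
    rw [hl, hm, hn]
    simp only [conicForm, Matrix.cons_val]
    ring
  have hsum : conicForm q (P 0 + P 1) = γ * d ^ 2 := by
    rw [hq, hd]
    simp only [det3, Pi.add_apply]
    ring
  have hne : γ ≠ 0 := by
    have h1 : a₂ * b₁ - a₁ * b₂ = -(d * det3 (P 2) (P 3) (P 4)) := by
      rw [ha₂, hb₁, ha₁, hb₂, hd]; simp only [det3]; ring
    rw [hγ, h1]
    have e1 := hdet 0 1 3 (by decide) (by decide) (by decide)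
    have e2 := hdet 0 1 4 (by decide) (by decide) (by decide)
    have e3 := hdet 0 1 2 (by decide) (by decide) (by decide)
    have e4 := hdet 2 3 4 (by decide) (by decide) (by decide)
    rw [← ha₃] at e1
    rw [← hb₃] at e2
    rw [← hd] at e3
    simp [e1, e2, e3, e4]
  have hd0 : d ≠ 0 := hd ▸ hdet 0 1 2 (by decide) (by decide) (by decide)
  refine ⟨q, ?_, ?_, ?_⟩
  · rintro rfl
    have : conicForm (0 : Fin 6 → ℤ) (P 0 + P 1) = 0 := by simp [conicForm]
    rw [this] at hsum
    exact mul_ne_zero hne (pow_ne_zero 2 hd0) hsum.symm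
  · intro i
    rw [hq]
    fin_cases i
    · simp only [Fin.zero_eta, det3]; ring
    · simp only [Fin.mk_one, det3]; ring
    · simp only [Fin.reduceFinMk, det3]; ring
    · simp only [Fin.reduceFinMk]
      rw [← ha₁, ← ha₂, ← ha₃, hα, hβ, hγ]; ring
    · simp only [Fin.reduceFinMk]
      rw [← hb₁, ← hb₂, ← hb₃, hα, hβ, hγ]; ring
  · rw [hsum, hγ]
    have hD0 : 0 ≤ D₀ := (abs_nonneg _).trans (hD 0 0 0)
    push_cast
    have k1 : |(a₁ : ℝ)| ≤ D₀ := ha₁ ▸ hD _ _ _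
    have k2 : |(a₂ : ℝ)| ≤ D₀ := ha₂ ▸ hD _ _ _
    have k3 : |(a₃ : ℝ)| ≤ D₀ := ha₃ ▸ hD _ _ _
    have k4 : |(b₁ : ℝ)| ≤ D₀ := hb₁ ▸ hD _ _ _
    have k5 : |(b₂ : ℝ)| ≤ D₀ := hb₂ ▸ hD _ _ _
    have k6 : |(b₃ : ℝ)| ≤ D₀ := hb₃ ▸ hD _ _ _
    have k7 : |(d : ℝ)| ≤ D₀ := hd ▸ hD _ _ _
    rw [abs_mul, abs_mul, abs_mul, abs_pow]
    have k8 : |(a₂ : ℝ) * b₁ - a₁ * b₂| ≤ D₀ * D₀ + D₀ * D₀ := by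
      refine (abs_sub _ _).trans ?_
      rw [abs_mul, abs_mul]
      gcongr
    calc |(a₃ : ℝ)| * |(b₃ : ℝ)| * |(a₂ : ℝ) * b₁ - a₁ * b₂| * |(d : ℝ)| ^ 2
        ≤ D₀ * D₀ * (D₀ * D₀ + D₀ * D₀) * D₀ ^ 2 := by gcongr
      _ = _ := by ring

end Conic

section FivePoints

theorem abs_mul_le_mul {x y X Y : ℝ} (hx : |x| ≤ X) (hy : |y| ≤ Y) : |x * y| ≤ X * Y := by
  rw [abs_mul]
  exact mul_le_mul hx hy (abs_nonneg _) ((abs_nonneg _).trans hx)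

theorem abs_le_mul_of_mul_le {r x R T : ℝ} (hR : 0 < R) (hr : R⁻¹ ≤ |r|) (h : |x * r| ≤ T) :
    |x| ≤ R * T := by
  have h1 : |x| * R⁻¹ ≤ |x| * |r| := by gcongr
  rw [abs_mul] at h
  calc |x| = R * (|x| * R⁻¹) := by field_simp
    _ ≤ R * T := by gcongr; linarith

/-- The local coefficients of a conic are controlled by the Taylor coefficients of its restriction
to a curve and by its quadratic part along the tangent. -/
theorem abs_le_of_local_coeffs {A : Fin 6 → ℝ} {r₂ r₃ r₄ R T : ℝ} (hR : 1 ≤ R)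
    (h₂ : R⁻¹ ≤ |r₂|) (h₃ : |r₃| ≤ R) (h₄ : |r₄| ≤ R) (h0 : |A 0| ≤ T) (h1 : |A 1| ≤ T)
    (h2 : |A 2| ≤ T) (g2 : |A 2 + A 3 * r₂| ≤ T) (g3 : |A 3 * r₃ + A 4 * r₂| ≤ T)
    (g4 : |A 3 * r₄ + A 4 * r₃ + A 5 * r₂ ^ 2| ≤ T) : ∀ i, |A i| ≤ 6 * R ^ 6 * T := by
  have hR0 : 0 < R := by linarith
  have hT : 0 ≤ T := (abs_nonneg _).trans h0
  have up : ∀ n : ℕ, R ^ n * T ≤ R ^ (n + 1) * T := fun n => by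
    gcongr
    omega
  have p0 : T ≤ R * T := by simpa using up 0
  have p1 : R * T ≤ R ^ 2 * T := by simpa using up 1
  have p2 : R ^ 2 * T ≤ R ^ 3 * T := up 2
  have p3 : R ^ 3 * T ≤ R ^ 4 * T := up 3
  have p4 : R ^ 4 * T ≤ R ^ 5 * T := up 4
  have p5 : R ^ 5 * T ≤ R ^ 6 * T := up 5
  have h3 : |A 3| ≤ R * (2 * T) := by
    refine abs_le_mul_of_mul_le hR0 h₂ ?_
    have e1 := abs_le.mp h2
    have e2 := abs_le.mp g2
    rw [abs_le]; constructor <;> linarith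
  have h4 : |A 4| ≤ R * (3 * (R ^ 2 * T)) := by
    refine abs_le_mul_of_mul_le hR0 h₂ ?_
    have e1 := abs_le.mp (abs_mul_le_mul h3 h₃)
    have e2 := abs_le.mp g3
    rw [abs_le]; constructor <;> linarith
  have h5 : |A 5| ≤ R * (R * (6 * (R ^ 4 * T))) := by
    refine abs_le_mul_of_mul_le hR0 h₂ (abs_le_mul_of_mul_le hR0 h₂ ?_)
    have e1 := abs_le.mp (abs_mul_le_mul h3 h₄)
    have e2 := abs_le.mp (abs_mul_le_mul h4 h₃)
    have e3 := abs_le.mp g4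
    rw [abs_le]; constructor <;> linarith
  intro i
  fin_cases i <;> simp only [Fin.zero_eta, Fin.mk_one, Fin.reduceFinMk] <;> linarith

theorem abs_local_sum_le {A : Fin 6 → ℝ} {r₂ r₃ r₄ R N t ρ e : ℝ} (hR : 1 ≤ R)
    (h₂ : |r₂| ≤ R) (h₃ : |r₃| ≤ R) (h₄ : |r₄| ≤ R) (hN : ∀ i, |A i| ≤ N) (ht : |t| ≤ 1)
    (he : 0 ≤ e) (he1 : e ≤ 1) (hρ : |ρ| ≤ R * (|t| ^ 5 + e))
    (h : conic A t (r₂ * t ^ 2 + r₃ * t ^ 3 + r₄ * t ^ 4 + ρ) = 0) :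
    |A 0 + A 1 * t + (A 2 + A 3 * r₂) * t ^ 2 + (A 3 * r₃ + A 4 * r₂) * t ^ 3 +
      (A 3 * r₄ + A 4 * r₃ + A 5 * r₂ ^ 2) * t ^ 4| ≤ 20 * R ^ 2 * N * (|t| ^ 5 + e) := by
  have hN0 : 0 ≤ N := (abs_nonneg _).trans (hN 0)
  have hR0 : 0 ≤ R := by linarith
  set X := |t| ^ 5 + e with hX
  have hX0 : 0 ≤ X := by positivity
  have ht5 : |t| ^ 5 ≤ X := by linarith
  have hX2 : X ≤ 2 := by
    have : |t| ^ 5 ≤ 1 := pow_le_one₀ (abs_nonneg _) ht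
    linarith
  have tk : ∀ k : ℕ, |t ^ k| ≤ 1 := fun k => by
    rw [abs_pow]; exact pow_le_one₀ (abs_nonneg _) ht
  have ht5' : |t ^ 5| ≤ X := by rwa [abs_pow]
  have hρ2 : |ρ| ≤ R * 2 := hρ.trans (by gcongr)
  have key : A 0 + A 1 * t + (A 2 + A 3 * r₂) * t ^ 2 + (A 3 * r₃ + A 4 * r₂) * t ^ 3 +
      (A 3 * r₄ + A 4 * r₃ + A 5 * r₂ ^ 2) * t ^ 4 =
      -(A 3 * ρ + A 4 * (r₄ * t ^ 5 + t * ρ) + A 5 * (t ^ 5 * (2 * (r₂ * r₃) +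
        (2 * (r₂ * r₄) + r₃ * r₃) * t + 2 * (r₃ * r₄) * t ^ 2 + r₄ * r₄ * t ^ 3) +
        ρ * (2 * (r₂ * t ^ 2 + r₃ * t ^ 3 + r₄ * t ^ 4) + ρ))) := by
    simp only [conic] at h
    linear_combination h
  rw [key, abs_neg]
  have add3 : ∀ {x y X Y : ℝ}, |x| ≤ X → |y| ≤ Y → |x + y| ≤ X + Y := fun hx hy =>
    (abs_add_le _ _).trans (add_le_add hx hy)
  have two : ∀ {x X : ℝ}, |x| ≤ X → |2 * x| ≤ 2 * X := fun hx => by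
    rw [abs_mul, abs_two]; linarith
  have b1 := abs_mul_le_mul (hN 3) hρ
  have b2 := abs_mul_le_mul (hN 4) (add3 (abs_mul_le_mul h₄ ht5') (abs_mul_le_mul ht hρ))
  have b3 := add3 (add3 (add3 (two (abs_mul_le_mul h₂ h₃)) (abs_mul_le_mul
    (add3 (two (abs_mul_le_mul h₂ h₄)) (abs_mul_le_mul h₃ h₃)) ht))
    (abs_mul_le_mul (two (abs_mul_le_mul h₃ h₄)) (tk 2)))
    (abs_mul_le_mul (abs_mul_le_mul h₄ h₄) (tk 3))
  have b4 := add3 (two (add3 (add3 (abs_mul_le_mul h₂ (tk 2)) (abs_mul_le_mul h₃ (tk 3)))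
    (abs_mul_le_mul h₄ (tk 4)))) hρ2
  have b5 := abs_mul_le_mul (hN 5) (add3 (abs_mul_le_mul ht5' b3) (abs_mul_le_mul hρ b4))
  refine (add3 (add3 b1 b2) b5).trans ?_
  have p1 : N * (R * X) ≤ N * (R ^ 2 * X) := by
    gcongr
    exact le_self_pow₀ hR two_ne_zero
  nlinarith only [p1, mul_nonneg hN0 (mul_nonneg (sq_nonneg R) hX0)]

theorem exists_conic_of_cell {D : ℕ → ℝ → ℝ} {lo hi R A C c τ : ℝ}
    (hD : ∀ j, ∀ x ∈ Set.Icc lo hi, HasDerivAt (D j) (D (j + 1) x) x) (hR : 1 ≤ R)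
    (hDR : ∀ j ≤ 5, ∀ x ∈ Set.Icc lo hi, |D j x| ≤ R)
    (hD2 : ∀ x ∈ Set.Icc lo hi, R⁻¹ ≤ |D 2 x / 2|) (hxR : ∀ x ∈ Set.Icc lo hi, |x| ≤ R)
    (hA : 1 ≤ A) (hC : 0 ≤ C) (hc : 0 < c) (hτ : 4 < τ) (hτ5 : τ ≤ 5) :
    ∃ N : ℝ, ∀ᶠ B : ℝ in Filter.atTop, ∀ P : Fin 5 → Fin 3 → ℤ,
      (∀ i, NearCurve (D 0) c (C * B ^ (-τ)) B (P i)) → (∀ i, absc (P i) ∈ Set.Icc lo hi) →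
      (∀ i j, |absc (P i) - absc (P j)| ≤ A / B) →
      (∀ i j k, i ≠ j → i ≠ k → j ≠ k → det3 (P i) (P j) (P k) ≠ 0) →
      ∃ q : Fin 6 → ℤ, q ≠ 0 ∧ (∀ i, |(q i : ℝ)| ≤ N) ∧ ∀ i, conicForm q (P i) = 0 := by
  set s : ℝ := 1 / (4 * R * A ^ 2) with hs
  have hs0 : 0 < s := by positivity
  obtain ⟨Kv, hKv, hvan⟩ := exists_abs_coeff_le 5 A s hs0
  set D₀ : ℝ := 2 * R * A ^ 3 + 1 with hD₀
  set W : ℝ := 2 * D₀ ^ 6 / (c ^ 2 * s ^ 2) with hW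
  set K₅ : ℝ := R * A ^ 2 + 2 * C with hK₅
  set K₇ : ℝ := (A * K₅ + K₅ ^ 2) / s ^ 2 with hK₇
  set K₄ : ℝ := Kv * (20 * R ^ 2 * (A ^ 5 + C)) with hK₄
  have hK₄0 : 0 ≤ K₄ := by positivity
  have hK₇0 : 0 ≤ K₇ := by positivity
  have hy0 : Filter.Tendsto (fun B : ℝ => B ^ (4 - τ)) Filter.atTop (nhds 0) := by
    have := tendsto_rpow_neg_atTop (show 0 < τ - 4 by linarith)
    simpa using this
  have hinv : Filter.Tendsto (fun B : ℝ => B⁻¹) Filter.atTop (nhds 0) := tendsto_inv_atTop_zero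
  have hε : ∀ᶠ B : ℝ in Filter.atTop, 36 * R ^ 6 * (K₄ * B ^ (4 - τ) + K₇ * B⁻¹) < 1 / 2 := by
    have : Filter.Tendsto (fun B : ℝ => 36 * R ^ 6 * (K₄ * B ^ (4 - τ) + K₇ * B⁻¹)) Filter.atTop
        (nhds (36 * R ^ 6 * (K₄ * 0 + K₇ * 0))) :=
      ((hy0.const_mul _).add (hinv.const_mul _)).const_mul _
    refine this.eventually_lt_const ?_
    norm_num
  have hsm : ∀ᶠ B : ℝ in Filter.atTop, 4 * C * A * B ^ (4 - τ) < 1 / 2 := by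
    refine (hy0.const_mul (4 * C * A)).eventually_lt_const ?_
    norm_num
  refine ⟨50 * R ^ 4 * (72 * R ^ 6 * W), ?_⟩
  filter_upwards [hε, hsm, Filter.eventually_ge_atTop A] with B hε hsm hBA P hP hI hcell hdet
  have hB1 : 1 ≤ B := hA.trans hBA
  have hB : 0 < B := by linarith
  set e : ℝ := C * B ^ (-τ) with he
  set y : ℝ := B ^ (4 - τ) with hy
  have hypos : 0 < y := by positivity
  have he0 : 0 ≤ e := by positivity
  have heB4 : e * B ^ 4 = C * y := by
    rw [he, hy, mul_assoc, ← Real.rpow_natCast B 4, ← Real.rpow_add hB]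
    congr 2; push_cast; ring
  have hpow : ∀ k : ℕ, 1 ≤ B ^ k := fun k => one_le_pow₀ hB1
  have heB2 : e * B ^ 2 ≤ C * y := by
    rw [← heB4]; gcongr
    norm_num
  have hCy : C * y ≤ 1 / 8 := by
    have : C * y ≤ C * y * A := le_mul_of_one_le_right (by positivity) hA
    linarith
  have hy1 : y ≤ 1 := by
    rw [hy]; exact Real.rpow_le_one_of_one_le_of_nonpos hB1 (by linarith)
  have he1 : e ≤ 1 := by
    have : e ≤ e * B ^ 4 := le_mul_of_one_le_right he0 (hpow 4)
    linarith
  have heC : e * B ^ 2 ≤ C := heB2.trans (mul_le_of_le_one_right hC hy1)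
  have hpos := fun i => (hP i).pos hc hB
  have htay2 : ∀ x ∈ Set.Icc lo hi, ∀ y ∈ Set.Icc lo hi,
      |D 0 y - D 0 x - D 1 x * (y - x)| ≤ R * |y - x| ^ 2 := by
    intro x hx y hy
    have := abs_sub_taylor_le 2 hD (hDR 2 (by norm_num)) hx hy
    simp only [Finset.sum_range_succ, Finset.range_zero, Finset.sum_empty] at this
    norm_num at this
    calc |D 0 y - D 0 x - D 1 x * (y - x)| = |D 0 y - (D 0 x + D 1 x * (y - x))| := by
          congr 1; ring
      _ ≤ R * (y - x) ^ 2 := this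
      _ = R * |y - x| ^ 2 := by rw [sq_abs]
  have hdetle : ∀ i j k, |(det3 (P i) (P j) (P k) : ℝ)| ≤
      B ^ 3 * (R * (|absc (P j) - absc (P i)| * (A / B) * (A / B + A / B)) +
        2 * e * (A / B + A / B)) := by
    intro i j k
    refine (NearCurve.abs_det3_le htay2 (hP i) (hP j) (hP k) hc hB (hI i) (hI j) (hI k)).trans ?_
    have h1 := hcell j i
    have h2 := hcell k i
    gcongr
  have hsecond : B ^ 3 * (2 * e * (A / B + A / B)) ≤ 1 / 2 := by
    have : B ^ 3 * (2 * e * (A / B + A / B)) = 4 * A * (e * B ^ 2) := by field_simp; ring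
    rw [this]
    have : 4 * A * (e * B ^ 2) ≤ 4 * A * (C * y) := by gcongr
    linarith
  have hD₀le : ∀ i j k, |(det3 (P i) (P j) (P k) : ℝ)| ≤ D₀ := by
    intro i j k
    refine (hdetle i j k).trans ?_
    have h1 : B ^ 3 * (R * (|absc (P j) - absc (P i)| * (A / B) * (A / B + A / B))) ≤
        B ^ 3 * (R * (A / B * (A / B) * (A / B + A / B))) := by
      have := hcell j i
      gcongr
    have h2 : B ^ 3 * (R * (A / B * (A / B) * (A / B + A / B))) = 2 * R * A ^ 3 := by
      field_simp; ring
    rw [mul_add, hD₀]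
    linarith
  have hsep : ∀ i j, i ≠ j → s / B ≤ |absc (P i) - absc (P j)| := by
    intro i j hij
    obtain ⟨k, hk1, hk2⟩ : ∃ k : Fin 5, j ≠ k ∧ i ≠ k := by
      revert hij; revert i j; decide
    have h1 : (1 : ℝ) ≤ |(det3 (P j) (P i) (P k) : ℝ)| := by
      exact_mod_cast Int.one_le_abs (hdet j i k hij.symm hk1 hk2)
    have h2 := hdetle j i k
    have h3 : B ^ 3 * (R * (|absc (P i) - absc (P j)| * (A / B) * (A / B + A / B))) =
      2 * R * A ^ 2 * B * |absc (P i) - absc (P j)| := by field_simp; ring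
    rw [mul_add, h3] at h2
    rw [hs, div_div, div_le_iff₀ (by positivity)]
    linarith
  obtain ⟨q, hq0, hqP, hqsum⟩ := exists_conic hdet hD₀le
  refine ⟨q, hq0, ?_, hqP⟩
  set a : ℝ := absc (P 0) with ha
  set θ : ℝ := D 1 a with hθ
  set qr : Fin 6 → ℝ := fun i => (q i : ℝ) with hqr
  obtain ⟨L, hL⟩ : ∃ L, L = conicShift qr a (D 0 a) θ := ⟨_, rfl⟩
  obtain ⟨N, hN⟩ : ∃ N, N = ∑ i, |L i| := ⟨_, rfl⟩
  have hLN : ∀ i, |L i| ≤ N := fun i => by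
    rw [hN]
    exact Finset.single_le_sum (f := fun i => |L i|) (fun _ _ => abs_nonneg _) (Finset.mem_univ i)
  have hN0 : 0 ≤ N := (abs_nonneg _).trans (hLN 0)
  have haI : a ∈ Set.Icc lo hi := hI 0
  obtain ⟨r₂, hr₂⟩ : ∃ r, r = D 2 a / 2 := ⟨_, rfl⟩
  obtain ⟨r₃, hr₃⟩ : ∃ r, r = D 3 a / 6 := ⟨_, rfl⟩
  obtain ⟨r₄, hr₄⟩ : ∃ r, r = D 4 a / 24 := ⟨_, rfl⟩
  have hr₂R : |r₂| ≤ R := by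
    rw [hr₂, abs_div]; norm_num; linarith [hDR 2 (by norm_num) a haI]
  have hr₃R : |r₃| ≤ R := by
    rw [hr₃, abs_div]; norm_num; linarith [hDR 3 (by norm_num) a haI]
  have hr₄R : |r₄| ≤ R := by
    rw [hr₄, abs_div]; norm_num; linarith [hDR 4 (by norm_num) a haI]
  have hr₂l : R⁻¹ ≤ |r₂| := hr₂ ▸ hD2 a haI
  obtain ⟨t, ht⟩ : ∃ t : Fin 5 → ℝ, ∀ i, t i = absc (P i) - a := ⟨_, fun _ => rfl⟩
  have htA : ∀ i, |t i| ≤ A / B := fun i => ht i ▸ hcell i 0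
  have ht1 : ∀ i, |t i| ≤ 1 := fun i => (htA i).trans ((div_le_one hB).mpr hBA)
  obtain ⟨w, hw⟩ : ∃ w : Fin 5 → ℝ, ∀ i, w i = ordi (P i) - D 0 a - θ * t i := ⟨_, fun _ => rfl⟩
  have hconic : ∀ i, conic L (t i) (w i) = 0 := by
    intro i
    have h1 : ((conicForm q (P i) : ℤ) : ℝ) = 0 := by rw [hqP i, Int.cast_zero]
    rw [conicForm_eq q (hpos i)] at h1
    have h2 := (mul_eq_zero.mp h1).resolve_left (pow_pos (hpos i) 2).ne'
    rw [hL, ← conic_shift]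
    convert h2 using 2
    · rw [ht]; ring
    · rw [hw]; ring
  have hρ : ∀ i, |w i - (r₂ * t i ^ 2 + r₃ * t i ^ 3 + r₄ * t i ^ 4)| ≤ R * (|t i| ^ 5 + e) := by
    intro i
    have h1 := abs_sub_taylor_le 5 hD (hDR 5 le_rfl) haI (hI i)
    simp only [Finset.sum_range_succ, Finset.range_zero, Finset.sum_empty, ← ht] at h1
    norm_num [Nat.factorial] at h1
    have h2 := abs_le.mp h1
    have h3 := abs_le.mp (hP i).near
    have h4 : e ≤ R * e := le_mul_of_one_le_left he0 hR
    rw [hw, hr₂, hr₃, hr₄, abs_le]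
    rw [← hθ] at h2
    constructor <;> linarith
  have hsum : ∀ i, |L 0 + L 1 * t i + (L 2 + L 3 * r₂) * t i ^ 2 +
      (L 3 * r₃ + L 4 * r₂) * t i ^ 3 + (L 3 * r₄ + L 4 * r₃ + L 5 * r₂ ^ 2) * t i ^ 4| ≤
      20 * R ^ 2 * N * (A ^ 5 + C) * B ^ (-τ) := by
    intro i
    have h1 := abs_local_sum_le hR hr₂R hr₃R hr₄R hLN (ht1 i) he0 he1 (hρ i) (by
      rw [add_sub_cancel]; exact hconic i)
    refine h1.trans ?_
    rw [mul_assoc _ (A ^ 5 + C)]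
    gcongr
    rw [add_mul]
    gcongr
    calc |t i| ^ 5 ≤ (A / B) ^ 5 := by gcongr; exact htA i
      _ = A ^ 5 * B ^ (-5 : ℝ) := by
        rw [div_pow, Real.rpow_neg hB.le]; norm_cast
      _ ≤ A ^ 5 * B ^ (-τ) := by
        gcongr
  obtain ⟨g, hg⟩ : ∃ g : Fin 5 → ℝ, g = ![L 0, L 1, L 2 + L 3 * r₂, L 3 * r₃ + L 4 * r₂,
    L 3 * r₄ + L 4 * r₃ + L 5 * r₂ ^ 2] := ⟨_, rfl⟩
  have hgle : ∀ j, |g j| ≤ N * (K₄ * y) := by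
    intro j
    have h1 := hvan (fun i => B * t i) (fun i => by
        rw [abs_mul, abs_of_pos hB]
        calc B * |t i| ≤ B * (A / B) := by gcongr; exact htA i
          _ = A := by field_simp) (fun i j hij => by
        rw [← mul_sub, abs_mul, abs_of_pos hB, ht, ht]
        calc s = B * (s / B) := by field_simp
          _ ≤ _ := by
            gcongr
            refine (hsep i j hij).trans (le_of_eq ?_)
            congr 1; ring)
      (fun j => g j * (B⁻¹) ^ (j : ℕ)) (20 * R ^ 2 * N * (A ^ 5 + C) * B ^ (-τ)) (fun i => by
        refine le_trans (le_of_eq ?_) (hsum i)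
        congr 1
        simp [Fin.sum_univ_five, hg, mul_pow]
        field_simp) j
    rw [abs_mul, abs_of_pos (show 0 < B⁻¹ ^ (j : ℕ) by positivity)] at h1
    have h2 : |g j| = |g j| * B⁻¹ ^ (j : ℕ) * B ^ (j : ℕ) := by
      rw [mul_assoc, ← mul_pow, inv_mul_cancel₀ hB.ne', one_pow, mul_one]
    rw [h2]
    calc |g j| * B⁻¹ ^ (j : ℕ) * B ^ (j : ℕ)
        ≤ (Kv * (20 * R ^ 2 * N * (A ^ 5 + C) * B ^ (-τ))) * B ^ 4 := by
          gcongr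
          omega
      _ = N * (K₄ * y) := by
        rw [hK₄, hy, show (4 - τ) = -τ + (4 : ℕ) by push_cast; ring, Real.rpow_add hB,
          Real.rpow_natCast]
        ring
  set δ : ℝ := w 1 - w 0 with hδ
  have ht0 : t 0 = 0 := by rw [ht, ha, sub_self]
  have hδle : |δ| ≤ K₅ / B ^ 2 := by
    have h1 := htay2 a haI _ (hI 1)
    rw [← ht] at h1
    have h2 := abs_le.mp (hP 1).near
    have h3 := abs_le.mp (hP 0).near
    have h4 : R * |t 1| ^ 2 ≤ R * (A / B) ^ 2 := by gcongr; exact htA 1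
    have h5 : K₅ / B ^ 2 = R * (A / B) ^ 2 + 2 * (C / B ^ 2) := by
      rw [hK₅]; field_simp
    have h6 : e ≤ C / B ^ 2 := by rw [le_div_iff₀ (by positivity)]; exact heC
    have h7 := abs_le.mp h1
    rw [hδ, hw, hw, ht0, h5, abs_le]
    constructor <;> linarith
  have hL2 : |L 2| ≤ W + N * (K₇ * B⁻¹) := by
    have h1 := conicForm_add_eq q (hpos 0) (hpos 1) (hqP 0) (hqP 1)
    rw [h1, abs_neg, abs_mul, abs_mul, abs_of_pos (hpos 0), abs_of_pos (hpos 1)] at hqsum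
    have h2 : (q 2 : ℝ) * (absc (P 1) - absc (P 0)) ^ 2 +
        q 4 * ((absc (P 1) - absc (P 0)) * (ordi (P 1) - ordi (P 0))) +
        q 5 * (ordi (P 1) - ordi (P 0)) ^ 2 = L 2 * t 1 ^ 2 + L 4 * (t 1 * δ) + L 5 * (δ * δ) := by
      have e1 : ordi (P 1) - ordi (P 0) = θ * t 1 + δ := by
        rw [hδ, hw, hw, ht0]; ring
      rw [e1, ← ha, ← ht, hL]
      simp only [conicShift, Matrix.cons_val, hqr]
      ring
    rw [h2] at hqsum
    have h3 : (c * B) * (c * B) * |L 2 * t 1 ^ 2 + L 4 * (t 1 * δ) + L 5 * (δ * δ)| ≤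
        2 * D₀ ^ 6 := by
      refine le_trans ?_ hqsum
      have i1 := (hP 0).le_zero
      have i2 := (hP 1).le_zero
      have i3 := (hpos 0).le
      gcongr
    have h4 : |L 2 * t 1 ^ 2 + L 4 * (t 1 * δ) + L 5 * (δ * δ)| ≤ 2 * D₀ ^ 6 / (c * B) ^ 2 := by
      rw [le_div_iff₀ (by positivity)]
      linarith
    have h5 := abs_mul_le_mul (hLN 4) (abs_mul_le_mul (htA 1) hδle)
    have h6 := abs_mul_le_mul (hLN 5) (abs_mul_le_mul hδle hδle)
    have h7 : |L 2 * t 1 ^ 2| ≤ 2 * D₀ ^ 6 / (c * B) ^ 2 + N * (A / B * (K₅ / B ^ 2)) +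
        N * (K₅ / B ^ 2 * (K₅ / B ^ 2)) := by
      have i1 := abs_le.mp h4
      have i2 := abs_le.mp h5
      have i3 := abs_le.mp h6
      rw [abs_le]; constructor <;> linarith
    have h8 : s / B ≤ |t 1| := by rw [ht]; exact hsep 1 0 (by decide)
    have h9 : |L 2| * (s / B) ^ 2 ≤ |L 2 * t 1 ^ 2| := by
      rw [abs_mul, abs_pow]; gcongr
    have h10 : N * (K₅ / B ^ 2 * (K₅ / B ^ 2)) ≤ N * (K₅ ^ 2 / B ^ 3) := by
      have : K₅ / B ^ 2 * (K₅ / B ^ 2) = K₅ ^ 2 / B ^ 4 := by field_simp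
      rw [this]
      gcongr
      norm_num
    have h11 : |L 2| * (s / B) ^ 2 ≤ (W + N * (K₇ * B⁻¹)) * (s / B) ^ 2 := by
      have e1 : (W + N * (K₇ * B⁻¹)) * (s / B) ^ 2 =
          2 * D₀ ^ 6 / (c * B) ^ 2 + N * (A / B * (K₅ / B ^ 2)) + N * (K₅ ^ 2 / B ^ 3) := by
        rw [hW, hK₇]; field_simp; ring
      rw [e1]
      linarith
    exact le_of_mul_le_mul_right h11 (by positivity)
  have hW0 : 0 ≤ W := by positivity
  set T : ℝ := W + N * (K₄ * y + K₇ * B⁻¹) with hT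
  have q1 : 0 ≤ N * (K₄ * y) := by positivity
  have q2 : 0 ≤ N * (K₇ * B⁻¹) := by positivity
  have hgT : ∀ j, |g j| ≤ T := fun j => (hgle j).trans (by rw [hT, mul_add]; linarith)
  have hloc := abs_le_of_local_coeffs (A := L) (T := T) hR hr₂l hr₃R hr₄R
    (by simpa [hg] using hgT 0) (by simpa [hg] using hgT 1)
    (hL2.trans (by rw [hT, mul_add]; linarith)) (by simpa [hg] using hgT 2)
    (by simpa [hg] using hgT 3) (by simpa [hg] using hgT 4)
  have hNle : N ≤ 72 * R ^ 6 * W := by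
    have h1 : N ≤ 36 * R ^ 6 * T := by
      rw [hN]
      calc ∑ i, |L i| ≤ ∑ _i : Fin 6, 6 * R ^ 6 * T := Finset.sum_le_sum fun i _ => hloc i
        _ = 36 * R ^ 6 * T := by simp; ring
    have h2 : N * (36 * R ^ 6 * (K₄ * y + K₇ * B⁻¹)) ≤ N * (1 / 2) := by gcongr
    have h3 : 36 * R ^ 6 * T = 36 * R ^ 6 * W + N * (36 * R ^ 6 * (K₄ * y + K₇ * B⁻¹)) := by
      rw [hT]; ring
    linarith
  exact abs_le_of_conicShift qr hR (hxR a haI) (hDR 0 (by norm_num) a haI)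
    (hDR 1 (by norm_num) a haI) (fun i => (hL ▸ hLN i).trans hNle)

end FivePoints

section Sparse

/-- A family of properties `P B` such that only `o(B)` elements satisfy `P B` as `B → ∞`. -/
def Sparse {α : Type*} (P : ℝ → α → Prop) : Prop :=
  ∀ ε : ℝ, 0 < ε → ∀ᶠ B : ℝ in Filter.atTop, ∀ S : Finset α, (∀ v ∈ S, P B v) →
    (S.card : ℝ) ≤ ε * B

theorem Sparse.mono {α : Type*} {P Q : ℝ → α → Prop} (hQ : Sparse Q)
    (h : ∀ᶠ B : ℝ in Filter.atTop, ∀ v, P B v → Q B v) : Sparse P := by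
  intro ε hε
  filter_upwards [hQ ε hε, h] with B hB h S hS
  exact hB S fun v hv => h v (hS v hv)

theorem Sparse.or {α : Type*} {P Q : ℝ → α → Prop} (hP : Sparse P) (hQ : Sparse Q) :
    Sparse (fun B v => P B v ∨ Q B v) := by
  classical
  intro ε hε
  filter_upwards [hP (ε / 2) (half_pos hε), hQ (ε / 2) (half_pos hε)] with B h₁ h₂ S hS
  have h3 := h₁ (S.filter (P B)) fun v hv => (Finset.mem_filter.mp hv).2
  have h4 := h₂ (S.filter fun v => ¬ P B v) fun v hv =>
    (hS v (Finset.mem_filter.mp hv).1).resolve_left (Finset.mem_filter.mp hv).2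
  have h5 := Finset.card_filter_add_card_filter_not (s := S) (P B)
  have h6 : (S.card : ℝ) = (S.filter (P B)).card + (S.filter fun v => ¬ P B v).card := by
    exact_mod_cast h5.symm
  rw [h6]; linarith

theorem sparse_false {α : Type*} : Sparse (fun _ (_ : α) => False) := by
  intro ε hε
  filter_upwards [Filter.eventually_ge_atTop 0] with B hB S hS
  have : S = ∅ := Finset.eq_empty_of_forall_notMem hS
  rw [this]; simp; positivity

/-- Sparsity is local on compact sets. -/
theorem sparse_of_isCompact {α X : Type*} [TopologicalSpace X] {K : Set X} (hK : IsCompact K)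
    (π : α → X) (P : ℝ → α → Prop)
    (h : ∀ x ∈ K, ∃ U ∈ nhds x, Sparse (fun B v => P B v ∧ π v ∈ U)) :
    Sparse (fun B v => P B v ∧ π v ∈ K) := by
  refine hK.induction_on (p := fun s => Sparse (fun B v => P B v ∧ π v ∈ s)) ?_ ?_ ?_ ?_
  · exact sparse_false.mono (.of_forall fun B v hv => hv.2)
  · intro s t hst ht
    exact ht.mono (.of_forall fun B v hv => ⟨hv.1, hst hv.2⟩)
  · intro s t hs ht
    exact (hs.or ht).mono (.of_forall fun B v hv => hv.2.imp (⟨hv.1, ·⟩) (⟨hv.1, ·⟩))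
  · intro x hx
    obtain ⟨U, hU, h⟩ := h x hx
    exact ⟨U, mem_nhdsWithin_of_mem_nhds hU, h⟩

end Sparse

section Nonflex

theorem tendsto_mul_rpow_neg_mul_pow {C τ : ℝ} {n : ℕ} (hτ : n < τ) :
    Filter.Tendsto (fun B : ℝ => C * B ^ (-τ) * B ^ n) Filter.atTop (nhds 0) := by
  have h1 : Filter.Tendsto (fun B : ℝ => C * B ^ (-(τ - n))) Filter.atTop (nhds (C * 0)) :=
    (tendsto_rpow_neg_atTop (by linarith)).const_mul C
  rw [mul_zero] at h1
  refine h1.congr' ?_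
  filter_upwards [Filter.eventually_gt_atTop 0] with B hB
  rw [mul_assoc, ← Real.rpow_natCast B n, ← Real.rpow_add hB]
  congr 2; ring

theorem abs_conic_sub_le {q : Fin 6 → ℝ} {N R x y z e : ℝ} (hN : ∀ i, |q i| ≤ N) (hR : 1 ≤ R)
    (hx : |x| ≤ R) (hz : |z| ≤ R) (h : |y - z| ≤ e) (he : e ≤ 1) :
    |conic q x y - conic q x z| ≤ 5 * R * N * e := by
  have hN0 : 0 ≤ N := (abs_nonneg _).trans (hN 0)
  have hy : |y| ≤ 2 * R := by
    have h1 := abs_le.mp h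
    have h2 := abs_le.mp hz
    rw [abs_le]; constructor <;> linarith
  have key : conic q x y - conic q x z = (q 3 * 1 + q 4 * x + q 5 * (y + z)) * (y - z) := by
    simp only [conic]; ring
  rw [key]
  have one : |(1 : ℝ)| ≤ R := by rwa [abs_one]
  have h1 := abs_mul_le_mul (hN 3) one
  have h2 := abs_mul_le_mul (hN 4) hx
  have h3 := abs_mul_le_mul (hN 5) ((abs_add_le y z).trans (add_le_add hy hz))
  have h4 : |q 3 * 1 + q 4 * x + q 5 * (y + z)| ≤ 5 * R * N := by
    have e1 := abs_le.mp h1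
    have e2 := abs_le.mp h2
    have e3 := abs_le.mp h3
    rw [abs_le]; constructor <;> linarith
  exact abs_mul_le_mul h4 h

theorem finite_zeros_of_analyticOnNhd {g : ℝ → ℝ} {lo hi : ℝ}
    (hg : AnalyticOnNhd ℝ g (Set.Icc lo hi)) (h : ¬ ∀ x ∈ Set.Icc lo hi, g x = 0) :
    {x ∈ Set.Icc lo hi | g x = 0}.Finite := by
  by_contra hinf
  obtain ⟨x, hx, hacc⟩ := Set.Infinite.exists_accPt_of_subset_isCompact hinf isCompact_Icc
    (Set.sep_subset _ _)
  refine h ?_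
  refine hg.eqOn_zero_of_preconnected_of_frequently_eq_zero isPreconnected_Icc hx ?_
  rw [accPt_iff_frequently_nhdsNE] at hacc
  exact hacc.mono fun y hy => hy.2

theorem analyticOnNhd_conic {f : ℝ → ℝ} {s : Set ℝ} (hf : AnalyticOnNhd ℝ f s) (q : Fin 6 → ℝ) :
    AnalyticOnNhd ℝ (fun x => conic q x (f x)) s := by
  intro x hx
  have h1 := hf x hx
  have h2 : AnalyticAt ℝ (fun x : ℝ => x) x := analyticAt_id
  simp only [conic]
  fun_prop

/-- Points near a curve and on a conic accumulate only at the intersections of the two. -/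
theorem eventually_near_zeros_of_conicForm {f : ℝ → ℝ} {lo hi R c C τ ρ : ℝ}
    (hf : ContinuousOn f (Set.Icc lo hi)) (hR : 1 ≤ R) (hfR : ∀ x ∈ Set.Icc lo hi, |f x| ≤ R)
    (hxR : ∀ x ∈ Set.Icc lo hi, |x| ≤ R) (hc : 0 < c) (hτ : 0 < τ) (hρ : 0 < ρ) (q : Fin 6 → ℤ) :
    ∀ᶠ B : ℝ in Filter.atTop, ∀ v, NearCurve f c (C * B ^ (-τ)) B v →
      absc v ∈ Set.Icc lo hi → conicForm q v = 0 →
      ∃ z ∈ Set.Icc lo hi, conic (fun i => (q i : ℝ)) z (f z) = 0 ∧ |absc v - z| < ρ := by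
  set qr : Fin 6 → ℝ := fun i => (q i : ℝ) with hqr
  set Z : Set ℝ := {z ∈ Set.Icc lo hi | conic qr z (f z) = 0} with hZ
  set U : Set ℝ := ⋃ z ∈ Z, Metric.ball z ρ with hU
  have hUo : IsOpen U := isOpen_biUnion fun _ _ => Metric.isOpen_ball
  have hK : IsCompact (Set.Icc lo hi \ U) := isCompact_Icc.diff hUo
  have hcont : ContinuousOn (fun x => |conic qr x (f x)|) (Set.Icc lo hi \ U) := by
    have h1 : ContinuousOn f (Set.Icc lo hi \ U) := hf.mono Set.sdiff_subset
    simp only [conic]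
    fun_prop
  obtain ⟨m, hm, hmin⟩ : ∃ m > 0, ∀ x ∈ Set.Icc lo hi \ U, m ≤ |conic qr x (f x)| := by
    rcases (Set.Icc lo hi \ U).eq_empty_or_nonempty with he | hne
    · exact ⟨1, one_pos, by simp [he]⟩
    · obtain ⟨x, hx, hmin⟩ := hK.exists_isMinOn hne hcont
      refine ⟨_, ?_, fun y hy => hmin hy⟩
      rw [gt_iff_lt, abs_pos]
      intro h0
      exact hx.2 (Set.mem_biUnion (show x ∈ Z from ⟨hx.1, h0⟩) (Metric.mem_ball_self hρ))
  obtain ⟨N, hN⟩ : ∃ N, N = ∑ i, |qr i| := ⟨_, rfl⟩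
  have hqN : ∀ i, |qr i| ≤ N := fun i => by
    rw [hN]
    exact Finset.single_le_sum (f := fun i => |qr i|) (fun _ _ => abs_nonneg _) (Finset.mem_univ i)
  have ht : Filter.Tendsto (fun B : ℝ => C * B ^ (-τ)) Filter.atTop (nhds 0) := by
    simpa using tendsto_mul_rpow_neg_mul_pow (C := C) (n := 0) (by simpa using hτ)
  have ht2 := ht.const_mul (5 * R * N)
  rw [mul_zero] at ht2
  filter_upwards [ht.eventually_le_const one_pos, ht2.eventually_lt_const hm,
    Filter.eventually_gt_atTop 0] with B he1 hem hB v hv hvI hq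
  by_contra hcon
  push Not at hcon
  have hvU : absc v ∉ U := by
    intro hU'
    obtain ⟨z, hz, hzv⟩ := Set.mem_iUnion₂.mp hU'
    exact absurd (hcon z hz.1 hz.2) (not_le.mpr (by simpa [Real.dist_eq] using hzv))
  have h1 := hmin _ ⟨hvI, hvU⟩
  have hpos := hv.pos hc hB
  have h2 : ((conicForm q v : ℤ) : ℝ) = 0 := by rw [hq, Int.cast_zero]
  rw [conicForm_eq q hpos] at h2
  have h3 : conic qr (absc v) (ordi v) = 0 :=
    (mul_eq_zero.mp h2).resolve_left (pow_pos hpos 2).ne'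
  have h4 := abs_conic_sub_le hqN hR (hxR _ hvI) (hfR _ hvI) hv.near he1
  rw [h3, zero_sub, abs_neg] at h4
  linarith

/-- The number of points near a curve of non-vanishing curvature over an interval. -/
theorem exists_card_le_of_curvature {f : ℝ → ℝ} {f' : ℝ → ℝ} {I : Set ℝ} {κ M c C τ : ℝ}
    (hM : ∀ x ∈ I, ∀ y ∈ I, |f y - f x - f' x * (y - x)| ≤ M * |y - x| ^ 2) (hM0 : 0 ≤ M)
    (hκ : 0 < κ) (hdd : ∀ x ∈ I, ∀ y ∈ I, ∀ z ∈ I,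
      κ * |(y - x) * (z - x) * (z - y)| ≤ |dd f x y z|)
    (hc : 0 < c) (hC : 0 ≤ C) (hτ : 4 < τ) :
    ∃ K, 0 < K ∧ ∀ᶠ B : ℝ in Filter.atTop,
      (∀ u v w, NearCurve f c (C * B ^ (-τ)) B u → NearCurve f c (C * B ^ (-τ)) B v →
        NearCurve f c (C * B ^ (-τ)) B w → absc u ∈ I → absc v ∈ I → absc w ∈ I →
        u ≠ v → u ≠ w → v ≠ w → det3 u v w ≠ 0) ∧
      ∀ S : Finset (Fin 3 → ℤ), (∀ v ∈ S, NearCurve f c (C * B ^ (-τ)) B v ∧ absc v ∈ I) →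
        ∀ a b : ℝ, a ≤ b → (∀ v ∈ S, absc v ∈ Set.Icc a b) →
          (S.card : ℝ) ≤ K * ((b - a) * B + 1) := by
  obtain ⟨c₀, hc₀, hc₀1, hc₀M⟩ : ∃ c₀ : ℝ, 0 < c₀ ∧ c₀ ≤ 1 ∧ 2 * M * c₀ ^ 3 < 1 / 2 := by
    refine ⟨(4 * M + 2)⁻¹, by positivity, inv_le_one_of_one_le₀ (by linarith), ?_⟩
    have h1 : (4 * M + 2)⁻¹ ≤ 1 := inv_le_one_of_one_le₀ (by linarith)
    have h0 : 0 < (4 * M + 2)⁻¹ := by positivity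
    calc 2 * M * (4 * M + 2)⁻¹ ^ 3 ≤ 2 * M * (4 * M + 2)⁻¹ := by
          gcongr
          exact pow_le_of_le_one h0.le h1 (by norm_num)
      _ < 1 / 2 := by
          rw [← div_eq_mul_inv, div_lt_iff₀ (by positivity)]; linarith
  refine ⟨2 / c₀, by positivity, ?_⟩
  have t4 := (tendsto_mul_rpow_neg_mul_pow (C := C) (n := 4) (by exact_mod_cast hτ)).const_mul 4
  have t2 := (tendsto_mul_rpow_neg_mul_pow (C := C) (τ := τ) (n := 2)
    (by push_cast; linarith)).const_mul 4
  rw [mul_zero] at t4 t2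
  filter_upwards [t4.eventually_lt_const hκ,
    t2.eventually_lt_const (show (0 : ℝ) < 1 / 2 by norm_num),
    Filter.eventually_ge_atTop 1] with B h4 h2 hB1
  have hB : 0 < B := by linarith
  have he0 : 0 ≤ C * B ^ (-τ) := by positivity
  have hne : ∀ u v, NearCurve f c (C * B ^ (-τ)) B u → NearCurve f c (C * B ^ (-τ)) B v →
      u ≠ v → absc u ≠ absc v := by
    intro u v hu hv huv h
    exact huv (hu.eq_of_absc_eq hv hc hB (by linarith) h)
  have hdet : ∀ u v w, NearCurve f c (C * B ^ (-τ)) B u → NearCurve f c (C * B ^ (-τ)) B v →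
        NearCurve f c (C * B ^ (-τ)) B w → absc u ∈ I → absc v ∈ I → absc w ∈ I →
        u ≠ v → u ≠ w → v ≠ w → det3 u v w ≠ 0 := by
    intro u v w hu hv hw huI hvI hwI huv huw hvw
    exact det3_ne_zero_of_dd_bound hκ hc hB (by linarith) hu hv hw (hne u v hu hv huv)
      (hne u w hu hw huw) (hne v w hv hw hvw) (hdd _ huI _ hvI _ hwI)
  refine ⟨hdet, fun S hS a b hab hSab => ?_⟩
  have hsm : 2 * M * c₀ ^ 3 + 4 * (C * B ^ (-τ)) * c₀ * B ^ 2 < 1 := by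
    have : C * B ^ (-τ) * B ^ 2 * c₀ ≤ C * B ^ (-τ) * B ^ 2 :=
      mul_le_of_le_one_right (by positivity) hc₀1
    linarith
  have := card_le_of_det3_ne_zero hM hM0 hc hB he0 hc₀ hsm S hS
    (fun u hu v hv w hw => hdet u v w (hS u hu).1 (hS v hv).1 (hS w hw).1 (hS u hu).2 (hS v hv).2
      (hS w hw).2) hab hSab
  refine this.trans ?_
  rw [mul_add, mul_add]
  have h1 : 2 * ((b - a) * B / c₀) = 2 / c₀ * ((b - a) * B) := by field_simp
  have h3 : (1 : ℝ) ≤ 1 / c₀ := (one_le_div hc₀).mpr hc₀1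
  have h5 : 2 / c₀ * 1 = 2 * (1 / c₀) := by ring
  rw [h1, h5]; linarith

theorem sparse_nearCurve_Icc {D : ℕ → ℝ → ℝ} {lo hi R c C τ : ℝ}
    (hD : ∀ j, ∀ x ∈ Set.Icc lo hi, HasDerivAt (D j) (D (j + 1) x) x) (hR : 1 ≤ R)
    (hDR : ∀ j ≤ 5, ∀ x ∈ Set.Icc lo hi, |D j x| ≤ R)
    (hD2 : (∀ x ∈ Set.Icc lo hi, 2 * R⁻¹ ≤ D 2 x) ∨ (∀ x ∈ Set.Icc lo hi, D 2 x ≤ -(2 * R⁻¹)))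
    (hxR : ∀ x ∈ Set.Icc lo hi, |x| ≤ R) (hlohi : lo ≤ hi)
    (hf : AnalyticOnNhd ℝ (D 0) (Set.Icc lo hi))
    (hconic : ∀ q : Fin 6 → ℤ, q ≠ 0 →
      ¬ ∀ x ∈ Set.Icc lo hi, conic (fun i => (q i : ℝ)) x (D 0 x) = 0)
    (hC : 0 ≤ C) (hc : 0 < c) (hτ : 4 < τ) (hτ5 : τ ≤ 5) :
    Sparse (fun B v => NearCurve (D 0) c (C * B ^ (-τ)) B v ∧ absc v ∈ Set.Icc lo hi) := by
  classical
  intro ε hε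
  have hR0 : 0 < R⁻¹ := by positivity
  have hdd : ∀ x ∈ Set.Icc lo hi, ∀ y ∈ Set.Icc lo hi, ∀ z ∈ Set.Icc lo hi,
      R⁻¹ * |(y - x) * (z - x) * (z - y)| ≤ |dd (D 0) x y z| := by
    intro x hx y hy z hz
    rcases hD2 with h | h
    · have := abs_dd_lower (k := 0) hR0.le (hD 0) (hD 1) (fun x hx => by
        simpa [mul_comm] using h x hx) hx hy hz
      simpa using this
    · have := abs_dd_lower (k := 0) (f := fun t => -D 0 t) (f' := fun t => -D 1 t)
        (f'' := fun t => -D 2 t) hR0.le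
        (fun x hx => (hD 0 x hx).neg) (fun x hx => (hD 1 x hx).neg) (fun x hx => by
          have := h x hx
          norm_num
          linarith) hx hy hz
      simpa [dd_neg] using this
  have hD2' : ∀ x ∈ Set.Icc lo hi, R⁻¹ ≤ |D 2 x / 2| := by
    intro x hx
    rcases hD2 with h | h
    · rw [le_abs]; left; linarith [h x hx]
    · rw [le_abs]; right; linarith [h x hx]
  have htay2 : ∀ x ∈ Set.Icc lo hi, ∀ y ∈ Set.Icc lo hi,
      |D 0 y - D 0 x - D 1 x * (y - x)| ≤ R * |y - x| ^ 2 := by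
    intro x hx y hy
    have := abs_sub_taylor_le 2 hD (hDR 2 (by norm_num)) hx hy
    simp only [Finset.sum_range_succ, Finset.range_zero, Finset.sum_empty] at this
    norm_num at this
    calc |D 0 y - D 0 x - D 1 x * (y - x)| = |D 0 y - (D 0 x + D 1 x * (y - x))| := by
          congr 1; ring
      _ ≤ R * (y - x) ^ 2 := this
      _ = R * |y - x| ^ 2 := by rw [sq_abs]
  obtain ⟨K, hK, hcount⟩ := exists_card_le_of_curvature htay2 (by linarith) hR0 hdd hc hC hτ
  obtain ⟨A, hA⟩ : ∃ A, A = 1 + 16 * (hi - lo) / ε := ⟨_, rfl⟩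
  have hA1 : 1 ≤ A := by
    have : 0 ≤ 16 * (hi - lo) / ε := div_nonneg (by linarith) hε.le
    linarith
  obtain ⟨N, hN⟩ := exists_conic_of_cell hD hR hDR hD2' hxR hA1 hC hc hτ hτ5
  obtain ⟨Q, hQ⟩ : ∃ Q : Finset (Fin 6 → ℤ), ∀ q, q ∈ Q ↔ q ≠ 0 ∧ ∀ i, |(q i : ℝ)| ≤ N := by
    have hfin : {q : Fin 6 → ℤ | q ≠ 0 ∧ ∀ i, |(q i : ℝ)| ≤ N}.Finite := by
      refine (Set.Finite.pi' (fun _ : Fin 6 => Set.finite_Icc (-⌊N⌋) ⌊N⌋)).subset ?_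
      rintro q ⟨-, hq⟩ i
      have : |q i| ≤ ⌊N⌋ := by rw [Int.le_floor]; exact_mod_cast hq i
      exact Set.mem_Icc.mpr (abs_le.mp this)
    exact ⟨hfin.toFinset, fun q => by simp⟩
  have hZfin : (⋃ q ∈ Q, {x ∈ Set.Icc lo hi |
      conic (fun i => (q i : ℝ)) x (D 0 x) = 0}).Finite := by
    refine Q.finite_toSet.biUnion fun q hq => ?_
    exact finite_zeros_of_analyticOnNhd (analyticOnNhd_conic hf _)
      (hconic q ((hQ q).mp hq).1)
  obtain ⟨Z, hZ⟩ : ∃ Z : Finset ℝ, ∀ q ∈ Q, ∀ z ∈ Set.Icc lo hi,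
      conic (fun i => (q i : ℝ)) z (D 0 z) = 0 → z ∈ Z := by
    refine ⟨hZfin.toFinset, fun q hq z hz h => ?_⟩
    rw [Set.Finite.mem_toFinset]
    exact Set.mem_biUnion (show q ∈ (Q : Set _) from hq) ⟨hz, h⟩
  obtain ⟨ρ, hρ⟩ : ∃ ρ, ρ = ε / (8 * K * (Z.card + 1)) := ⟨_, rfl⟩
  have hρ0 : 0 < ρ := by rw [hρ]; positivity
  have hnear : ∀ᶠ B : ℝ in Filter.atTop, ∀ q ∈ Q, ∀ v, NearCurve (D 0) c (C * B ^ (-τ)) B v →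
      absc v ∈ Set.Icc lo hi → conicForm q v = 0 → ∃ z ∈ Z, |absc v - z| < ρ := by
    rw [Filter.eventually_all_finset]
    intro q hq
    filter_upwards [eventually_near_zeros_of_conicForm (C := C) hf.continuousOn hR
        (hDR 0 (by norm_num))
      hxR hc (show 0 < τ by linarith) hρ0 q] with B hB v hv hvI hqv
    obtain ⟨z, hz, hz0, hzv⟩ := hB v hv hvI hqv
    exact ⟨z, hZ q hq z hz hz0, hzv⟩
  filter_upwards [hcount, hN, hnear, Filter.eventually_ge_atTop 1,
    Filter.eventually_ge_atTop ((4 + Z.card * K) * (2 / ε))] with B hcount hN hnear hB1 hBbig S hS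
  have hB : 0 < B := by linarith
  have hsplit : (S.card : ℝ) = (S.filter fun v => ∃ z ∈ Z, |absc v - z| < ρ).card +
      (S.filter fun v => ¬ ∃ z ∈ Z, |absc v - z| < ρ).card := by
    exact_mod_cast (Finset.card_filter_add_card_filter_not (s := S) _).symm
  have h1 : ((S.filter fun v => ∃ z ∈ Z, |absc v - z| < ρ).card : ℝ) ≤
      Z.card * (K * (2 * ρ * B + 1)) := by
    have hsub : (S.filter fun v => ∃ z ∈ Z, |absc v - z| < ρ) ⊆
        Z.biUnion fun z => S.filter fun v => |absc v - z| < ρ := by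
      intro v hv
      obtain ⟨hvS, z, hz, hzv⟩ := Finset.mem_filter.mp hv
      exact Finset.mem_biUnion.mpr ⟨z, hz, Finset.mem_filter.mpr ⟨hvS, hzv⟩⟩
    have e1 : ((S.filter fun v => ∃ z ∈ Z, |absc v - z| < ρ).card : ℝ) ≤
        ∑ z ∈ Z, ((S.filter fun v => |absc v - z| < ρ).card : ℝ) := by
      exact_mod_cast (Finset.card_le_card hsub).trans Finset.card_biUnion_le
    refine e1.trans ?_
    rw [← nsmul_eq_mul]
    refine Finset.sum_le_card_nsmul _ _ _ fun z _ => ?_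
    have := hcount.2 (S.filter fun v => |absc v - z| < ρ)
      (fun v hv => hS v (Finset.mem_filter.mp hv).1) (z - ρ) (z + ρ) (by linarith) (fun v hv => by
        have := abs_lt.mp (Finset.mem_filter.mp hv).2
        constructor <;> linarith)
    rwa [show z + ρ - (z - ρ) = 2 * ρ by ring] at this
  have h2 : ((S.filter fun v => ¬ ∃ z ∈ Z, |absc v - z| < ρ).card : ℝ) ≤
      (4 : ℕ) * ((hi - lo) / (A / B) + 1) := by
    refine card_le_of_cells _ absc 4 hlohi (by positivity)
      (fun v hv => (hS v (Finset.mem_filter.mp hv).1).2) ?_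
    intro T hT hTc
    by_contra! hcard
    obtain ⟨T', hT', hT'5⟩ := Finset.exists_subset_card_eq (show 5 ≤ T.card by omega)
    obtain ⟨P, hP⟩ : ∃ P : Fin 5 → Fin 3 → ℤ, Function.Injective P ∧ ∀ i, P i ∈ T' :=
      ⟨fun i => ((T'.equivFinOfCardEq hT'5).symm i : Fin 3 → ℤ), fun i j h =>
        (T'.equivFinOfCardEq hT'5).symm.injective (Subtype.ext h), fun i =>
        ((T'.equivFinOfCardEq hT'5).symm i).2⟩
    have hPT : ∀ i, P i ∈ T := fun i => hT' (hP.2 i)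
    have hPS : ∀ i, P i ∈ S := fun i => (Finset.mem_filter.mp (hT (hPT i))).1
    obtain ⟨q, hq0, hqN, hqP⟩ := hN P (fun i => (hS _ (hPS i)).1) (fun i => (hS _ (hPS i)).2)
      (fun i j => hTc _ (hPT i) _ (hPT j)) (fun i j k hij hik hjk =>
        hcount.1 _ _ _ (hS _ (hPS i)).1 (hS _ (hPS j)).1 (hS _ (hPS k)).1 (hS _ (hPS i)).2
          (hS _ (hPS j)).2 (hS _ (hPS k)).2 (hP.1.ne hij) (hP.1.ne hik) (hP.1.ne hjk))
    exact (Finset.mem_filter.mp (hT (hPT 0))).2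
      (hnear q ((hQ q).mpr ⟨hq0, hqN⟩) _ (hS _ (hPS 0)).1 (hS _ (hPS 0)).2 (hqP 0))
  have h3 : (hi - lo) / (A / B) ≤ ε / 16 * B := by
    rw [div_div_eq_mul_div, div_le_iff₀ (by positivity)]
    have : hi - lo ≤ ε / 16 * A := by
      rw [hA, mul_add, show ε / 16 * (16 * (hi - lo) / ε) = hi - lo by field_simp]
      linarith
    calc (hi - lo) * B ≤ ε / 16 * A * B := by gcongr
      _ = _ := by ring
  have h4 : (Z.card : ℝ) * (K * (2 * ρ * B)) ≤ ε / 4 * B := by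
    have e1 : (Z.card + 1 : ℝ) * (K * (2 * ρ * B)) = ε / 4 * B := by
      rw [hρ]; field_simp; ring
    have e2 : 0 ≤ K * (2 * ρ * B) := by positivity
    linarith
  have h5 : 4 + Z.card * K ≤ ε / 2 * B := by
    calc 4 + Z.card * K = ε / 2 * ((4 + Z.card * K) * (2 / ε)) := by field_simp
      _ ≤ _ := by gcongr
  rw [hsplit]
  push_cast at h2
  linarith

/-- Near a point of a curve which is neither an inflection point nor on a conic arc there are
few integer points. -/
theorem sparse_nearCurve_of_deriv_deriv_ne_zero {f : ℝ → ℝ} {x₀ c C τ : ℝ}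
    (hf : AnalyticAt ℝ f x₀) (hf2 : deriv (deriv f) x₀ ≠ 0)
    (hconic : ∀ q : Fin 6 → ℤ, q ≠ 0 →
      ¬ ∀ᶠ x in nhds x₀, conic (fun i => (q i : ℝ)) x (f x) = 0)
    (hC : 0 ≤ C) (hc : 0 < c) (hτ : 4 < τ) (hτ5 : τ ≤ 5) :
    ∃ η > 0, Sparse (fun B v => NearCurve f c (C * B ^ (-τ)) B v ∧
      absc v ∈ Set.Icc (x₀ - η) (x₀ + η)) := by
  obtain ⟨D, hDdef⟩ : ∃ D : ℕ → ℝ → ℝ, ∀ j, D j = deriv^[j] f := ⟨_, fun _ => rfl⟩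
  have hD0 : D 0 = f := hDdef 0
  have hDs : ∀ j, D (j + 1) = deriv (D j) := fun j => by
    rw [hDdef, hDdef, Function.iterate_succ_apply']
  have hDan : ∀ x, AnalyticAt ℝ f x → ∀ j, AnalyticAt ℝ (D j) x := by
    intro x hx j
    induction j with
    | zero => rwa [hD0]
    | succ j ih => rw [hDs]; exact ih.deriv
  have hd : D 2 x₀ ≠ 0 := by rwa [hDs, hDs, hD0]
  obtain ⟨R, hRdef⟩ : ∃ R,
      R = 1 + (|x₀| + 1) + 4 / |D 2 x₀| + ∑ j ∈ Finset.range 6, (|D j x₀| + 1) :=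
    ⟨_, rfl⟩
  have hd0 : 0 < 4 / |D 2 x₀| := by positivity
  have hs0 : 0 ≤ ∑ j ∈ Finset.range 6, (|D j x₀| + 1) :=
    Finset.sum_nonneg fun j _ => by positivity
  have hR1 : 1 ≤ R := by
    have := abs_nonneg x₀
    linarith
  have hRinv : 2 * R⁻¹ ≤ |D 2 x₀| / 2 := by
    have h1 : 4 / |D 2 x₀| ≤ R := by
      have := abs_nonneg x₀
      linarith
    have h2 : R⁻¹ ≤ (4 / |D 2 x₀|)⁻¹ := inv_anti₀ hd0 h1
    rw [inv_div] at h2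
    linarith
  have ev1 : ∀ᶠ x in nhds x₀, AnalyticAt ℝ f x := hf.eventually_analyticAt
  have ev2 : ∀ᶠ x in nhds x₀, ∀ j ∈ Finset.range 6, |D j x| < |D j x₀| + 1 := by
    rw [Filter.eventually_all_finset]
    intro j _
    exact ((hDan x₀ hf j).continuousAt.abs).eventually_lt_const (by linarith)
  have ev3 : ∀ᶠ x in nhds x₀, |D 2 x - D 2 x₀| < |D 2 x₀| / 2 := by
    have h1 : Filter.Tendsto (fun x => |D 2 x - D 2 x₀|) (nhds x₀) (nhds |D 2 x₀ - D 2 x₀|) :=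
      ((hDan x₀ hf 2).continuousAt.sub continuousAt_const).abs
    refine h1.eventually_lt_const ?_
    rw [sub_self, abs_zero]; positivity
  have ev4 : ∀ᶠ x in nhds x₀, |x| < |x₀| + 1 :=
    continuous_abs.continuousAt.eventually_lt_const (by linarith)
  obtain ⟨η, hη, hev⟩ := Metric.eventually_nhds_iff.mp (ev1.and (ev2.and (ev3.and ev4)))
  have hI : ∀ x ∈ Set.Icc (x₀ - η / 2) (x₀ + η / 2), dist x x₀ < η := by
    intro x hx
    rw [Real.dist_eq, abs_lt]
    constructor <;> linarith [hx.1, hx.2]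
  have hev' := fun x hx => hev (hI x hx)
  refine ⟨η / 2, half_pos hη, ?_⟩
  rw [← hD0]
  refine sparse_nearCurve_Icc (R := R) ?_ hR1 ?_ ?_ ?_ (by linarith) ?_ ?_ hC hc hτ hτ5
  · intro j x hx
    rw [hDs]
    exact (hDan x (hev' x hx).1 j).differentiableAt.hasDerivAt
  · intro j hj x hx
    have h1 := (hev' x hx).2.1 j (by simp; omega)
    have h2 := Finset.single_le_sum (f := fun j => |D j x₀| + 1) (fun j _ => by positivity)
      (show j ∈ Finset.range 6 by simp; omega)
    have := abs_nonneg x₀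
    linarith
  · rcases lt_or_gt_of_ne hd with h | h
    · right
      intro x hx
      have h1 := abs_lt.mp (hev' x hx).2.2.1
      rw [abs_of_neg h] at h1 hRinv
      linarith
    · left
      intro x hx
      have h1 := abs_lt.mp (hev' x hx).2.2.1
      rw [abs_of_pos h] at h1 hRinv
      linarith
  · intro x hx
    have := (hev' x hx).2.2.2
    linarith
  · rw [hD0]
    exact fun x hx => (hev' x hx).1
  · intro q hq h
    refine hconic q hq ?_
    filter_upwards [Icc_mem_nhds (show x₀ - η / 2 < x₀ by linarith)
      (show x₀ < x₀ + η / 2 by linarith)] with x hx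
    rw [← hD0]
    exact h x hx

end Nonflex

section Flex

theorem dd_lower_of_side {D : ℕ → ℝ → ℝ} {a η m σ s : ℝ} {k : ℕ}
    (hD : ∀ j, ∀ x ∈ Set.Icc (a - η) (a + η), HasDerivAt (D j) (D (j + 1) x) x)
    (hm : 0 ≤ m) (hσ : σ = 1 ∨ σ = -1)
    (hs : s = 1 ∨ s = -1)
    (hlow : ∀ x ∈ Set.Icc (a - η) (a + η), 0 ≤ σ * (x - a) →
      m * ((k + 2) * (k + 1)) * |x - a| ^ k ≤ s * D 2 x) {x y z : ℝ}
    (hx : x ∈ Set.Icc (a - η) (a + η) ∧ 0 ≤ σ * (x - a))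
    (hy : y ∈ Set.Icc (a - η) (a + η) ∧ 0 ≤ σ * (y - a))
    (hz : z ∈ Set.Icc (a - η) (a + η) ∧ 0 ≤ σ * (z - a)) :
    m * |(y - x) * (z - x) * (z - y)| * |x - a| ^ k ≤ |dd (D 0) x y z| := by
  have hσσ : σ * σ = 1 := by rcases hσ with h | h <;> rw [h] <;> norm_num
  have hσabs : |σ| = 1 := by rcases hσ with h | h <;> rw [h] <;> norm_num
  have hsabs : |s| = 1 := by rcases hs with h | h <;> rw [h] <;> norm_num
  have hmem : ∀ t ∈ Set.Icc 0 η, a + σ * t ∈ Set.Icc (a - η) (a + η) := by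
    intro t ht
    rcases hσ with h | h <;> rw [h] <;> constructor <;> linarith [ht.1, ht.2]
  have hback : ∀ x, x ∈ Set.Icc (a - η) (a + η) ∧ 0 ≤ σ * (x - a) → σ * (x - a) ∈ Set.Icc 0 η := by
    intro x hx
    refine ⟨hx.2, ?_⟩
    rcases hσ with h | h <;> rw [h] <;> linarith [hx.1.1, hx.1.2]
  have hinv : ∀ x, a + σ * (σ * (x - a)) = x := fun x => by
    rw [← mul_assoc, hσσ]; ring
  have hlin : ∀ t, HasDerivAt (fun t => a + σ * t) σ t := fun t => by
    simpa using ((hasDerivAt_id t).const_mul σ).const_add a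
  have key := abs_dd_lower (k := k) (f := fun t => s * D 0 (a + σ * t))
    (f' := fun t => s * (D 1 (a + σ * t) * σ)) (f'' := fun t => s * (D 2 (a + σ * t) * σ * σ))
    (a := 0) (b := η) hm
    (fun t ht => ((hD 0 _ (hmem t ht)).comp t (hlin t)).const_mul s)
    (fun t ht => (((hD 1 _ (hmem t ht)).comp t (hlin t)).mul_const σ).const_mul s)
    (fun t ht => by
      have h1 := hlow _ (hmem t ht) (by
        rw [add_sub_cancel_left, ← mul_assoc, hσσ, one_mul]; exact ht.1)
      rw [add_sub_cancel_left, abs_mul, hσabs, one_mul, abs_of_nonneg ht.1] at h1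
      rw [sub_zero, mul_assoc _ σ, hσσ, mul_one]
      exact h1) (hback x hx) (hback y hy) (hback z hz)
  have e1 : dd (fun t => s * D 0 (a + σ * t)) (σ * (x - a)) (σ * (y - a)) (σ * (z - a)) =
      s * σ * dd (D 0) x y z := by
    simp only [dd, hinv]; ring
  have e2 : (σ * (y - a) - σ * (x - a)) * (σ * (z - a) - σ * (x - a)) *
      (σ * (z - a) - σ * (y - a)) = (σ * σ) * σ * ((y - x) * (z - x) * (z - y)) := by ring
  rw [e1, e2, hσσ, one_mul, abs_mul, abs_mul, abs_mul, abs_mul _ (dd _ _ _ _), abs_mul s, hσabs,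
    hsabs,
    sub_zero, abs_mul σ, hσabs, one_mul, one_mul, one_mul, one_mul] at key
  simpa only [abs_mul] using key

theorem exists_card_le_of_flex_side {D : ℕ → ℝ → ℝ} {a η m M σ s μ₀ c C τ : ℝ} {k : ℕ}
    (hD : ∀ j, ∀ x ∈ Set.Icc (a - η) (a + η), HasDerivAt (D j) (D (j + 1) x) x)
    (hη0 : 0 < η) (hη1 : η ≤ 1) (hm : 0 < m) (hM : 0 ≤ M) (hσ : σ = 1 ∨ σ = -1)
    (hs : s = 1 ∨ s = -1)
    (hup : ∀ x ∈ Set.Icc (a - η) (a + η), |D 2 x| ≤ M * |x - a| ^ k)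
    (hlow : ∀ x ∈ Set.Icc (a - η) (a + η), 0 ≤ σ * (x - a) →
      m * ((k + 2) * (k + 1)) * |x - a| ^ k ≤ s * D 2 x)
    (hθ : IsAlgebraic ℤ (D 1 a)) (hμ : IsAlgebraic ℤ μ₀) (hμ₀ : D 0 a = D 1 a * a + μ₀)
    (hc : 0 < c) (hC : 0 ≤ C) (hτ : 4 < τ) :
    ∃ K, 0 < K ∧ ∀ᶠ B : ℝ in Filter.atTop, ∀ S : Finset (Fin 3 → ℤ),
      (∀ v ∈ S, NearCurve (D 0) c (C * B ^ (-τ)) B v ∧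
        (absc v ∈ Set.Icc (a - η) (a + η) ∧ 0 ≤ σ * (absc v - a)) ∧
        ordi v ≠ D 1 a * absc v + μ₀) →
      ∀ ρ, 0 ≤ ρ → (∀ v ∈ S, |absc v - a| ≤ ρ) → (S.card : ℝ) ≤ K * (ρ * B + 1) := by
  obtain ⟨I, hI⟩ : ∃ I : Set ℝ, ∀ x, x ∈ I ↔ x ∈ Set.Icc (a - η) (a + η) ∧ 0 ≤ σ * (x - a) :=
    ⟨{x | x ∈ Set.Icc (a - η) (a + η) ∧ 0 ≤ σ * (x - a)}, fun _ => Iff.rfl⟩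
  have habs : ∀ x ∈ Set.Icc (a - η) (a + η), |x - a| ≤ η := by
    intro x hx
    rw [abs_le]; constructor <;> linarith [hx.1, hx.2]
  have haI : a ∈ Set.Icc (a - η) (a + η) := by constructor <;> linarith
  have hsub : ∀ x ∈ Set.Icc (a - η) (a + η),
      Set.Icc (a - |x - a|) (a + |x - a|) ⊆ Set.Icc (a - η) (a + η) := by
    intro x hx
    have := habs x hx
    exact Set.Icc_subset_Icc (by linarith) (by linarith)
  have hball : ∀ x y : ℝ, |y - a| ≤ |x - a| ↔ y ∈ Set.Icc (a - |x - a|) (a + |x - a|) := by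
    intro x y
    rw [abs_le, Set.mem_Icc]
    constructor <;> rintro ⟨h1, h2⟩ <;> constructor <;> linarith
  have hD1 : ∀ x ∈ Set.Icc (a - η) (a + η), |D 1 x - D 1 a| ≤ M * |x - a| ^ (k + 1) := by
    intro x hx
    have := (convex_Icc (a - |x - a|) (a + |x - a|)).norm_image_sub_le_of_norm_hasDerivWithin_le
      (f := D 1) (f' := D 2) (C := M * |x - a| ^ k) (x := a) (y := x)
      (fun y hy => (hD 1 y (hsub x hx hy)).hasDerivWithinAt) (fun y hy => by
        rw [Real.norm_eq_abs]
        refine (hup y (hsub x hx hy)).trans ?_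
        have := (hball x y).mpr hy
        gcongr) ((hball x a).mp (by simp)) ((hball x x).mp le_rfl)
    rw [Real.norm_eq_abs, Real.norm_eq_abs] at this
    rwa [pow_succ, ← mul_assoc]
  have hr : ∀ x ∈ Set.Icc (a - η) (a + η), ∀ y, |y - a| ≤ |x - a| →
      |(D 0 x - D 1 a * x) - (D 0 y - D 1 a * y)| ≤ M * |x - a| ^ (k + 1) * |x - y| := by
    intro x hx y hy
    have := (convex_Icc (a - |x - a|) (a + |x - a|)).norm_image_sub_le_of_norm_hasDerivWithin_le
      (f := fun x => D 0 x - D 1 a * x) (f' := fun x => D 1 x - D 1 a)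
      (C := M * |x - a| ^ (k + 1)) (x := y) (y := x)
      (fun y hy => ((hD 0 y (hsub x hx hy)).sub
        (by simpa using (hasDerivAt_id y).const_mul (D 1 a))).hasDerivWithinAt) (fun z hz => by
        rw [Real.norm_eq_abs]
        refine (hD1 z (hsub x hx hz)).trans ?_
        have := (hball x z).mpr hz
        gcongr) ((hball x y).mp hy) ((hball x x).mp le_rfl)
    simpa only [Real.norm_eq_abs] using this
  have hr0 : ∀ x ∈ Set.Icc (a - η) (a + η),
      |D 0 x - (D 1 a * x + μ₀)| ≤ M * |x - a| ^ (k + 1) := by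
    intro x hx
    have h1 := hr x hx a (by simp)
    have h2 : (D 0 x - D 1 a * x) - (D 0 a - D 1 a * a) = D 0 x - (D 1 a * x + μ₀) := by
      rw [hμ₀]; ring
    rw [h2] at h1
    refine h1.trans (mul_le_of_le_one_right (by positivity) ((habs x hx).trans hη1))
  obtain ⟨δ, hδ0, hδ1, hδk, hδτ⟩ : ∃ δ : ℝ, 0 < δ ∧ δ ≤ 1 ∧ δ * k ≤ 2 ∧ 4 + 2 * δ < τ := by
    refine ⟨min ((τ - 4) / 4) (1 / (k + 1)), lt_min (by linarith) (by positivity), ?_, ?_, ?_⟩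
    · exact (min_le_right _ _).trans ((div_le_one (by positivity)).mpr (by simp))
    · calc min ((τ - 4) / 4) (1 / ((k : ℝ) + 1)) * k ≤ 1 / ((k : ℝ) + 1) * k := by
            gcongr; exact min_le_right _ _
        _ ≤ 2 := by
            rw [div_mul_eq_mul_div, div_le_iff₀ (by positivity)]
            linarith [Nat.cast_nonneg (α := ℝ) k]
    · linarith [min_le_left ((τ - 4) / 4) (1 / ((k : ℝ) + 1))]
  obtain ⟨ζ, hζ, hdet⟩ := exists_det3_ne_zero_of_flex (f := D 0) (c := c) (I := I) (a := a)
    (θ := D 1 a) (μ₀ := μ₀) (K := M) (κ := m) (δ := δ) (k := k) hθ hμ hm hM hδ0 hδk hδ1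
    (fun x hx => (habs x ((hI x).mp hx).1).trans hη1)
    (fun x hx y hy z hz => dd_lower_of_side hD hm.le hσ hs hlow ((hI x).mp hx) ((hI y).mp hy)
      ((hI z).mp hz))
    (fun x hx y _ hxy => hr x ((hI x).mp hx).1 y hxy) (fun x hx => hr0 x ((hI x).mp hx).1) hc
  have hM2 : ∀ x ∈ I, ∀ y ∈ I, |D 0 y - D 0 x - D 1 x * (y - x)| ≤ M * |y - x| ^ 2 := by
    intro x hx y hy
    have := abs_sub_taylor_le (R := M) 2 hD (fun x hx => (hup x hx).trans (mul_le_of_le_one_right hM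
      (pow_le_one₀ (abs_nonneg _) ((habs x hx).trans hη1)))) ((hI x).mp hx).1 ((hI y).mp hy).1
    simp only [Finset.sum_range_succ, Finset.range_zero, Finset.sum_empty] at this
    norm_num at this
    calc |D 0 y - D 0 x - D 1 x * (y - x)| = |D 0 y - (D 0 x + D 1 x * (y - x))| := by
          congr 1; ring
      _ ≤ M * (y - x) ^ 2 := this
      _ = M * |y - x| ^ 2 := by rw [sq_abs]
  obtain ⟨c₀, hc₀, hc₀1, hc₀M⟩ : ∃ c₀ : ℝ, 0 < c₀ ∧ c₀ ≤ 1 ∧ 2 * M * c₀ ^ 3 < 1 / 2 := by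
    refine ⟨(4 * M + 2)⁻¹, by positivity, inv_le_one_of_one_le₀ (by linarith), ?_⟩
    have h1 : (4 * M + 2)⁻¹ ≤ 1 := inv_le_one_of_one_le₀ (by linarith)
    have h0 : 0 < (4 * M + 2)⁻¹ := by positivity
    calc 2 * M * (4 * M + 2)⁻¹ ^ 3 ≤ 2 * M * (4 * M + 2)⁻¹ := by
          gcongr
          exact pow_le_of_le_one h0.le h1 (by norm_num)
      _ < 1 / 2 := by
          rw [← div_eq_mul_inv, div_lt_iff₀ (by positivity)]; linarith
  refine ⟨4 / c₀, by positivity, ?_⟩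
  have t2 := (tendsto_mul_rpow_neg_mul_pow (C := C) (τ := τ) (n := 2)
    (by push_cast; linarith)).const_mul 4
  have tδ : Filter.Tendsto (fun B : ℝ => C * B ^ (-(τ - (4 + 2 * δ)))) Filter.atTop
      (nhds (C * 0)) :=
    (tendsto_rpow_neg_atTop (by linarith)).const_mul C
  rw [mul_zero] at t2 tδ
  filter_upwards [
    t2.eventually_lt_const (show (0 : ℝ) < 1 / 2 by norm_num),
    tδ.eventually_le_const hζ, Filter.eventually_ge_atTop 1] with B h2 hδB hB1 S hS ρ hρ hSρ
  have hB : 0 < B := by linarith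
  have he0 : 0 ≤ C * B ^ (-τ) := by positivity
  have hne : ∀ u v, NearCurve (D 0) c (C * B ^ (-τ)) B u → NearCurve (D 0) c (C * B ^ (-τ)) B v →
      u ≠ v → absc u ≠ absc v := by
    intro u v hu hv huv h
    exact huv (hu.eq_of_absc_eq hv hc hB (by linarith) h)
  have hδB' : C * B ^ (-τ) * B ^ (4 + 2 * δ) ≤ ζ := by
    rwa [mul_assoc, ← Real.rpow_add hB, show -τ + (4 + 2 * δ) = -(τ - (4 + 2 * δ)) by ring]
  have hsm : 2 * M * c₀ ^ 3 + 4 * (C * B ^ (-τ)) * c₀ * B ^ 2 < 1 := by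
    have : C * B ^ (-τ) * B ^ 2 * c₀ ≤ C * B ^ (-τ) * B ^ 2 :=
      mul_le_of_le_one_right (by positivity) hc₀1
    linarith
  have hSI : ∀ v ∈ S, absc v ∈ I := fun v hv => (hI _).mpr (hS v hv).2.1
  have := card_le_of_det3_ne_zero hM2 hM hc hB he0 hc₀ hsm S (fun v hv => ⟨(hS v hv).1, hSI v hv⟩)
    (fun u hu v hv w hw huv huw hvw => hdet _ B hB1 hδB' u v w (hS u hu).1 (hS v hv).1 (hS w hw).1
      (hSI u hu) (hSI v hv) (hSI w hw) (hne u v (hS u hu).1 (hS v hv).1 huv)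
      (hne u w (hS u hu).1 (hS w hw).1 huw) (hne v w (hS v hv).1 (hS w hw).1 hvw) (hS u hu).2.2)
    (a := a - ρ) (b := a + ρ) (by linarith) (fun v hv => by
      have := abs_le.mp (hSρ v hv)
      constructor <;> linarith)
  refine this.trans ?_
  have h1 : 2 * ((a + ρ - (a - ρ)) * B / c₀ + 1) = 4 / c₀ * (ρ * B) + 2 := by field_simp; ring
  have h3 : (1 : ℝ) ≤ 1 / c₀ := (one_le_div hc₀).mpr hc₀1
  have h5 : 4 / c₀ * 1 = 4 * (1 / c₀) := by ring
  rw [h1, mul_add, h5]; linarith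

/-- Near an inflection point with algebraic tangent line there are few integer points off that
line. -/
theorem sparse_nearCurve_of_flex {f : ℝ → ℝ} {x₀ μ₀ c C τ : ℝ}
    (hf : AnalyticAt ℝ f x₀) (hf2 : ¬ ∀ᶠ x in nhds x₀, deriv (deriv f) x = 0)
    (hconic : ∀ q : Fin 6 → ℤ, q ≠ 0 →
      ¬ ∀ᶠ x in nhds x₀, conic (fun i => (q i : ℝ)) x (f x) = 0)
    (hθ : IsAlgebraic ℤ (deriv f x₀)) (hμ : IsAlgebraic ℤ μ₀) (hμ₀ : f x₀ = deriv f x₀ * x₀ + μ₀)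
    (hC : 0 ≤ C) (hc : 0 < c) (hτ : 4 < τ) (hτ5 : τ ≤ 5) :
    ∃ η > 0, Sparse (fun B v => (NearCurve f c (C * B ^ (-τ)) B v ∧
      ordi v ≠ deriv f x₀ * absc v + μ₀) ∧ absc v ∈ Set.Icc (x₀ - η) (x₀ + η)) := by
  classical
  obtain ⟨D, hDdef⟩ : ∃ D : ℕ → ℝ → ℝ, ∀ j, D j = deriv^[j] f := ⟨_, fun _ => rfl⟩
  have hD0 : D 0 = f := hDdef 0
  have hDs : ∀ j, D (j + 1) = deriv (D j) := fun j => by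
    rw [hDdef, hDdef, Function.iterate_succ_apply']
  have hD1 : D 1 = deriv f := by rw [hDs, hD0]
  have hD2 : D 2 = deriv (deriv f) := by rw [hDs, hD1]
  have hDan : ∀ x, AnalyticAt ℝ f x → ∀ j, AnalyticAt ℝ (D j) x := by
    intro x hx j
    induction j with
    | zero => rwa [hD0]
    | succ j ih => rw [hDs]; exact ih.deriv
  obtain ⟨k, u, hu, hu0, huk⟩ :=
    (hDan x₀ hf 2).exists_eventuallyEq_pow_smul_nonzero_iff.mpr (by rwa [hD2])
  have ev3 : ∀ᶠ x in nhds x₀, |u x - u x₀| < |u x₀| / 2 := by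
    have h1 : Filter.Tendsto (fun x => |u x - u x₀|) (nhds x₀) (nhds |u x₀ - u x₀|) :=
      (hu.continuousAt.sub continuousAt_const).abs
    refine h1.eventually_lt_const ?_
    rw [sub_self, abs_zero]; positivity
  obtain ⟨η, hη, hev⟩ := Metric.eventually_nhds_iff.mp
    (hf.eventually_analyticAt.and (huk.and ev3))
  obtain ⟨ξ, hξ⟩ : ∃ ξ, ξ = min (η / 2) 1 := ⟨_, rfl⟩
  have hξ0 : 0 < ξ := by rw [hξ]; positivity
  have hξ1 : ξ ≤ 1 := by rw [hξ]; exact min_le_right _ _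
  have hξη : ξ < η := by rw [hξ]; exact (min_le_left _ _).trans_lt (by linarith)
  have hI : ∀ x ∈ Set.Icc (x₀ - ξ) (x₀ + ξ), dist x x₀ < η := by
    intro x hx
    rw [Real.dist_eq, abs_lt]
    constructor <;> linarith [hx.1, hx.2]
  have hev' := fun x hx => hev (hI x hx)
  have hD : ∀ j, ∀ x ∈ Set.Icc (x₀ - ξ) (x₀ + ξ), HasDerivAt (D j) (D (j + 1) x) x := by
    intro j x hx
    rw [hDs]
    exact (hDan x (hev' x hx).1 j).differentiableAt.hasDerivAt
  have hD2u : ∀ x ∈ Set.Icc (x₀ - ξ) (x₀ + ξ), D 2 x = (x - x₀) ^ k * u x := fun x hx => by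
    rw [(hev' x hx).2.1, smul_eq_mul]
  have hulow : ∀ x ∈ Set.Icc (x₀ - ξ) (x₀ + ξ), |u x₀| / 2 ≤ |u x| := by
    intro x hx
    have h1 := (hev' x hx).2.2
    have h2 := abs_sub_abs_le_abs_sub (u x₀) (u x)
    rw [abs_sub_comm] at h2
    linarith
  have huup : ∀ x ∈ Set.Icc (x₀ - ξ) (x₀ + ξ), |u x| ≤ 2 * |u x₀| := by
    intro x hx
    have h1 := (hev' x hx).2.2
    have h2 := abs_sub_abs_le_abs_sub (u x) (u x₀)
    linarith [abs_nonneg (u x₀)]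
  have hside : ∀ σ : ℝ, (σ = 1 ∨ σ = -1) → ∃ K, 0 < K ∧ ∀ᶠ B : ℝ in Filter.atTop,
      ∀ S : Finset (Fin 3 → ℤ), (∀ v ∈ S, NearCurve (D 0) c (C * B ^ (-τ)) B v ∧
        (absc v ∈ Set.Icc (x₀ - ξ) (x₀ + ξ) ∧ 0 ≤ σ * (absc v - x₀)) ∧
        ordi v ≠ D 1 x₀ * absc v + μ₀) →
      ∀ ρ, 0 ≤ ρ → (∀ v ∈ S, |absc v - x₀| ≤ ρ) → (S.card : ℝ) ≤ K * (ρ * B + 1) := by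
    intro σ hσ
    have hσσ : σ * σ = 1 := by rcases hσ with h | h <;> rw [h] <;> norm_num
    have hσk : σ ^ k = 1 ∨ σ ^ k = -1 := by
      rcases hσ with h | h <;> rw [h]
      · left; simp
      · exact neg_one_pow_eq_or ℝ k
    obtain ⟨s₁, hs₁, hs₁u⟩ : ∃ s₁ : ℝ, (s₁ = 1 ∨ s₁ = -1) ∧ s₁ * u x₀ = |u x₀| := by
      rcases le_total 0 (u x₀) with h | h
      · exact ⟨1, Or.inl rfl, by rw [one_mul, abs_of_nonneg h]⟩
      · exact ⟨-1, Or.inr rfl, by rw [abs_of_nonpos h]; ring⟩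
    refine exists_card_le_of_flex_side (k := k) (M := 2 * |u x₀|) (s := σ ^ k * s₁)
      (m := |u x₀| / 2 / ((k + 2) * (k + 1))) hD hξ0 hξ1 (by positivity) (by positivity) hσ ?_ ?_ ?_
      (by rwa [hD1]) hμ (by rwa [hD0, hD1]) hc hC hτ
    · rcases hσk with h | h <;> rcases hs₁ with h' | h' <;> rw [h, h'] <;> norm_num
    · intro x hx
      rw [hD2u x hx, abs_mul, abs_pow, mul_comm]
      gcongr
      exact huup x hx
    · intro x hx hxσ
      rw [hD2u x hx, div_mul_cancel₀ _ (by positivity)]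
      have e1 : |x - x₀| = σ * (x - x₀) := by
        have : |σ * (x - x₀)| = |x - x₀| := by
          rw [abs_mul]; rcases hσ with h | h <;> rw [h] <;> norm_num
        rw [← this, abs_of_nonneg hxσ]
      have e2 : σ ^ k * s₁ * ((x - x₀) ^ k * u x) = s₁ * u x * |x - x₀| ^ k := by
        rw [e1, mul_pow]; ring
      rw [e2]
      gcongr
      have h1 := abs_lt.mp (hev' x hx).2.2
      rcases hs₁ with h | h <;> rw [h] at hs₁u ⊢ <;> linarith
  obtain ⟨K₁, hK₁, hc₁⟩ := hside 1 (Or.inl rfl)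
  obtain ⟨K₂, hK₂, hc₂⟩ := hside (-1) (Or.inr rfl)
  refine ⟨ξ, hξ0, ?_⟩
  intro ε hε
  obtain ⟨ρ, hρ⟩ : ∃ ρ, ρ = ε / (4 * (K₁ + K₂)) := ⟨_, rfl⟩
  have hρ0 : 0 < ρ := by rw [hρ]; positivity
  have hrest : Sparse (fun B v => NearCurve f c (C * B ^ (-τ)) B v ∧
      absc v ∈ Set.Icc (x₀ - ξ) (x₀ + ξ) \ Metric.ball x₀ ρ) := by
    refine sparse_of_isCompact (isCompact_Icc.diff Metric.isOpen_ball) absc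
      (fun B v => NearCurve f c (C * B ^ (-τ)) B v) ?_
    intro x hx
    have hxx : x - x₀ ≠ 0 := by
      intro h
      exact hx.2 (by rw [sub_eq_zero.mp h]; exact Metric.mem_ball_self hρ0)
    obtain ⟨η', hη', hsp⟩ := sparse_nearCurve_of_deriv_deriv_ne_zero (c := c) (C := C)
      (hev' x hx.1).1 (by
        rw [← hD2, hD2u x hx.1]
        refine mul_ne_zero (pow_ne_zero _ hxx) ?_
        have := hulow x hx.1
        rw [← abs_pos]
        have h0 : 0 < |u x₀| := abs_pos.mpr hu0
        linarith) (fun q hq h => by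
        have han : AnalyticOnNhd ℝ (fun x => conic (fun i => (q i : ℝ)) x (f x))
            (Set.Icc (x₀ - ξ) (x₀ + ξ)) :=
          analyticOnNhd_conic (fun x hx => (hev' x hx).1) _
        have := han.eqOn_zero_of_preconnected_of_eventuallyEq_zero isPreconnected_Icc hx.1 h
        refine hconic q hq ?_
        filter_upwards [Icc_mem_nhds (show x₀ - ξ < x₀ by linarith)
          (show x₀ < x₀ + ξ by linarith)] with y hy
        exact this hy) hC hc hτ hτ5
    exact ⟨_, Icc_mem_nhds (by linarith) (by linarith), hsp⟩
  filter_upwards [hrest (ε / 2) (half_pos hε), hc₁, hc₂, Filter.eventually_ge_atTop 1,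
    Filter.eventually_ge_atTop ((K₁ + K₂) * (4 / ε))] with B hrest hc₁ hc₂ hB1 hBbig S hS
  have hB : 0 < B := by linarith
  have hsplit : (S.card : ℝ) = (S.filter fun v => absc v ∈ Metric.ball x₀ ρ).card +
      (S.filter fun v => absc v ∉ Metric.ball x₀ ρ).card := by
    exact_mod_cast (Finset.card_filter_add_card_filter_not (s := S) _).symm
  have hsplit2 : ((S.filter fun v => absc v ∈ Metric.ball x₀ ρ).card : ℝ) =
      ((S.filter fun v => absc v ∈ Metric.ball x₀ ρ).filter fun v => 0 ≤ 1 * (absc v - x₀)).card +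
      ((S.filter fun v => absc v ∈ Metric.ball x₀ ρ).filter
        fun v => ¬ 0 ≤ 1 * (absc v - x₀)).card := by
    exact_mod_cast (Finset.card_filter_add_card_filter_not _).symm
  have h1 := hrest (S.filter fun v => absc v ∉ Metric.ball x₀ ρ) (fun v hv =>
    ⟨(hS v (Finset.mem_filter.mp hv).1).1.1, (hS v (Finset.mem_filter.mp hv).1).2,
      (Finset.mem_filter.mp hv).2⟩)
  have hnear : ∀ v ∈ S.filter fun v => absc v ∈ Metric.ball x₀ ρ, |absc v - x₀| ≤ ρ := by
    intro v hv
    have := (Finset.mem_filter.mp hv).2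
    rw [Metric.mem_ball, Real.dist_eq] at this
    exact this.le
  have h2 := hc₁ ((S.filter fun v => absc v ∈ Metric.ball x₀ ρ).filter
    fun v => 0 ≤ 1 * (absc v - x₀)) (fun v hv => by
      obtain ⟨hv1, hv2⟩ := Finset.mem_filter.mp hv
      have hv3 := hS v (Finset.mem_filter.mp hv1).1
      rw [hD0, hD1]
      exact ⟨hv3.1.1, ⟨hv3.2, hv2⟩, hv3.1.2⟩) ρ hρ0.le
    (fun v hv => hnear v (Finset.mem_filter.mp hv).1)
  have h3 := hc₂ ((S.filter fun v => absc v ∈ Metric.ball x₀ ρ).filter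
    fun v => ¬ 0 ≤ 1 * (absc v - x₀)) (fun v hv => by
      obtain ⟨hv1, hv2⟩ := Finset.mem_filter.mp hv
      have hv3 := hS v (Finset.mem_filter.mp hv1).1
      rw [hD0, hD1]
      exact ⟨hv3.1.1, ⟨hv3.2, by linarith⟩, hv3.1.2⟩) ρ hρ0.le
    (fun v hv => hnear v (Finset.mem_filter.mp hv).1)
  have h4 : K₁ * (ρ * B + 1) + K₂ * (ρ * B + 1) = ε / 4 * B + (K₁ + K₂) := by
    rw [hρ]; field_simp
  have h5 : K₁ + K₂ ≤ ε / 4 * B := by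
    calc K₁ + K₂ = ε / 4 * ((K₁ + K₂) * (4 / ε)) := by field_simp
      _ ≤ _ := by gcongr
  rw [hsplit, hsplit2]
  linarith

end Flex

theorem aeval_mul_of_isHomogeneous {σ R A : Type*} [CommSemiring R] [CommSemiring A]
    [Algebra R A] {F : MvPolynomial σ R} {n : ℕ} (hF : F.IsHomogeneous n) (r : A) (x : σ → A) :
    aeval (fun i => r * x i) F = r ^ n * aeval x F := by
  rw [aeval_def, aeval_def, eval₂_eq, eval₂_eq, Finset.mul_sum]
  refine Finset.sum_congr rfl fun d hd => ?_
  have hdeg : ∑ i ∈ d.support, d i = n := by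
    have := hF (mem_support_iff.1 hd)
    rwa [Finsupp.weight_apply, Finsupp.sum, Finset.sum_congr rfl
      (fun i _ => by rw [Pi.one_apply, smul_eq_mul, mul_one])] at this
  simp_rw [mul_pow]
  rw [Finset.prod_mul_distrib, Finset.prod_pow_eq_pow_sum, hdeg]
  ring

theorem sum_mul_aeval_pderiv {σ R A : Type*} [Fintype σ] [CommRing R]
    [CommRing A] [Algebra R A] {F : MvPolynomial σ R} {n : ℕ} (hF : F.IsHomogeneous n)
    (x : σ → A) : ∑ i, x i * aeval x (pderiv i F) = n * aeval x F := by
  have h := congrArg (aeval x) hF.sum_X_mul_pderiv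
  simpa using h

theorem derivative_aeval_mvPolynomial {σ : Type*} [Fintype σ]
    (w : σ → Polynomial ℂ) (F : MvPolynomial σ ℤ) :
    Polynomial.derivative (aeval w F) =
      ∑ i, aeval w (pderiv i F) * Polynomial.derivative (w i) := by
  classical
  induction F using MvPolynomial.induction_on with
  | C a => simp
  | add p q hp hq => simp [hp, hq, add_mul, Finset.sum_add_distrib]
  | mul_X p j hp =>
    have key : ∀ i, aeval w (pderiv i (p * X j)) * Polynomial.derivative (w i) =
        aeval w (pderiv i p) * Polynomial.derivative (w i) * w j +
          aeval w p *
            (aeval w (pderiv i (X j : MvPolynomial σ ℤ)) * Polynomial.derivative (w i)) := by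
      intro i
      rw [pderiv_mul, map_add, map_mul, map_mul, aeval_X]
      ring
    rw [map_mul, aeval_X, Polynomial.derivative_mul, hp, Finset.sum_mul,
      Finset.sum_congr rfl fun i _ => key i, Finset.sum_add_distrib, ← Finset.mul_sum]
    congr 2
    · rw [Finset.sum_eq_single j]
      · simp
      · intro i _ hij
        simp [Pi.single_eq_of_ne' hij]
      · simp

theorem hasDerivAt_aeval_mvPolynomial {σ 𝕜 : Type*} [Fintype σ] [NontriviallyNormedField 𝕜]
    {c : 𝕜 → σ → 𝕜} {c' : σ → 𝕜} {t : 𝕜} (hc : ∀ i, HasDerivAt (fun s => c s i) (c' i) t)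
    (F : MvPolynomial σ ℤ) :
    HasDerivAt (fun s => aeval (c s) F) (∑ i, aeval (c t) (pderiv i F) * c' i) t := by
  classical
  induction F using MvPolynomial.induction_on with
  | C a => simpa using hasDerivAt_const t (a : 𝕜)
  | add p q hp hq =>
    simp only [map_add, add_mul, Finset.sum_add_distrib]
    exact hp.add hq
  | mul_X p j hp =>
    have h := hp.mul (hc j)
    simp only [map_mul, aeval_X]
    refine h.congr_deriv ?_
    simp only [map_mul, aeval_X, pderiv_mul, pderiv_X, map_add,
      add_mul, Finset.sum_add_distrib, Finset.sum_mul]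
    congr 1
    · exact Finset.sum_congr rfl fun i _ => by ring
    · rw [Finset.sum_eq_single j]
      · simp
      · intro i _ hij
        simp [Pi.single_eq_of_ne' hij]
      · simp

theorem eval_aeval_mvPolynomial {σ : Type*} (w : σ → Polynomial ℂ) (F : MvPolynomial σ ℤ) (m : ℂ) :
    (aeval w F).eval m = aeval (fun i => (w i).eval m) F := by
  induction F using MvPolynomial.induction_on with
  | C a => simp
  | add p q hp hq => simp [hp, hq]
  | mul_X p j hp => simp [hp]

theorem pderiv_comm {σ R : Type*} [CommRing R] (i j : σ) (F : MvPolynomial σ R) :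
    pderiv i (pderiv j F) = pderiv j (pderiv i F) := by
  classical
  induction F using MvPolynomial.induction_on with
  | C a => simp
  | add p q hp hq => simp [hp, hq]
  | mul_X p l hp =>
    have key : ∀ a b : σ, pderiv a (Pi.single (M := fun _ => MvPolynomial σ R) b 1 l) = 0 := by
      intro a b
      by_cases h : l = b
      · subst h; simp
      · simp [Pi.single_eq_of_ne h]
    simp only [pderiv_mul, pderiv_X, map_add, hp, key]
    ring

/-- The plane curve cut out by `F` over `ℂ` has no singular point. -/
def Smooth (F : MvPolynomial (Fin 3) ℤ) : Prop :=
  ∀ x : Fin 3 → ℂ, x ≠ 0 → ∃ i, aeval x (pderiv i F) ≠ 0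

theorem aeval_polynomial_eq_zero {F : MvPolynomial (Fin 3) ℤ} {w : Fin 3 → Polynomial ℂ}
    (h : {m : ℂ | aeval (fun i => (w i).eval m) F = 0}.Infinite) : aeval w F = 0 := by
  refine Polynomial.eq_zero_of_infinite_isRoot _ (h.mono fun m hm => ?_)
  rw [Set.mem_ofPred_eq, Polynomial.IsRoot, eval_aeval_mvPolynomial]
  exact hm

theorem infinite_ne_zero_complex : {m : ℂ | m ≠ 0}.Infinite :=
  (Set.finite_singleton (0 : ℂ)).infinite_compl

open Matrix in
/-- Along a parametrised curve inside the zero set of `F`, if the derivative of `F` in every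
direction vanishes together with that in direction `E j`, then the latter is a nonzero constant. -/
theorem exists_directional_eq_const {F : MvPolynomial (Fin 3) ℤ} (hns : Smooth F)
    {E : Matrix (Fin 3) (Fin 3) ℂ} (hE : E.det ≠ 0) (w : Fin 3 → Polynomial ℂ)
    (hw : ∀ m, (fun i => (w i).eval m) ≠ 0) (j : Fin 3)
    (hj : ∀ m, ∑ i, E j i * aeval (fun i => (w i).eval m) (pderiv i F) = 0 →
      ∀ l, ∑ i, E l i * aeval (fun i => (w i).eval m) (pderiv i F) = 0) :
    ∃ a : ℂ, a ≠ 0 ∧ ∀ m, ∑ i, E j i * aeval (fun i => (w i).eval m) (pderiv i F) = a := by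
  set P : Polynomial ℂ := ∑ i, Polynomial.C (E j i) * aeval w (pderiv i F) with hP
  have hPe : ∀ m, P.eval m = ∑ i, E j i * aeval (fun i => (w i).eval m) (pderiv i F) := by
    intro m
    simp [hP, Polynomial.eval_finsetSum, eval_aeval_mvPolynomial]
  have hne : ∀ m, P.eval m ≠ 0 := by
    intro m hm
    rw [hPe] at hm
    obtain ⟨i, hi⟩ := hns _ (hw m)
    have h0 := Matrix.eq_zero_of_mulVec_eq_zero hE
      (v := fun i => aeval (fun i => (w i).eval m) (pderiv i F)) (by
        ext l
        simpa [Matrix.mulVec, dotProduct] using hj m hm l)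
    exact hi (congrFun h0 i)
  have hdeg : P.degree = 0 := by
    by_contra hd
    obtain ⟨z, hz⟩ := IsAlgClosed.exists_root P hd
    exact hne z hz
  rw [Polynomial.eq_C_of_degree_eq_zero hdeg] at hne hPe
  refine ⟨P.coeff 0, by simpa using hne 0, fun m => ?_⟩
  rw [← hPe]
  simp

theorem combination_ne_zero {E : Matrix (Fin 3) (Fin 3) ℂ} (hE : E.det ≠ 0) {u : Fin 3 → ℂ}
    (hu : u ≠ 0) : (fun i => E 0 i * u 0 + E 1 i * u 1 + E 2 i * u 2) ≠ 0 := by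
  intro h
  apply hu
  refine Matrix.eq_zero_of_vecMul_eq_zero hE ?_
  ext i
  have := congrFun h i
  simpa [Matrix.vecMul, dotProduct, Fin.sum_univ_three, mul_comm] using this

theorem exists_const_of_conic {F : MvPolynomial (Fin 3) ℤ} (hns : Smooth F) {k : ℕ}
    (hF : F.IsHomogeneous k) {E : Matrix (Fin 3) (Fin 3) ℂ} (hE : E.det ≠ 0)
    (h : {m : ℂ | aeval (fun i => E 0 i * m ^ 2 + E 1 i * m + E 2 i) F = 0}.Infinite) :
    ∃ a : ℂ, a ≠ 0 ∧ ∀ m : ℂ,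
      ∑ i, E 0 i * aeval (fun i => E 0 i * m ^ 2 + E 1 i * m + E 2 i) (pderiv i F) = a ∧
      ∑ i, E 2 i * aeval (fun i => E 0 i * m ^ 2 + E 1 i * m + E 2 i) (pderiv i F) =
        m ^ 2 * a := by
  set w : Fin 3 → Polynomial ℂ := fun i => Polynomial.C (E 0 i) * Polynomial.X ^ 2 +
    Polynomial.C (E 1 i) * Polynomial.X + Polynomial.C (E 2 i) with hw
  have hwe : ∀ m : ℂ, (fun i => (w i).eval m) = fun i => E 0 i * m ^ 2 + E 1 i * m + E 2 i := by
    intro m; ext i; simp [hw]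
  have hF0 : aeval w F = 0 := aeval_polynomial_eq_zero (by simpa only [hwe] using h)
  have hd : ∀ m : ℂ, ∑ i, aeval (fun i => (w i).eval m) (pderiv i F) *
      (E 0 i * (2 * m) + E 1 i) = 0 := by
    intro m
    have := congrArg (Polynomial.eval m) (derivative_aeval_mvPolynomial w F)
    rw [hF0] at this
    simp only [Polynomial.eval_finsetSum, Polynomial.eval_mul, eval_aeval_mvPolynomial] at this
    rw [Polynomial.derivative_zero, Polynomial.eval_zero] at this
    rw [this]
    refine Finset.sum_congr rfl fun i _ => ?_
    congr 1
    simp [hw, one_add_one_eq_two]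
  have he : ∀ m : ℂ, ∑ i, aeval (fun i => (w i).eval m) (pderiv i F) *
      (E 0 i * m ^ 2 + E 1 i * m + E 2 i) = 0 := by
    intro m
    have := sum_mul_aeval_pderiv hF (fun i => (w i).eval m)
    rw [← eval_aeval_mvPolynomial, hF0] at this
    simp only [Polynomial.eval_zero, mul_zero] at this
    rw [← this]
    refine Finset.sum_congr rfl fun i _ => ?_
    rw [mul_comm, congrFun (hwe m) i]
  have h2 : ∀ m : ℂ, ∑ i, E 2 i * aeval (fun i => (w i).eval m) (pderiv i F) =
      m ^ 2 * ∑ i, E 0 i * aeval (fun i => (w i).eval m) (pderiv i F) := by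
    intro m
    have h1 := hd m
    have h2 := he m
    simp only [Fin.sum_univ_three] at h1 h2 ⊢
    linear_combination h2 - m * h1
  have h1 : ∀ m : ℂ, ∑ i, E 1 i * aeval (fun i => (w i).eval m) (pderiv i F) =
      -(2 * m) * ∑ i, E 0 i * aeval (fun i => (w i).eval m) (pderiv i F) := by
    intro m
    have h1 := hd m
    simp only [Fin.sum_univ_three] at h1 ⊢
    linear_combination h1
  obtain ⟨a, ha, hconst⟩ := exists_directional_eq_const hns hE w (fun m => by
    rw [hwe]
    have := combination_ne_zero hE (u := ![m ^ 2, m, 1]) (fun h0 => by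
      have := congrFun h0 2
      simp at this)
    simpa using this) 0 (fun m hm l => by
      fin_cases l
      · exact hm
      · simpa [hm] using h1 m
      · simpa [hm] using h2 m)
  refine ⟨a, ha, fun m => ?_⟩
  have h3 := h2 m
  rw [hconst m] at h3
  have h4 := hconst m
  rw [hwe] at h3 h4
  exact ⟨h4, h3⟩

/-- A smooth plane curve of degree at least three contains no conic. -/
theorem Smooth.not_conic {F : MvPolynomial (Fin 3) ℤ} (hns : Smooth F) {k : ℕ} (hk : 3 ≤ k)
    (hF : F.IsHomogeneous k) {E : Matrix (Fin 3) (Fin 3) ℂ} (hE : E.det ≠ 0)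
    (h : {m : ℂ | aeval (fun i => E 0 i * m ^ 2 + E 1 i * m + E 2 i) F = 0}.Infinite) : False := by
  obtain ⟨a, ha, hconst⟩ := exists_const_of_conic hns hF hE h
  set E' : Matrix (Fin 3) (Fin 3) ℂ := Matrix.of ![E 2, E 1, E 0]
  have hE' : E'.det ≠ 0 := by
    rw [Matrix.det_fin_three] at hE ⊢
    contrapose! hE
    simp [E'] at hE
    linear_combination -hE
  have hrev : ∀ n : ℂ, n ≠ 0 → (fun i => E' 0 i * n ^ 2 + E' 1 i * n + E' 2 i) =
      fun i => n ^ 2 * ((fun i => E 0 i * (n⁻¹) ^ 2 + E 1 i * n⁻¹ + E 2 i) i) := by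
    intro n hn
    ext i
    simp [E']
    field_simp
    ring
  have hzero : aeval (fun i => Polynomial.C (E 0 i) * Polynomial.X ^ 2 +
      Polynomial.C (E 1 i) * Polynomial.X + Polynomial.C (E 2 i)) F = 0 :=
    aeval_polynomial_eq_zero (by simpa using h)
  have hall : ∀ m : ℂ, aeval (fun i => E 0 i * m ^ 2 + E 1 i * m + E 2 i) F = 0 := by
    intro m
    have := congrArg (Polynomial.eval m) hzero
    rw [eval_aeval_mvPolynomial] at this
    simpa using this
  obtain ⟨b, hb, hconst'⟩ := exists_const_of_conic hns hF hE' (infinite_ne_zero_complex.mono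
    fun n hn => by
      rw [Set.mem_ofPred_eq, hrev n hn, aeval_mul_of_isHomogeneous hF, hall, mul_zero])
  have hkey : ∀ n : ℂ, n ≠ 0 → b = (n ^ 2) ^ (k - 1) * ((n⁻¹) ^ 2 * a) := by
    intro n hn
    rw [← (hconst' n).1, ← (hconst n⁻¹).2, hrev n hn, Finset.mul_sum]
    refine Finset.sum_congr rfl fun i _ => ?_
    rw [aeval_mul_of_isHomogeneous hF.pderiv]
    simp [E']
    ring
  have h1 := hkey 1 one_ne_zero
  have h2 := hkey 2 two_ne_zero
  obtain ⟨j, rfl⟩ : ∃ j, k = j + 3 := ⟨k - 3, by omega⟩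
  rw [h1] at h2
  simp only [show j + 3 - 1 = j + 2 by omega] at h2
  have h3 : ((4 : ℂ) ^ (j + 1) - 1) * a = 0 := by
    rw [show (4 : ℂ) = 2 ^ 2 by norm_num]
    ring_nf at h2 ⊢
    linear_combination -h2
  rcases mul_eq_zero.1 h3 with h4 | h4
  · have h5 : (4 : ℕ) ^ (j + 1) = 1 := by
      exact_mod_cast sub_eq_zero.1 h4
    have := Nat.one_lt_pow (Nat.succ_ne_zero j) (show 1 < 4 by norm_num)
    omega
  · exact ha h4

theorem exists_const_of_line {F : MvPolynomial (Fin 3) ℤ} (hns : Smooth F) {k : ℕ}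
    (hF : F.IsHomogeneous k) {E : Matrix (Fin 3) (Fin 3) ℂ} (hE : E.det ≠ 0)
    (h : {m : ℂ | aeval (fun i => E 0 i * m + E 1 i) F = 0}.Infinite) :
    ∃ a : ℂ, a ≠ 0 ∧ ∀ m : ℂ,
      ∑ i, E 2 i * aeval (fun i => E 0 i * m + E 1 i) (pderiv i F) = a := by
  set w : Fin 3 → Polynomial ℂ := fun i => 
    Polynomial.C (E 0 i) * Polynomial.X + Polynomial.C (E 1 i) with hw
  have hwe : ∀ m : ℂ, (fun i => (w i).eval m) = fun i => E 0 i * m + E 1 i := by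
    intro m; ext i; simp [hw]
  have hF0 : aeval w F = 0 := aeval_polynomial_eq_zero (by simpa only [hwe] using h)
  have hd : ∀ m : ℂ, ∑ i, E 0 i * aeval (fun i => (w i).eval m) (pderiv i F) = 0 := by
    intro m
    have := congrArg (Polynomial.eval m) (derivative_aeval_mvPolynomial w F)
    rw [hF0] at this
    simp only [Polynomial.eval_finsetSum, Polynomial.eval_mul, eval_aeval_mvPolynomial] at this
    rw [Polynomial.derivative_zero, Polynomial.eval_zero] at this
    rw [this]
    refine Finset.sum_congr rfl fun i _ => ?_
    rw [mul_comm]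
    congr 1
    simp [hw]
  have he : ∀ m : ℂ, ∑ i, E 1 i * aeval (fun i => (w i).eval m) (pderiv i F) = 0 := by
    intro m
    have h1 := hd m
    have := sum_mul_aeval_pderiv hF (fun i => (w i).eval m)
    rw [← eval_aeval_mvPolynomial, hF0] at this
    simp only [Polynomial.eval_zero, mul_zero] at this
    rw [Finset.sum_congr rfl fun i _ => by rw [congrFun (hwe m) i]] at this
    simp only [Fin.sum_univ_three] at h1 this ⊢
    linear_combination this - m * h1
  obtain ⟨a, ha, hconst⟩ := exists_directional_eq_const hns hE w (fun m => by
    rw [hwe]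
    have := combination_ne_zero hE (u := ![m, 1, 0]) (fun h0 => by
      have := congrFun h0 1
      simp at this)
    simpa using this) 2 (fun m hm l => by
      fin_cases l
      · exact hd m
      · exact he m
      · exact hm)
  exact ⟨a, ha, fun m => by rw [← hconst m, hwe]⟩

/-- A smooth plane curve of degree at least two contains no line. -/
theorem Smooth.not_line {F : MvPolynomial (Fin 3) ℤ} (hns : Smooth F) {k : ℕ} (hk : 2 ≤ k)
    (hF : F.IsHomogeneous k) {E : Matrix (Fin 3) (Fin 3) ℂ} (hE : E.det ≠ 0)
    (h : {m : ℂ | aeval (fun i => E 0 i * m + E 1 i) F = 0}.Infinite) : False := by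
  obtain ⟨a, ha, hconst⟩ := exists_const_of_line hns hF hE h
  set E' : Matrix (Fin 3) (Fin 3) ℂ := Matrix.of ![E 1, E 0, E 2]
  have hE' : E'.det ≠ 0 := by
    rw [Matrix.det_fin_three] at hE ⊢
    contrapose! hE
    simp [E'] at hE
    linear_combination -hE
  have hrev : ∀ n : ℂ, n ≠ 0 → (fun i => E' 0 i * n + E' 1 i) =
      fun i => n * ((fun i => E 0 i * n⁻¹ + E 1 i) i) := by
    intro n hn
    ext i
    simp [E']
    field_simp
    ring
  have hzero : aeval (fun i =>
      Polynomial.C (E 0 i) * Polynomial.X + Polynomial.C (E 1 i)) F = 0 :=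
    aeval_polynomial_eq_zero (by simpa using h)
  have hall : ∀ m : ℂ, aeval (fun i => E 0 i * m + E 1 i) F = 0 := by
    intro m
    have := congrArg (Polynomial.eval m) hzero
    rw [eval_aeval_mvPolynomial] at this
    simpa using this
  obtain ⟨b, hb, hconst'⟩ := exists_const_of_line hns hF hE' (infinite_ne_zero_complex.mono
    fun n hn => by
      rw [Set.mem_ofPred_eq, hrev n hn, aeval_mul_of_isHomogeneous hF, hall, mul_zero])
  have hkey : ∀ n : ℂ, n ≠ 0 → b = n ^ (k - 1) * a := by
    intro n hn
    rw [← hconst' n, ← hconst n⁻¹, hrev n hn, Finset.mul_sum]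
    refine Finset.sum_congr rfl fun i _ => ?_
    rw [aeval_mul_of_isHomogeneous hF.pderiv]
    simp [E']
    ring
  have h1 := hkey 1 one_ne_zero
  have h2 := hkey 2 two_ne_zero
  rw [h1, one_pow] at h2
  have h5 : (2 : ℂ) ^ (k - 1) = 1 := (mul_right_cancel₀ ha h2).symm
  have h6 : (2 : ℕ) ^ (k - 1) = 1 := by exact_mod_cast h5
  have := Nat.one_lt_pow (show k - 1 ≠ 0 by omega) (show 1 < 2 by norm_num)
  omega

open Filter Topology in
/-- The analytic implicit function theorem in the plane: near a zero where the vertical derivative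
does not vanish, the zero set of `G` is a graph and `|G|` is comparable to the vertical distance to
that graph. -/
theorem exists_analyticAt_implicit {G : ℝ × ℝ → ℝ} {x₀ y₀ b : ℝ} (hG : AnalyticAt ℝ G (x₀, y₀))
    (h0 : G (x₀, y₀) = 0) (hb : HasDerivAt (fun y => G (x₀, y)) b y₀) (hb0 : b ≠ 0) :
    ∃ f : ℝ → ℝ, AnalyticAt ℝ f x₀ ∧ f x₀ = y₀ ∧ (∀ᶠ x in 𝓝 x₀, G (x, f x) = 0) ∧
      ∃ C > 0, ∀ᶠ p in 𝓝 (x₀, y₀), |p.2 - f p.1| ≤ C * |G p| ∧ |G p| ≤ C * |p.2 - f p.1| := by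
  have hcd : ContDiffAt ℝ (⊤ : WithTop ℕ∞) G (x₀, y₀) := hG.contDiffAt
  have hn : (⊤ : WithTop ℕ∞) ≠ 0 := by simp
  have hstrict := hcd.hasStrictFDerivAt hn
  set L := fderiv ℝ G (x₀, y₀) with hL
  have hLb : L (0, 1) = b := by
    have h1 : HasDerivAt (fun y : ℝ => (x₀, y)) ((0, 1) : ℝ × ℝ) y₀ :=
      (hasDerivAt_const y₀ x₀).prodMk (hasDerivAt_id y₀)
    exact (hstrict.hasFDerivAt.comp_hasDerivAt y₀ h1).unique hb
  have hLw : ∀ w : ℝ, L (0, w) = b * w := by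
    intro w
    have : ((0, w) : ℝ × ℝ) = w • ((0, 1) : ℝ × ℝ) := by simp
    rw [this, map_smul, hLb, smul_eq_mul, mul_comm]
  have hinv : (L ∘L .inr ℝ ℝ ℝ).IsInvertible := by
    refine ⟨ContinuousLinearEquiv.unitsEquivAut ℝ (Units.mk0 b hb0), ?_⟩
    ext
    simp [hLb]
  set f := hcd.implicitFunction hn hinv with hf
  have hfa : AnalyticAt ℝ f x₀ := (hcd.contDiffAt_implicitFunction hn hinv).analyticAt
  have hfx : f x₀ = y₀ := hcd.implicitFunction_apply_self hn hinv
  have hfe : ∀ᶠ x in 𝓝 x₀, G (x, f x) = 0 := by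
    have := hcd.eventually_apply_implicitFunction hn hinv
    rwa [h0] at this
  refine ⟨f, hfa, hfx, hfe, 2 / |b| + 2 * |b|, by positivity, ?_⟩
  have hbpos : 0 < |b| := abs_pos.2 hb0
  have hlit := hstrict.isLittleO.def (half_pos hbpos)
  have htend : Tendsto (fun p : ℝ × ℝ => (p, (p.1, f p.1))) (𝓝 (x₀, y₀))
      (𝓝 ((x₀, y₀), (x₀, y₀))) := by
    refine tendsto_id.prodMk_nhds (Tendsto.prodMk_nhds (continuous_fst.tendsto _) ?_)
    have h1 : Tendsto f (𝓝 x₀) (𝓝 y₀) := by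
      have := hfa.continuousAt.tendsto
      rwa [hfx] at this
    exact h1.comp (continuous_fst.tendsto (x₀, y₀))
  filter_upwards [htend.eventually hlit, (continuous_fst.tendsto (x₀, y₀)).eventually hfe]
    with p hp hp0
  rw [hp0, sub_zero] at hp
  have hdiff : p - (p.1, f p.1) = (0, p.2 - f p.1) := by
    ext <;> simp
  rw [hdiff, hLw, Real.norm_eq_abs, Prod.norm_def] at hp
  simp only [norm_zero, Real.norm_eq_abs] at hp
  rw [max_eq_right (abs_nonneg _)] at hp
  have h1 : |b| * |p.2 - f p.1| ≤ |G p| + |b| / 2 * |p.2 - f p.1| := by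
    have := abs_sub_abs_le_abs_sub (b * (p.2 - f p.1)) (G p)
    rw [abs_sub_comm, abs_mul] at this
    linarith
  have h2 : |G p| ≤ |b| * |p.2 - f p.1| + |b| / 2 * |p.2 - f p.1| := by
    have := abs_sub_abs_le_abs_sub (G p) (b * (p.2 - f p.1))
    rw [abs_mul] at this
    linarith
  have hw := abs_nonneg (p.2 - f p.1)
  have hGp := abs_nonneg (G p)
  constructor
  · have h3 : |p.2 - f p.1| ≤ 2 / |b| * |G p| := by
      rw [div_mul_eq_mul_div, le_div_iff₀ hbpos]
      nlinarith
    nlinarith [mul_nonneg hbpos.le hGp]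
  · have : 0 ≤ 2 / |b| * |p.2 - f p.1| := by positivity
    nlinarith [mul_nonneg hbpos.le hw]

/-- The dehomogenisation of `F` with respect to the zeroth variable. -/
noncomputable def affinePart (F : MvPolynomial (Fin 3) ℤ) (x y : ℝ) : ℝ := aeval ![1, x, y] F

theorem hasDerivAt_affinePart (F : MvPolynomial (Fin 3) ℤ) {f : ℝ → ℝ} {f' x : ℝ}
    (hf : HasDerivAt f f' x) :
    HasDerivAt (fun t => affinePart F t (f t))
      (affinePart (pderiv 1 F) x (f x) + affinePart (pderiv 2 F) x (f x) * f') x := by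
  have h := hasDerivAt_aeval_mvPolynomial (c := fun t => ![1, t, f t]) (c' := ![0, 1, f']) (t := x)
    (fun i => by
      fin_cases i
      · exact hasDerivAt_const x (1 : ℝ)
      · exact hasDerivAt_id x
      · exact hf) F
  refine h.congr_deriv ?_
  simp [Fin.sum_univ_three, affinePart]

theorem hasDerivAt_affinePart_snd (F : MvPolynomial (Fin 3) ℤ) (x y : ℝ) :
    HasDerivAt (fun y => affinePart F x y) (affinePart (pderiv 2 F) x y) y := by
  have h := hasDerivAt_aeval_mvPolynomial (c := fun y => ![1, x, y]) (c' := ![0, 0, 1]) (t := y)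
    (fun i => by
      fin_cases i
      · exact hasDerivAt_const y (1 : ℝ)
      · exact hasDerivAt_const y x
      · exact hasDerivAt_id y) F
  refine h.congr_deriv ?_
  simp [Fin.sum_univ_three, affinePart]

theorem analyticAt_affinePart (F : MvPolynomial (Fin 3) ℤ) (p : ℝ × ℝ) :
    AnalyticAt ℝ (fun p : ℝ × ℝ => affinePart F p.1 p.2) p := by
  refine AnalyticAt.aeval_mvPolynomial (fun i => ?_) F
  fin_cases i
  · exact analyticAt_const
  · exact analyticAt_fst
  · exact analyticAt_snd

/-- `f` parametrises the affine curve `F(1,x,y) = 0` near `x₀`, transversally to the vertical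
direction. -/
structure IsBranch (F : MvPolynomial (Fin 3) ℤ) (f : ℝ → ℝ) (x₀ : ℝ) : Prop where
  analyticAt : AnalyticAt ℝ f x₀
  eventually_eq_zero : ∀ᶠ x in nhds x₀, affinePart F x (f x) = 0
  pderiv_ne_zero : affinePart (pderiv 2 F) x₀ (f x₀) ≠ 0

theorem exists_isBranch {F : MvPolynomial (Fin 3) ℤ} {x₀ y₀ : ℝ} (h0 : affinePart F x₀ y₀ = 0)
    (h2 : affinePart (pderiv 2 F) x₀ y₀ ≠ 0) :
    ∃ f : ℝ → ℝ, IsBranch F f x₀ ∧ f x₀ = y₀ ∧ ∃ C > 0, ∀ᶠ p in nhds (x₀, y₀),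
      |p.2 - f p.1| ≤ C * |affinePart F p.1 p.2| ∧ |affinePart F p.1 p.2| ≤ C * |p.2 - f p.1| := by
  obtain ⟨f, hf, hfx, hfe, C, hC, hCe⟩ := exists_analyticAt_implicit
    (analyticAt_affinePart F (x₀, y₀)) h0 (hasDerivAt_affinePart_snd F x₀ y₀) h2
  exact ⟨f, ⟨hf, hfe, by rwa [hfx]⟩, hfx, C, hC, hCe⟩

namespace IsBranch

variable {F : MvPolynomial (Fin 3) ℤ} {f : ℝ → ℝ} {x₀ : ℝ}

theorem continuousAt_affinePart (h : IsBranch F f x₀) (P : MvPolynomial (Fin 3) ℤ) :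
    ContinuousAt (fun x => affinePart P x (f x)) x₀ :=
  (hasDerivAt_affinePart P h.analyticAt.differentiableAt.hasDerivAt).continuousAt

theorem eventually (h : IsBranch F f x₀) : ∀ᶠ x in nhds x₀, IsBranch F f x := by
  filter_upwards [h.analyticAt.eventually_analyticAt, h.eventually_eq_zero.eventually_nhds,
    (h.continuousAt_affinePart (pderiv 2 F)).eventually_ne h.pderiv_ne_zero] with x h1 h2 h3
  exact ⟨h1, h2, h3⟩

theorem eq_zero (h : IsBranch F f x₀) : affinePart F x₀ (f x₀) = 0 :=
  h.eventually_eq_zero.self_of_nhds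

theorem deriv_eq (h : IsBranch F f x₀) :
    affinePart (pderiv 1 F) x₀ (f x₀) + affinePart (pderiv 2 F) x₀ (f x₀) * deriv f x₀ = 0 := by
  refine (hasDerivAt_affinePart F h.analyticAt.differentiableAt.hasDerivAt).unique ?_
  exact (hasDerivAt_const x₀ (0 : ℝ)).congr_of_eventuallyEq h.eventually_eq_zero

/-- The bordered Hessian whose zeros on the curve are the inflection points. -/
noncomputable def _root_.inflectionForm (F : MvPolynomial (Fin 3) ℤ) : MvPolynomial (Fin 3) ℤ :=
  pderiv 1 (pderiv 1 F) * pderiv 2 F ^ 2 - 2 * pderiv 1 (pderiv 2 F) * pderiv 1 F * pderiv 2 F +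
    pderiv 2 (pderiv 2 F) * pderiv 1 F ^ 2

theorem affinePart_inflectionForm (h : IsBranch F f x₀) :
    affinePart (inflectionForm F) x₀ (f x₀) =
      -deriv (deriv f) x₀ * affinePart (pderiv 2 F) x₀ (f x₀) ^ 3 := by
  have hd := h.analyticAt.differentiableAt.hasDerivAt
  have hd2 := h.analyticAt.deriv.differentiableAt.hasDerivAt
  have h1 := hasDerivAt_affinePart (pderiv 1 F) hd
  have h2 := (hasDerivAt_affinePart (pderiv 2 F) hd).mul hd2
  have hz := (hasDerivAt_const x₀ (0 : ℝ)).congr_of_eventuallyEq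
    (h.eventually.mono fun x hx => hx.deriv_eq)
  have key := (h1.add h2).unique hz
  have hd0 := h.deriv_eq
  rw [pderiv_comm 2 1] at key
  have hexp : affinePart (inflectionForm F) x₀ (f x₀) =
      affinePart (pderiv 1 (pderiv 1 F)) x₀ (f x₀) * affinePart (pderiv 2 F) x₀ (f x₀) ^ 2 -
      2 * affinePart (pderiv 1 (pderiv 2 F)) x₀ (f x₀) * affinePart (pderiv 1 F) x₀ (f x₀) *
        affinePart (pderiv 2 F) x₀ (f x₀) +
      affinePart (pderiv 2 (pderiv 2 F)) x₀ (f x₀) * affinePart (pderiv 1 F) x₀ (f x₀) ^ 2 := by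
    simp [affinePart, inflectionForm]
  rw [hexp]
  generalize affinePart (pderiv 1 (pderiv 1 F)) x₀ (f x₀) = a11 at *
  generalize affinePart (pderiv 1 (pderiv 2 F)) x₀ (f x₀) = a12 at *
  generalize affinePart (pderiv 2 (pderiv 2 F)) x₀ (f x₀) = a22 at *
  generalize affinePart (pderiv 2 F) x₀ (f x₀) = a2 at *
  have ha1 : affinePart (pderiv 1 F) x₀ (f x₀) = -(a2 * deriv f x₀) := by linarith
  rw [ha1]
  linear_combination a2 ^ 2 * key

end IsBranch

theorem eventually_abs_sub_taylor_le {f : ℝ → ℝ} {x₀ R : ℝ} (hf : AnalyticAt ℝ f x₀) (n : ℕ)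
    (hR : ∀ᶠ x in nhds x₀, |deriv^[n] f x| ≤ R) :
    ∀ᶠ x in nhds x₀, |f x - ∑ j ∈ Finset.range n,
      deriv^[j] f x₀ * (x - x₀) ^ j / (j.factorial : ℝ)| ≤ R * |x - x₀| ^ n := by
  obtain ⟨η, hη, h⟩ := Metric.eventually_nhds_iff_ball.1 (hf.eventually_analyticAt.and hR)
  have hsub : ∀ x ∈ Set.Icc (x₀ - η / 2) (x₀ + η / 2), x ∈ Metric.ball x₀ η := by
    intro x hx
    rw [Metric.mem_ball, Real.dist_eq, abs_lt]
    constructor <;> linarith [hx.1, hx.2]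
  filter_upwards [Icc_mem_nhds (show x₀ - η / 2 < x₀ by linarith)
    (show x₀ < x₀ + η / 2 by linarith)] with x hx
  refine abs_sub_taylor_le (D := fun j => deriv^[j] f) n (fun j y hy => ?_)
    (fun y hy => (h y (hsub y hy)).2) ⟨by linarith, by linarith⟩ hx
  have h1 := (h y (hsub y hy)).1
  simp only [Function.iterate_succ_apply']
  exact (h1.iterated_deriv j).differentiableAt.hasDerivAt

theorem aeval_ofReal_comp (F : MvPolynomial (Fin 3) ℤ) (v : Fin 3 → ℝ) :
    aeval (fun i => ((v i : ℝ) : ℂ)) F = ((aeval v F : ℝ) : ℂ) :=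
  aeval_algebraMap_apply ℂ v F

theorem infinite_of_frequently_nhdsNE {X : Type*} [TopologicalSpace X] [T1Space X] {S : Set X}
    {a : X} (h : ∃ᶠ x in nhdsWithin a {a}ᶜ, x ∈ S) : S.Infinite := by
  intro hS
  refine h ?_
  have h1 : (S \ {a})ᶜ ∈ nhds a := (hS.subset Set.sdiff_subset).isClosed.compl_mem_nhds (by simp)
  filter_upwards [nhdsWithin_le_nhds h1, self_mem_nhdsWithin] with x hx hxa hxS
  exact hx ⟨hxS, hxa⟩

theorem X_pow_dvd_of_norm_eval_le {Q : Polynomial ℂ} {C : ℝ} (n : ℕ)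
    (h : ∀ᶠ t : ℝ in nhdsWithin 0 {0}ᶜ, ‖Q.eval (t : ℂ)‖ ≤ C * |t| ^ n) :
    Polynomial.X ^ n ∣ Q := by
  induction n generalizing Q with
  | zero => simp
  | succ n ih =>
    have htend : Filter.Tendsto (fun t : ℝ => ‖Q.eval (t : ℂ)‖) (nhdsWithin 0 {0}ᶜ)
        (nhds ‖Q.eval 0‖) := by
      have hc : Continuous fun t : ℝ => ‖Q.eval (t : ℂ)‖ := by fun_prop
      simpa using (hc.tendsto 0).mono_left nhdsWithin_le_nhds
    have htend2 : Filter.Tendsto (fun t : ℝ => C * |t| ^ (n + 1)) (nhdsWithin 0 {0}ᶜ)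
        (nhds 0) := by
      have hc : Continuous fun t : ℝ => C * |t| ^ (n + 1) := by fun_prop
      simpa using (hc.tendsto 0).mono_left nhdsWithin_le_nhds
    have h0 : Q.eval 0 = 0 := norm_le_zero_iff.1 (le_of_tendsto_of_tendsto htend htend2 h)
    obtain ⟨Q', rfl⟩ : Polynomial.X ∣ Q := Polynomial.X_dvd_iff.2 (by
      rwa [Polynomial.coeff_zero_eq_eval_zero])
    rw [pow_succ']
    refine mul_dvd_mul_left _ (ih ?_)
    filter_upwards [h, self_mem_nhdsWithin] with t ht ht0
    have htpos : 0 < |t| := abs_pos.2 ht0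
    rw [Polynomial.eval_mul, Polynomial.eval_X, norm_mul, Complex.norm_real, Real.norm_eq_abs,
      pow_succ] at ht
    nlinarith

namespace IsBranch

variable {F : MvPolynomial (Fin 3) ℤ} {f : ℝ → ℝ} {x₀ : ℝ} {k : ℕ}

theorem _root_.finite_zeros_on_line (hns : Smooth F) (hk : 2 ≤ k)
    (hF : F.IsHomogeneous k) (x₀ y₀ θ : ℝ) :
    {t : ℝ | affinePart F (x₀ + t) (y₀ + θ * t) = 0}.Finite := by
  by_contra hinf
  refine hns.not_line hk hF
    (E := Matrix.of ![![0, 1, (θ : ℂ)], ![1, (x₀ : ℂ), (y₀ : ℂ)], ![0, 0, 1]])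
    (by rw [Matrix.det_fin_three]; simp) ?_
  refine ((Set.Infinite.image Complex.ofReal_injective.injOn hinf)).mono ?_
  rintro _ ⟨t, ht, rfl⟩
  rw [Set.mem_ofPred_eq] at ht ⊢
  rw [affinePart] at ht
  have := aeval_ofReal_comp F ![1, x₀ + t, y₀ + θ * t]
  rw [ht, Complex.ofReal_zero] at this
  refine Eq.trans ?_ this
  congr 2
  ext i
  fin_cases i
  · simp
  · simp [add_comm]
  · simp [add_comm]

theorem not_eventually_deriv_deriv_eq_zero (hns : Smooth F) (hk : 2 ≤ k) (hF : F.IsHomogeneous k)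
    (h : IsBranch F f x₀) : ¬ ∀ᶠ x in nhds x₀, deriv (deriv f) x = 0 := by
  intro h2
  have htaylor := eventually_abs_sub_taylor_le (R := 0) h.analyticAt 2 (h2.mono fun x hx => by
    simp only [Function.iterate_succ, Function.iterate_zero, Function.comp_apply, id]
    simp [hx])
  refine infinite_of_frequently_nhdsNE (a := (0 : ℝ)) ?_
    (finite_zeros_on_line hns hk hF x₀ (f x₀) (deriv f x₀))
  refine Filter.Eventually.frequently (nhdsWithin_le_nhds ?_)
  have htend : Filter.Tendsto (fun t : ℝ => x₀ + t) (nhds 0) (nhds x₀) := by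
    simpa using (continuous_const_add x₀).tendsto 0
  filter_upwards [htend.eventually htaylor, htend.eventually h.eventually_eq_zero] with t ht ht0
  rw [Finset.sum_range_succ, Finset.sum_range_one, zero_mul, abs_nonpos_iff, sub_eq_zero] at ht
  convert ht0 using 1
  rw [ht]
  simp

/-- At an inflection point of the branch, the tangent line is an inflectional tangent. -/
theorem isInflTangent (hns : Smooth F) (hk : 2 ≤ k) (hF : F.IsHomogeneous k)
    (h : IsBranch F f x₀) {C : ℝ} (hC : 0 ≤ C)
    (hup : ∀ᶠ p in nhds (x₀, f x₀), |affinePart F p.1 p.2| ≤ C * |p.2 - f p.1|)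
    (hflex : deriv (deriv f) x₀ = 0) :
    IsInflTangent F ![1, (x₀ : ℂ), (f x₀ : ℂ)] ![0, 1, ((deriv f x₀ : ℝ) : ℂ)] := by
  have hp : ∀ P : MvPolynomial (Fin 3) ℤ, aeval ![1, (x₀ : ℂ), (f x₀ : ℂ)] P =
      ((affinePart P x₀ (f x₀) : ℝ) : ℂ) := by
    intro P
    rw [affinePart, ← aeval_ofReal_comp]
    congr 2
    ext i
    fin_cases i <;> simp
  refine ⟨fun h0 => by simpa using congrFun h0 0, by rw [hp, h.eq_zero, Complex.ofReal_zero],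
    fun c hc => ?_, ?_, ?_⟩
  · have h0 := congrFun hc 0
    have h1 := congrFun hc 1
    simp at h0
    simp [← h0] at h1
  · have := h.deriv_eq
    simp only [Fin.sum_univ_three, hp]
    simp only [Matrix.cons_val_zero, Matrix.cons_val_one, Matrix.cons_val, zero_mul, zero_add,
      one_mul]
    exact_mod_cast (by linarith : affinePart (pderiv 1 F) x₀ (f x₀) +
      deriv f x₀ * affinePart (pderiv 2 F) x₀ (f x₀) = 0)
  · rw [contactOrder]
    set Q : Polynomial ℂ := aeval (fun i =>
      Polynomial.C ((![1, (x₀ : ℂ), (f x₀ : ℂ)] : Fin 3 → ℂ) i)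
      + Polynomial.C ((![0, 1, ((deriv f x₀ : ℝ) : ℂ)] : Fin 3 → ℂ) i) * Polynomial.X) F with hQ
    have hQe : ∀ t : ℝ, Q.eval (t : ℂ) =
        ((affinePart F (x₀ + t) (f x₀ + deriv f x₀ * t) : ℝ) : ℂ) := by
      intro t
      rw [hQ, eval_aeval_mvPolynomial, affinePart, ← aeval_ofReal_comp]
      congr 2
      ext i
      fin_cases i <;> simp
    have hQ0 : Q ≠ 0 := by
      intro h0
      have hfin := finite_zeros_on_line hns hk hF x₀ (f x₀) (deriv f x₀)
      refine Set.infinite_univ (hfin.subset fun t _ => ?_)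
      have := hQe t
      rw [h0, Polynomial.eval_zero] at this
      exact_mod_cast this.symm
    rw [Polynomial.le_rootMultiplicity_iff hQ0, Polynomial.C_0, sub_zero]
    set R : ℝ := |deriv^[3] f x₀| + 1
    have hR : ∀ᶠ x in nhds x₀, |deriv^[3] f x| ≤ R :=
      ((h.analyticAt.iterated_deriv 3).continuousAt.abs.eventually_lt_const
        (lt_add_one _)).mono fun x hx => hx.le
    have htaylor := eventually_abs_sub_taylor_le h.analyticAt 3 hR
    refine X_pow_dvd_of_norm_eval_le (C := C * R) 3 (nhdsWithin_le_nhds ?_)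
    have htend : Filter.Tendsto (fun t : ℝ => x₀ + t) (nhds 0) (nhds x₀) := by
      simpa using (continuous_const_add x₀).tendsto 0
    have htend2 : Filter.Tendsto (fun t : ℝ => (x₀ + t, f x₀ + deriv f x₀ * t)) (nhds 0)
        (nhds (x₀, f x₀)) := by
      have hc : Continuous fun t : ℝ => (x₀ + t, f x₀ + deriv f x₀ * t) := by fun_prop
      simpa using hc.tendsto 0
    filter_upwards [htend.eventually htaylor, htend2.eventually hup] with t ht ht2
    rw [hQe, Complex.norm_real, Real.norm_eq_abs]
    refine ht2.trans ?_
    rw [mul_assoc]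
    refine mul_le_mul_of_nonneg_left ?_ hC
    rw [Finset.sum_range_succ, Finset.sum_range_succ, Finset.sum_range_one] at ht
    simp only [Function.iterate_succ, Function.iterate_zero, Function.comp_apply, id, hflex] at ht
    rw [abs_sub_comm]
    simpa using ht

theorem _root_.onInflTangent_of_ordi_eq {x₀ y₀ θ : ℝ}
    (h : IsInflTangent F ![1, (x₀ : ℂ), (y₀ : ℂ)] ![0, 1, (θ : ℂ)]) {v : Fin 3 → ℤ}
    (hv : (v 0 : ℝ) ≠ 0) (hl : ordi v = θ * absc v + (y₀ - θ * x₀)) : OnInflTangent F v := by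
  refine ⟨_, _, h, ?_⟩
  rw [Submodule.mem_span_pair]
  refine ⟨((v 0 : ℝ) : ℂ), ((v 1 - x₀ * v 0 : ℝ) : ℂ), ?_⟩
  rw [ordi, absc] at hl
  field_simp at hl
  have h2 : (v 2 : ℝ) = v 0 * y₀ + (v 1 - x₀ * v 0) * θ := by linear_combination hl
  have h2' : (v 2 : ℂ) = v 0 * y₀ + (v 1 - x₀ * v 0) * θ := by exact_mod_cast h2
  ext i
  fin_cases i
  · simp
  · simp; ring
  · simp [h2']

end IsBranch

theorem eq_zero_of_conicShift_eq_zero {q : Fin 6 → ℝ} {a y₀ θ : ℝ}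
    (h : ∀ i, conicShift q a y₀ θ i = 0) : q = 0 := by
  set R := 1 + |a| + |y₀| + |θ|
  have h1 := abs_nonneg a
  have h2 := abs_nonneg y₀
  have h3 := abs_nonneg θ
  have := abs_le_of_conicShift q (R := R) (N := 0) (a := a) (y₀ := y₀) (θ := θ) (by linarith)
    (by linarith) (by linarith)
    (by linarith) (fun i => by rw [h i, abs_zero])
  ext i
  simpa using this i

namespace IsBranch

variable {F : MvPolynomial (Fin 3) ℤ} {f : ℝ → ℝ} {x₀ : ℝ} {k : ℕ}

open Filter Topology in
/-- The quotient of the deviation from the tangent line by the square of the abscissa. -/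
theorem _root_.tendsto_tangent_deviation (hf : AnalyticAt ℝ f x₀) :
    Tendsto (fun t => (f (x₀ + t) - f x₀ - deriv f x₀ * t) / t ^ 2) (𝓝[≠] 0)
      (𝓝 (deriv (deriv f) x₀ / 2)) := by
  set R : ℝ := |deriv^[3] f x₀| + 1
  have hR : ∀ᶠ x in nhds x₀, |deriv^[3] f x| ≤ R :=
    ((hf.iterated_deriv 3).continuousAt.abs.eventually_lt_const
      (lt_add_one _)).mono fun x hx => hx.le
  have htaylor := eventually_abs_sub_taylor_le hf 3 hR
  have htend : Tendsto (fun t : ℝ => x₀ + t) (𝓝[≠] 0) (𝓝 x₀) := by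
    have := (continuous_const_add x₀).tendsto 0
    rw [add_zero] at this
    exact this.mono_left nhdsWithin_le_nhds
  have hlim : Tendsto (fun t : ℝ => R * |t|) (𝓝[≠] 0) (𝓝 0) := by
    have hc : Continuous fun t : ℝ => R * |t| := by fun_prop
    simpa using (hc.tendsto 0).mono_left nhdsWithin_le_nhds
  rw [tendsto_iff_norm_sub_tendsto_zero]
  refine squeeze_zero' (Eventually.of_forall fun t => norm_nonneg _) ?_ hlim
  filter_upwards [htend.eventually htaylor, self_mem_nhdsWithin] with t ht ht0
  have ht0' : t ≠ 0 := ht0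
  have htpos : 0 < |t| := abs_pos.2 ht0
  rw [Finset.sum_range_succ, Finset.sum_range_succ, Finset.sum_range_one] at ht
  simp only [Function.iterate_succ, Function.iterate_zero, Function.comp_apply, id,
    add_sub_cancel_left, pow_zero, Nat.factorial, mul_one, Nat.cast_one, div_one, pow_one] at ht
  rw [Real.norm_eq_abs]
  have h1 : (f (x₀ + t) - f x₀ - deriv f x₀ * t) / t ^ 2 - deriv (deriv f) x₀ / 2 =
      (f (x₀ + t) - (f x₀ + deriv f x₀ * t + deriv (deriv f) x₀ * t ^ 2 / 2)) / t ^ 2 := by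
    field_simp
    ring
  rw [h1, abs_div, abs_pow, div_le_iff₀ (by positivity)]
  refine le_trans (by simpa using ht) (le_of_eq (by ring))

open Filter Topology in
theorem conic_coeff_eq_zero (hns : Smooth F) (hk : 3 ≤ k) (hF : F.IsHomogeneous k)
    (h : IsBranch F f x₀) (hf2 : deriv (deriv f) x₀ ≠ 0) {q : Fin 6 → ℝ}
    (hq : ∀ᶠ x in nhds x₀, conic q x (f x) = 0) : q = 0 := by
  obtain ⟨A, hA⟩ : ∃ A, A = conicShift q x₀ (f x₀) (deriv f x₀) := ⟨_, rfl⟩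
  set r : ℝ → ℝ := fun t => (f (x₀ + t) - f x₀ - deriv f x₀ * t) / t ^ 2 with hr
  set r₂ := deriv (deriv f) x₀ / 2 with hr₂
  have hr₂0 : r₂ ≠ 0 := by positivity
  have hrl : Tendsto r (𝓝[≠] 0) (𝓝 r₂) := tendsto_tangent_deviation h.analyticAt
  have ht : Tendsto (fun t : ℝ => t) (𝓝[≠] 0) (𝓝 0) := nhdsWithin_le_nhds
  have hx : Tendsto (fun t : ℝ => x₀ + t) (𝓝[≠] 0) (𝓝 x₀) := by
    simpa using ht.const_add x₀
  have hfr : ∀ t : ℝ, t ≠ 0 → f (x₀ + t) = f x₀ + deriv f x₀ * t + r t * t ^ 2 := by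
    intro t ht0
    simp only [hr]
    field_simp
    ring
  have heq : ∀ᶠ t in 𝓝[≠] 0, A 0 + A 1 * t + A 2 * t ^ 2 + A 3 * (r t * t ^ 2) +
      A 4 * (t * (r t * t ^ 2)) + A 5 * (r t * t ^ 2) ^ 2 = 0 := by
    filter_upwards [hx.eventually hq, self_mem_nhdsWithin] with t ht1 ht0
    rw [hfr t ht0, conic_shift, ← hA] at ht1
    exact ht1
  have lim0 : A 0 = 0 := by
    have hl := (((((ht.const_mul (A 1)).const_add (A 0)).add ((ht.pow 2).const_mul (A 2))).add
      ((hrl.mul (ht.pow 2)).const_mul (A 3))).add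
      ((ht.mul (hrl.mul (ht.pow 2))).const_mul (A 4))).add
      (((hrl.mul (ht.pow 2)).pow 2).const_mul (A 5))
    have := tendsto_nhds_unique (hl.congr' heq) tendsto_const_nhds
    simpa using this
  have heq1 : ∀ᶠ t in 𝓝[≠] 0, A 1 + A 2 * t + A 3 * (r t * t) +
      A 4 * (r t * t ^ 2) + A 5 * (r t ^ 2 * t ^ 3) = 0 := by
    filter_upwards [heq, self_mem_nhdsWithin] with t ht1 ht0
    refine (mul_eq_zero.1 (?_ : t * _ = 0)).resolve_left ht0
    rw [lim0] at ht1
    linear_combination ht1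
  have lim1 : A 1 = 0 := by
    have hl := ((((ht.const_mul (A 2)).const_add (A 1)).add
      ((hrl.mul ht).const_mul (A 3))).add
      ((hrl.mul (ht.pow 2)).const_mul (A 4))).add
      (((hrl.pow 2).mul (ht.pow 3)).const_mul (A 5))
    have := tendsto_nhds_unique (hl.congr' heq1) tendsto_const_nhds
    simpa using this
  have heq2 : ∀ᶠ t in 𝓝[≠] 0, A 2 + A 3 * r t + A 4 * (r t * t) + A 5 * (r t ^ 2 * t ^ 2) = 0 := by
    filter_upwards [heq1, self_mem_nhdsWithin] with t ht1 ht0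
    refine (mul_eq_zero.1 (?_ : t * _ = 0)).resolve_left ht0
    rw [lim1] at ht1
    linear_combination ht1
  have lim2 : A 2 + A 3 * r₂ = 0 := by
    have hl := (((hrl.const_mul (A 3)).const_add (A 2)).add ((hrl.mul ht).const_mul (A 4))).add
      (((hrl.pow 2).mul (ht.pow 2)).const_mul (A 5))
    have := tendsto_nhds_unique (hl.congr' heq2) tendsto_const_nhds
    simpa using this
  have hrne : ∀ᶠ t in 𝓝[≠] (0 : ℝ), r t ≠ 0 := hrl.eventually_ne hr₂0
  by_cases hA3 : A 3 = 0
  · have hA2 : A 2 = 0 := by simpa [hA3] using lim2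
    have heq4 : ∀ᶠ t in 𝓝[≠] 0, A 4 + A 5 * (r t * t) = 0 := by
      filter_upwards [heq2, hrne, self_mem_nhdsWithin] with t ht1 hrt ht0
      refine (mul_eq_zero.1 (?_ : (r t * t) * _ = 0)).resolve_left (mul_ne_zero hrt ht0)
      rw [hA2, hA3] at ht1
      linear_combination ht1
    have hA4 : A 4 = 0 := by
      have hl := ((hrl.mul ht).const_mul (A 5)).const_add (A 4)
      have := tendsto_nhds_unique (hl.congr' heq4) tendsto_const_nhds
      simpa using this
    have hA5 : A 5 = 0 := by
      obtain ⟨t, ht1, hrt, ht0⟩ := (heq4.and (hrne.and self_mem_nhdsWithin)).exists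
      rw [hA4, zero_add] at ht1
      exact (mul_eq_zero.1 ht1).resolve_right (mul_ne_zero hrt ht0)
    refine eq_zero_of_conicShift_eq_zero (a := x₀) (y₀ := f x₀) (θ := deriv f x₀) fun i => ?_
    rw [← hA]
    fin_cases i
    exacts [lim0, lim1, hA2, hA3, hA4, hA5]
  · exfalso
    have hA2 : A 2 ≠ 0 := fun h0 => by
      rw [h0, zero_add] at lim2
      exact mul_ne_zero hA3 hr₂0 lim2
    set e₀ : Fin 3 → ℝ := ![1, x₀, f x₀]
    set e₁ : Fin 3 → ℝ := ![0, 1, deriv f x₀]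
    set e₂ : Fin 3 → ℝ := ![0, 0, 1]
    set M : Fin 3 → Fin 3 → ℝ := ![fun i => A 5 * e₀ i - A 3 * e₂ i,
      fun i => A 4 * e₀ i - A 3 * e₁ i, fun i => A 2 * e₀ i] with hM
    have hroot : ∀ᶠ t in 𝓝[≠] 0,
        aeval (fun i => M 0 i * (r t * t) ^ 2 + M 1 i * (r t * t) + M 2 i) F = 0 := by
      filter_upwards [heq2, hx.eventually h.eventually_eq_zero,
      self_mem_nhdsWithin] with t ht1 ht2 ht0
      have hpt : (fun i => M 0 i * (r t * t) ^ 2 + M 1 i * (r t * t) + M 2 i) = fun i =>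
          (A 2 + A 4 * (r t * t) + A 5 * (r t * t) ^ 2) *
            (![1, x₀ + t, f (x₀ + t)] : Fin 3 → ℝ) i := by
        rw [hfr t ht0]
        ext i
        fin_cases i
        · simp [hM, e₀, e₁, e₂]
          ring
        · simp [hM, e₀, e₁, e₂]
          linear_combination (-t) * ht1
        · simp [hM, e₀, e₁, e₂]
          linear_combination (-(deriv f x₀ * t + r t * t ^ 2)) * ht1
      rw [hpt, aeval_mul_of_isHomogeneous hF]
      rw [affinePart] at ht2
      rw [ht2, mul_zero]
    refine hns.not_conic hk hF (E := Matrix.of fun j i => (M j i : ℂ)) ?_ ?_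
    · rw [Matrix.det_fin_three]
      simp only [Matrix.of_apply]
      norm_cast
      simp [hM, e₀, e₁, e₂]
      intro h0
      have : A 2 * A 3 ^ 2 = 0 := by linear_combination -h0
      exact mul_ne_zero hA2 (pow_ne_zero 2 hA3) this
    · have hinf : {m : ℝ | aeval (fun i => M 0 i * m ^ 2 + M 1 i * m + M 2 i) F = 0}.Infinite := by
        refine infinite_of_frequently_nhdsNE (a := (0 : ℝ)) ?_
        have hm : Tendsto (fun t => r t * t) (𝓝[≠] 0) (𝓝[≠] 0) := by
          refine tendsto_nhdsWithin_iff.2 ⟨by simpa using hrl.mul ht, ?_⟩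
          filter_upwards [hrne, self_mem_nhdsWithin] with t h1 h2
          exact mul_ne_zero h1 h2
        exact hm.frequently hroot.frequently
      refine (hinf.image Complex.ofReal_injective.injOn).mono ?_
      rintro _ ⟨m, hm, rfl⟩
      rw [Set.mem_ofPred_eq] at hm ⊢
      have := aeval_ofReal_comp F (fun i => M 0 i * m ^ 2 + M 1 i * m + M 2 i)
      rw [hm, Complex.ofReal_zero] at this
      refine Eq.trans ?_ this
      congr 2
      ext i
      simp

theorem not_eventually_conic (hns : Smooth F) (hk : 3 ≤ k) (hF : F.IsHomogeneous k)
    (h : IsBranch F f x₀) {q : Fin 6 → ℤ} (hq : q ≠ 0) :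
    ¬ ∀ᶠ x in nhds x₀, conic (fun i => (q i : ℝ)) x (f x) = 0 := by
  intro hcon
  obtain ⟨x, hx, hb, hc⟩ := ((Filter.not_eventually.1
    (h.not_eventually_deriv_deriv_eq_zero hns (by omega) hF)).and_eventually
    (h.eventually.and hcon.eventually_nhds)).exists
  have := hb.conic_coeff_eq_zero hns hk hF hx hc
  refine hq (funext fun i => ?_)
  have hi : (q i : ℝ) = 0 := congrFun this i
  exact_mod_cast hi

end IsBranch

section Algebraic

/-- Evaluation of a bivariate integral polynomial at a real point. -/
noncomputable def evalPair (x y : ℝ) : Polynomial (Polynomial ℤ) →+* ℝ :=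
  Polynomial.eval₂RingHom (Polynomial.aeval x : Polynomial ℤ →ₐ[ℤ] ℝ).toRingHom y

theorem evalPair_C (x y : ℝ) (r : Polynomial ℤ) :
    evalPair x y (Polynomial.C r) = Polynomial.aeval x r := by
  simp [evalPair]

/-- The dehomogenisation of a ternary form as a bivariate polynomial. -/
noncomputable def affinePoly (P : MvPolynomial (Fin 3) ℤ) : Polynomial (Polynomial ℤ) :=
  aeval ![1, Polynomial.C Polynomial.X, Polynomial.X] P

theorem evalPair_affinePoly (x y : ℝ) (P : MvPolynomial (Fin 3) ℤ) :
    evalPair x y (affinePoly P) = affinePart P x y := by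
  have h := comp_aeval_apply ![1, Polynomial.C Polynomial.X, Polynomial.X]
    (evalPair x y).toIntAlgHom P
  refine h.trans ?_
  rw [affinePart]
  congr 2
  ext i
  fin_cases i <;> simp [evalPair]

theorem analyticAt_evalPair {f : ℝ → ℝ} {x₀ : ℝ} (hf : AnalyticAt ℝ f x₀)
    (P : Polynomial (Polynomial ℤ)) : AnalyticAt ℝ (fun x => evalPair x (f x) P) x₀ := by
  induction P using Polynomial.induction_on' with
  | add p q hp hq => simpa using hp.fun_add hq
  | monomial n r =>
    have h : (fun x => evalPair x (f x) (Polynomial.monomial n r)) =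
        fun x => Polynomial.aeval x r * f x ^ n := by
      ext x
      simp [evalPair]
    rw [h]
    exact (analyticAt_id.aeval_polynomial r).mul (hf.pow n)

/-- The ideal of bivariate polynomials vanishing on the germ of the graph of `f`. -/
noncomputable def germIdeal (f : ℝ → ℝ) (x₀ : ℝ) : Ideal (Polynomial (Polynomial ℤ)) where
  carrier := {P | ∀ᶠ x in nhds x₀, evalPair x (f x) P = 0}
  add_mem' := fun {P Q} hP hQ => by
    filter_upwards [hP, hQ] with x h1 h2
    rw [map_add, h1, h2, add_zero]
  zero_mem' := Filter.Eventually.of_forall fun x => map_zero _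
  smul_mem' := fun c P hP => by
    filter_upwards [hP] with x h1
    rw [smul_eq_mul, map_mul, h1, mul_zero]

theorem mem_germIdeal {f : ℝ → ℝ} {x₀ : ℝ} {P : Polynomial (Polynomial ℤ)} :
    P ∈ germIdeal f x₀ ↔ ∀ᶠ x in nhds x₀, evalPair x (f x) P = 0 := Iff.rfl

theorem isPrime_germIdeal {f : ℝ → ℝ} {x₀ : ℝ} (hf : AnalyticAt ℝ f x₀) :
    (germIdeal f x₀).IsPrime := by
  refine Ideal.isPrime_iff.2 ⟨fun h => ?_, fun {P Q} hPQ => ?_⟩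
  · have h1 := (mem_germIdeal.1 ((Ideal.eq_top_iff_one _).1 h)).self_of_nhds
    rw [map_one] at h1
    exact one_ne_zero h1
  · rcases (analyticAt_evalPair hf P).eventually_eq_zero_or_eventually_ne_zero with h | h
    · exact Or.inl h
    rcases (analyticAt_evalPair hf Q).eventually_eq_zero_or_eventually_ne_zero with h' | h'
    · exact Or.inr h'
    exfalso
    obtain ⟨x, h1, h2, h3⟩ := (h.and (h'.and (nhdsWithin_le_nhds hPQ))).exists
    rw [map_mul] at h3
    exact mul_ne_zero h1 h2 h3

theorem exists_algebraMap_eq_mul {R S : Type*} [CommRing R] [IsDomain R] [CommRing S] [IsDomain S]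
    [Algebra R S] (π : Polynomial R →ₐ[R] S) {G W : Polynomial R} (hG0 : G ≠ 0) (hG : π G = 0)
    (hW : π W ≠ 0) : ∃ r : R, r ≠ 0 ∧ ∃ s, algebraMap R S r = π W * s := by
  have hY : IsAlgebraic R (π Polynomial.X) := by
    refine ⟨G, hG0, ?_⟩
    rw [Polynomial.aeval_algHom_apply, Polynomial.aeval_X_left_apply, hG]
  have hall : ∀ P : Polynomial R, IsAlgebraic R (π P) := by
    intro P
    induction P using Polynomial.induction_on' with
    | add p q hp hq => rw [map_add]; exact hp.add hq
    | monomial n r =>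
      rw [← Polynomial.C_mul_X_pow_eq_monomial, map_mul, map_pow, ← Polynomial.algebraMap_eq,
        AlgHom.commutes]
      exact (isAlgebraic_algebraMap r).mul (hY.pow n)
  obtain ⟨r, hr0, s, hs⟩ := (hall W).exists_nonzero_dvd (mem_nonZeroDivisors_of_ne_zero hW)
  exact ⟨r, hr0, s, hs⟩

/-- If an algebraic germ `f` is annihilated at `x₀`, but not identically, by some polynomial, then
`x₀` is algebraic. -/
theorem isAlgebraic_of_evalPair_eq_zero {f : ℝ → ℝ} {x₀ : ℝ} (hf : AnalyticAt ℝ f x₀)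
    {G W : Polynomial (Polynomial ℤ)} (hG0 : G ≠ 0) (hG : G ∈ germIdeal f x₀)
    (hW : W ∉ germIdeal f x₀) (hW0 : evalPair x₀ (f x₀) W = 0) : IsAlgebraic ℤ x₀ := by
  have := isPrime_germIdeal hf
  have hπW : Ideal.Quotient.mk (germIdeal f x₀) W ≠ 0 := mt Ideal.Quotient.eq_zero_iff_mem.1 hW
  obtain ⟨r, hr0, s, hs⟩ := exists_algebraMap_eq_mul (R := Polynomial ℤ)
    (S := Polynomial (Polynomial ℤ) ⧸ germIdeal f x₀)
    (Ideal.Quotient.mkₐ (Polynomial ℤ) (germIdeal f x₀)) (W := W) hG0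
    (Ideal.Quotient.eq_zero_iff_mem.2 hG) hπW
  obtain ⟨Q, rfl⟩ := Ideal.Quotient.mk_surjective s
  have hmem : Polynomial.C r - W * Q ∈ germIdeal f x₀ := by
    rw [← Ideal.Quotient.mk_eq_mk_iff_sub_mem, map_mul]
    exact hs
  have h0 := (mem_germIdeal.1 hmem).self_of_nhds
  rw [map_sub, map_mul, hW0, zero_mul, sub_zero, evalPair_C] at h0
  exact ⟨r, hr0, h0⟩

theorem isAlgebraic_affinePart {x y : ℝ} (hx : IsAlgebraic ℤ x) (hy : IsAlgebraic ℤ y)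
    (P : MvPolynomial (Fin 3) ℤ) : IsAlgebraic ℤ (affinePart P x y) := by
  rw [affinePart]
  induction P using MvPolynomial.induction_on with
  | C a => rw [aeval_C]; exact isAlgebraic_algebraMap a
  | add p q hp hq => rw [map_add]; exact hp.add hq
  | mul_X p i hp =>
    rw [map_mul, aeval_X]
    refine hp.mul ?_
    fin_cases i
    · exact isAlgebraic_one
    · exact hx
    · exact hy

open scoped Algebra in
theorem isAlgebraic_of_affinePart_eq_zero {P : MvPolynomial (Fin 3) ℤ} {x y : ℝ}
    (hx : IsAlgebraic ℤ x) (h0 : affinePart P x y = 0)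
    (h2 : affinePart (pderiv 2 P) x y ≠ 0) : IsAlgebraic ℤ y := by
  have : Algebra.IsAlgebraic ℤ (Algebra.adjoin ℤ {x}) :=
    (Subalgebra.isAlgebraic_iff _).1 (Algebra.isAlgebraic_adjoin_singleton_iff.2 hx)
  set x' : Algebra.adjoin ℤ {x} := ⟨x, Algebra.self_mem_adjoin_singleton ℤ x⟩
  set φ : Polynomial ℤ →+* Algebra.adjoin ℤ {x} :=
    (Polynomial.aeval x' : Polynomial ℤ →ₐ[ℤ] Algebra.adjoin ℤ {x}).toRingHom
  have heval : ∀ z : ℝ, Polynomial.aeval z ((affinePoly P).map φ) = affinePart P x z := by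
    intro z
    rw [← evalPair_affinePoly, evalPair, Polynomial.aeval_def, Polynomial.eval₂_map]
    congr 1
    refine Polynomial.ringHom_ext' (Subsingleton.elim _ _) ?_
    change algebraMap _ ℝ (Polynomial.aeval x' Polynomial.X) = Polynomial.aeval x Polynomial.X
    rw [Polynomial.aeval_X, Polynomial.aeval_X]
    rfl
  refine IsAlgebraic.restrictScalars ℤ (S := Algebra.adjoin ℤ {x})
    ⟨(affinePoly P).map φ, fun hz => h2 ?_, by rw [heval, h0]⟩
  refine (hasDerivAt_affinePart_snd P x y).unique ?_
  have hzero : (fun y => affinePart P x y) = fun _ => 0 := by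
    ext z
    rw [← heval, hz, map_zero]
  rw [hzero]
  exact hasDerivAt_const y 0

theorem affinePoly_ne_zero {F : MvPolynomial (Fin 3) ℤ} {x y : ℝ}
    (h2 : affinePart (pderiv 2 F) x y ≠ 0) : affinePoly F ≠ 0 := by
  intro h0
  refine h2 ((hasDerivAt_affinePart_snd F x y).unique ?_)
  have hzero : (fun y => affinePart F x y) = fun _ => 0 := by
    ext z
    rw [← evalPair_affinePoly, h0, map_zero]
  rw [hzero]
  exact hasDerivAt_const y 0

namespace IsBranch

variable {F : MvPolynomial (Fin 3) ℤ} {f : ℝ → ℝ} {x₀ : ℝ} {k : ℕ}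

theorem isAlgebraic_of_flex (hns : Smooth F) (hk : 2 ≤ k) (hF : F.IsHomogeneous k)
    (h : IsBranch F f x₀) (hflex : deriv (deriv f) x₀ = 0) :
    IsAlgebraic ℤ x₀ ∧ IsAlgebraic ℤ (f x₀) ∧ IsAlgebraic ℤ (deriv f x₀) := by
  have hx : IsAlgebraic ℤ x₀ := by
    refine isAlgebraic_of_evalPair_eq_zero h.analyticAt (G := affinePoly F)
      (W := affinePoly (inflectionForm F)) (affinePoly_ne_zero h.pderiv_ne_zero) ?_ ?_ ?_
    · rw [mem_germIdeal]
      simpa only [evalPair_affinePoly] using h.eventually_eq_zero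
    · rw [mem_germIdeal]
      intro hW
      refine h.not_eventually_deriv_deriv_eq_zero hns hk hF ?_
      filter_upwards [hW, h.eventually] with x hx hb
      rw [evalPair_affinePoly, hb.affinePart_inflectionForm, neg_mul, neg_eq_zero] at hx
      exact (mul_eq_zero.1 hx).resolve_right (pow_ne_zero 3 hb.pderiv_ne_zero)
    · rw [evalPair_affinePoly, h.affinePart_inflectionForm, hflex, neg_zero, zero_mul]
  have hy := isAlgebraic_of_affinePart_eq_zero hx h.eq_zero h.pderiv_ne_zero
  refine ⟨hx, hy, ?_⟩
  have hθ : deriv f x₀ =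
      -affinePart (pderiv 1 F) x₀ (f x₀) * (affinePart (pderiv 2 F) x₀ (f x₀))⁻¹ := by
    rw [eq_mul_inv_iff_mul_eq₀ h.pderiv_ne_zero]
    linarith [h.deriv_eq]
  rw [hθ]
  exact (isAlgebraic_affinePart hx hy _).neg.mul (isAlgebraic_affinePart hx hy _).inv

end IsBranch

end Algebraic

section Assembly

/-- The real vector underlying an integer vector. -/
def castVec (v : Fin 3 → ℤ) : Fin 3 → ℝ := fun i => (v i : ℝ)

theorem norm_castVec (v : Fin 3 → ℤ) :
    ‖castVec v‖ = max |(v 0 : ℝ)| (max |(v 1 : ℝ)| |(v 2 : ℝ)|) := by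
  refine le_antisymm ((pi_norm_le_iff_of_nonneg (by positivity)).2 fun i => ?_) ?_
  · rw [Real.norm_eq_abs]
    fin_cases i <;> simp [castVec]
  · have h := norm_le_pi_norm (castVec v)
    exact max_le (h 0) (max_le (h 1) (h 2))

theorem gcd_eq_one_iff (v : Fin 3 → ℤ) :
    Int.gcd (v 0) (Int.gcd (v 1) (v 2)) = 1 ↔ ∀ d : ℤ, (∀ i, d ∣ v i) → IsUnit d := by
  constructor
  · intro h d hd
    have h1 : d ∣ (Int.gcd (v 0) (Int.gcd (v 1) (v 2)) : ℤ) :=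
      Int.dvd_coe_gcd (hd 0) (Int.dvd_coe_gcd (hd 1) (hd 2))
    rw [h] at h1
    exact isUnit_of_dvd_one (by simpa using h1)
  · intro h
    have h1 : IsUnit (Int.gcd (v 0) (Int.gcd (v 1) (v 2)) : ℤ) := by
      refine h _ fun i => ?_
      have h12 := Int.gcd_dvd_right (v 0) (Int.gcd (v 1) (v 2))
      fin_cases i
      · exact Int.gcd_dvd_left _ _
      · exact h12.trans (Int.gcd_dvd_left _ _)
      · exact h12.trans (Int.gcd_dvd_right _ _)
    simpa [Int.isUnit_iff_natAbs_eq] using h1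

theorem aeval_castVec (F : MvPolynomial (Fin 3) ℤ) (v : Fin 3 → ℤ) :
    aeval (castVec v) F = ((eval v F : ℤ) : ℝ) := by
  have h := comp_aeval_apply v (Int.castRingHom ℝ).toIntAlgHom F
  exact h.symm

theorem counted_iff {F : MvPolynomial (Fin 3) ℤ} {γ B : ℝ} {v : Fin 3 → ℤ} :
    Counted F γ B v ↔ Int.gcd (v 0) (Int.gcd (v 1) (v 2)) = 1 ∧ |aeval (castVec v) F| ≤ B ^ γ ∧
      B / 2 < ‖castVec v‖ ∧ ‖castVec v‖ ≤ B := by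
  rw [Counted, norm_castVec, aeval_castVec, Int.cast_abs]

/-- The radial projection of an integer vector to the unit sphere of the sup norm. -/
noncomputable def direction (v : Fin 3 → ℤ) : Fin 3 → ℝ := ‖castVec v‖⁻¹ • castVec v

theorem Sparse.of_injective {α β : Type*} {P : ℝ → α → Prop} {Q : ℝ → β → Prop} (hQ : Sparse Q)
    {g : α → β} (hg : Function.Injective g) (h : ∀ B v, P B v → Q B (g v)) : Sparse P := by
  intro ε hε
  filter_upwards [hQ ε hε] with B hB S hS
  rw [← S.card_map ⟨g, hg⟩]
  refine hB _ fun w hw => ?_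
  obtain ⟨v, hv, rfl⟩ := Finset.mem_map.1 hw
  exact h B v (hS v hv)

/-- The points to be counted with direction close to `p` are sparse. -/
def LocallySparse (F : MvPolynomial (Fin 3) ℤ) (γ : ℝ) (p : Fin 3 → ℝ) : Prop :=
  ∃ U ∈ nhds p, Sparse fun B v => (Counted F γ B v ∧ ¬ OnInflTangent F v) ∧ direction v ∈ U

theorem OnInflTangent.of_neg {F : MvPolynomial (Fin 3) ℤ} {v : Fin 3 → ℤ}
    (h : OnInflTangent F (-v)) : OnInflTangent F v := by
  obtain ⟨p, w, hpw, hv⟩ := h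
  refine ⟨p, w, hpw, ?_⟩
  rw [← neg_mem_iff]
  convert hv using 1
  ext i
  simp

theorem castVec_neg (v : Fin 3 → ℤ) : castVec (-v) = -castVec v := by
  ext i
  simp [castVec]

theorem aeval_smul_of_isHomogeneous {F : MvPolynomial (Fin 3) ℤ} {k : ℕ} (hF : F.IsHomogeneous k)
    (r : ℝ) (x : Fin 3 → ℝ) : aeval (r • x) F = r ^ k * aeval x F :=
  aeval_mul_of_isHomogeneous hF r x

theorem LocallySparse.of_neg {F : MvPolynomial (Fin 3) ℤ} {k : ℕ} (hF : F.IsHomogeneous k) {γ : ℝ}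
    {p : Fin 3 → ℝ} (h : LocallySparse F γ (-p)) : LocallySparse F γ p := by
  obtain ⟨U, hU, hs⟩ := h
  refine ⟨Neg.neg ⁻¹' U, continuous_neg.continuousAt hU, hs.of_injective neg_injective ?_⟩
  rintro B v ⟨⟨hc, hn⟩, hd⟩
  refine ⟨⟨?_, fun h => hn h.of_neg⟩, ?_⟩
  · rw [counted_iff] at hc ⊢
    rw [gcd_eq_one_iff] at hc ⊢
    rw [castVec_neg, norm_neg, ← neg_one_smul ℝ (castVec v), aeval_smul_of_isHomogeneous hF,
      abs_mul, abs_pow, abs_neg, abs_one, one_pow, one_mul]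
    simpa using hc
  · simpa [direction, castVec_neg] using hd

theorem OnInflTangent.of_rename {F : MvPolynomial (Fin 3) ℤ} {v : Fin 3 → ℤ}
    (σ : Equiv.Perm (Fin 3)) (h : OnInflTangent (rename σ.symm F) (v ∘ σ)) :
    OnInflTangent F v := by
  obtain ⟨p, w, ⟨h1, h2, h3, h4, h5⟩, hv⟩ := h
  refine ⟨p ∘ σ.symm, w ∘ σ.symm, ⟨fun h => h1 ?_, by rwa [aeval_rename] at h2, fun c hc => h3 c ?_,
    ?_, ?_⟩, ?_⟩
  · ext i
    simpa using congrFun h (σ i)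
  · ext i
    simpa using congrFun hc (σ i)
  · rw [← h4, ← Equiv.sum_comp σ]
    refine Finset.sum_congr rfl fun i _ => ?_
    have h6 := pderiv_rename σ.symm.injective (σ i) F
    rw [Equiv.symm_apply_apply] at h6
    rw [h6, aeval_rename]
    simp
  · rwa [contactOrder, aeval_rename] at h5
  · rw [Submodule.mem_span_pair] at hv ⊢
    obtain ⟨a, b, hab⟩ := hv
    refine ⟨a, b, ?_⟩
    ext i
    simpa using congrFun hab (σ.symm i)

theorem norm_comp_perm (σ : Equiv.Perm (Fin 3)) (x : Fin 3 → ℝ) : ‖x ∘ σ‖ = ‖x‖ := by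
  refine le_antisymm ((pi_norm_le_iff_of_nonneg (norm_nonneg _)).2 fun i => norm_le_pi_norm x _)
    ((pi_norm_le_iff_of_nonneg (norm_nonneg _)).2 fun i => ?_)
  simpa using norm_le_pi_norm (x ∘ σ) (σ.symm i)

theorem LocallySparse.of_rename {F : MvPolynomial (Fin 3) ℤ} {γ : ℝ} {p : Fin 3 → ℝ}
    (σ : Equiv.Perm (Fin 3)) (h : LocallySparse (rename σ.symm F) γ (p ∘ σ)) :
    LocallySparse F γ p := by
  obtain ⟨U, hU, hs⟩ := h
  have hcont : Continuous fun q : Fin 3 → ℝ => q ∘ σ :=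
    continuous_pi fun i => continuous_apply (σ i)
  refine ⟨(· ∘ σ) ⁻¹' U, hcont.continuousAt hU,
    hs.of_injective (g := fun v => v ∘ σ) σ.surjective.injective_comp_right ?_⟩
  have hcast : ∀ v : Fin 3 → ℤ, castVec (v ∘ σ) = castVec v ∘ σ := fun v => rfl
  rintro B v ⟨⟨hc, hn⟩, hd⟩
  refine ⟨⟨?_, fun h => hn (h.of_rename σ)⟩, ?_⟩
  · rw [counted_iff] at hc ⊢
    rw [gcd_eq_one_iff] at hc ⊢
    rw [hcast, norm_comp_perm, aeval_rename]
    refine ⟨fun d hd => hc.1 d fun i => by simpa using hd (σ.symm i), ?_⟩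
    convert hc.2 using 4
    ext i
    simp
  · rw [direction, hcast, norm_comp_perm]
    exact hd

theorem Smooth.rename {F : MvPolynomial (Fin 3) ℤ} (hns : Smooth F) (σ : Equiv.Perm (Fin 3)) :
    Smooth (rename σ F) := by
  intro x hx
  obtain ⟨i, hi⟩ := hns (x ∘ σ) fun h => hx (by
    ext i
    simpa using congrFun h (σ.symm i))
  exact ⟨σ i, by rwa [pderiv_rename σ.injective, aeval_rename]⟩

theorem Smooth.exists_pderiv_ne_zero {F : MvPolynomial (Fin 3) ℤ} (hns : Smooth F) {p : Fin 3 → ℝ}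
    (hp : p ≠ 0) : ∃ i, aeval p (pderiv i F) ≠ 0 := by
  obtain ⟨i, hi⟩ := hns (fun i => (p i : ℂ)) fun h => hp (by
    ext i
    simpa using congrFun h i)
  rw [aeval_ofReal_comp] at hi
  exact ⟨i, by simpa using hi⟩

theorem direction_of_pos {v : Fin 3 → ℤ} (hv : 0 < ‖castVec v‖) :
    castVec v = ‖castVec v‖ • direction v := by
  rw [direction, smul_inv_smul₀ hv.ne']

theorem locallySparse_of_ne_zero {F : MvPolynomial (Fin 3) ℤ} {k : ℕ} (hF : F.IsHomogeneous k)
    {γ : ℝ} (hγ : γ < k) {p : Fin 3 → ℝ} (hp : aeval p F ≠ 0) : LocallySparse F γ p := by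
  have hcont : Continuous fun q : Fin 3 → ℝ => |aeval q F| := by
    have h : (fun q : Fin 3 → ℝ => |aeval q F|) =
        fun q => |eval q (map (Int.castRingHom ℝ) F)| := by
      ext q
      rw [eval_map, aeval_def]
      rfl
    rw [h]
    exact (continuous_eval _).abs
  have hpos : |aeval p F| / 2 < |aeval p F| := half_lt_self (abs_pos.2 hp)
  refine ⟨{q | |aeval p F| / 2 < |aeval q F|}, hcont.continuousAt.eventually_const_lt hpos, ?_⟩
  refine sparse_false.mono ?_
  have hlim := (tendsto_rpow_neg_atTop (sub_pos.2 hγ)).eventually_lt_const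
    (show 0 < |aeval p F| / 2 / 2 ^ k by positivity)
  filter_upwards [hlim, Filter.eventually_gt_atTop 0] with B hB hB0
  rintro v ⟨⟨hc, -⟩, hd⟩
  rw [counted_iff] at hc
  have hpos : 0 < ‖castVec v‖ := (half_pos hB0).trans hc.2.2.1
  have h1 := hc.2.1
  rw [direction_of_pos hpos, aeval_smul_of_isHomogeneous hF, abs_mul, abs_pow, abs_norm] at h1
  have h2 : (B / 2) ^ k * (|aeval p F| / 2) ≤ B ^ γ := by
    refine le_trans ?_ h1
    gcongr
    · exact hc.2.2.1.le
  rw [neg_sub, Real.rpow_sub hB0, Real.rpow_natCast, div_lt_iff₀ (by positivity)] at hB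
  rw [div_pow] at h2
  have h3 : B ^ k / 2 ^ k * (|aeval p F| / 2) = |aeval p F| / 2 / 2 ^ k * B ^ k := by ring
  linarith

end Assembly

section Chart

theorem IsBranch.exists_sparse {F : MvPolynomial (Fin 3) ℤ} {k : ℕ} {f : ℝ → ℝ} {x₀ : ℝ}
    (hns : Smooth F) (hk : 3 ≤ k) (hF : F.IsHomogeneous k) (h : IsBranch F f x₀) {C : ℝ}
    (hC : 0 ≤ C)
    (hup : ∀ᶠ p in nhds (x₀, f x₀), |affinePart F p.1 p.2| ≤ C * |p.2 - f p.1|)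
    {c C' τ : ℝ} (hc : 0 < c) (hC' : 0 ≤ C') (hτ : 4 < τ) (hτ5 : τ ≤ 5) :
    ∃ η > 0, Sparse (fun B v => (NearCurve f c (C' * B ^ (-τ)) B v ∧ ¬ OnInflTangent F v) ∧
      absc v ∈ Set.Icc (x₀ - η) (x₀ + η)) := by
  have hk2 : 2 ≤ k := by omega
  have hcon : ∀ q : Fin 6 → ℤ, q ≠ 0 →
      ¬ ∀ᶠ x in nhds x₀, conic (fun i => (q i : ℝ)) x (f x) = 0 :=
    fun q hq => h.not_eventually_conic hns hk hF hq
  by_cases hflex : deriv (deriv f) x₀ = 0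
  · obtain ⟨hx, hy, hθ⟩ := h.isAlgebraic_of_flex hns hk2 hF hflex
    have htan := h.isInflTangent hns hk2 hF hC hup hflex
    obtain ⟨η, hη, hs⟩ := sparse_nearCurve_of_flex (μ₀ := f x₀ - deriv f x₀ * x₀) h.analyticAt
      (h.not_eventually_deriv_deriv_eq_zero hns hk2 hF) hcon hθ (hy.sub (hθ.mul hx)) (by ring)
      hC' hc hτ hτ5
    refine ⟨η, hη, hs.mono ?_⟩
    filter_upwards [Filter.eventually_gt_atTop 0] with B hB v ⟨⟨hv, hn⟩, hI⟩
    exact ⟨⟨hv, fun hl => hn (onInflTangent_of_ordi_eq htan (hv.pos hc hB).ne' hl)⟩, hI⟩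
  · obtain ⟨η, hη, hs⟩ := sparse_nearCurve_of_deriv_deriv_ne_zero h.analyticAt hflex hcon
      hC' hc hτ hτ5
    exact ⟨η, hη, hs.mono (.of_forall fun B v hv => ⟨hv.1.1, hv.2⟩)⟩

theorem aeval_eq_pow_mul_affinePart {F : MvPolynomial (Fin 3) ℤ} {k : ℕ} (hF : F.IsHomogeneous k)
    {p : Fin 3 → ℝ} (hp : p 0 ≠ 0) :
    aeval p F = p 0 ^ k * affinePart F (p 1 / p 0) (p 2 / p 0) := by
  rw [affinePart, ← aeval_smul_of_isHomogeneous hF]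
  congr 2
  ext i
  fin_cases i
  · simp
  · simp [mul_div_cancel₀, hp]
  · simp [mul_div_cancel₀, hp]

theorem direction_div_direction {v : Fin 3 → ℤ} (hv : 0 < ‖castVec v‖) (i : Fin 3) :
    direction v i / direction v 0 = (v i : ℝ) / v 0 := by
  simp only [direction, Pi.smul_apply, smul_eq_mul, castVec]
  exact mul_div_mul_left _ _ (inv_ne_zero hv.ne')

theorem locallySparse_of_chart {F : MvPolynomial (Fin 3) ℤ} {k : ℕ} (hns : Smooth F) (hk : 3 ≤ k)
    (hF : F.IsHomogeneous k) {γ : ℝ} (hγ : γ < k - 4) {p : Fin 3 → ℝ} (hp0 : 0 < p 0)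
    (hp : aeval p F = 0) (hp2 : aeval p (pderiv 2 F) ≠ 0) : LocallySparse F γ p := by
  set τ : ℝ := min (k - γ) 5 with hτ
  have hτ4 : 4 < τ := lt_min (by linarith) (by norm_num)
  set φ : (Fin 3 → ℝ) → ℝ × ℝ := fun q => (q 1 / q 0, q 2 / q 0) with hφ
  rw [aeval_eq_pow_mul_affinePart hF hp0.ne'] at hp
  rw [aeval_eq_pow_mul_affinePart hF.pderiv hp0.ne'] at hp2
  obtain ⟨f, hf, hfx, C, hC, hnear⟩ := exists_isBranch
    ((mul_eq_zero.1 hp).resolve_left (pow_ne_zero k hp0.ne')) (right_ne_zero_of_mul hp2)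
  set c : ℝ := p 0 / 4 with hc
  have hc0 : 0 < c := by positivity
  obtain ⟨η, hη, hs⟩ := hf.exists_sparse hns hk hF hC.le
    (by rw [hfx]; exact hnear.mono fun q hq => hq.2) (C' := C * (c ^ k)⁻¹) hc0 (by positivity)
    hτ4 (min_le_right _ _)
  have hcont : ContinuousAt φ p :=
    ((continuous_apply 1).continuousAt.div (continuous_apply 0).continuousAt hp0.ne').prodMk
      ((continuous_apply 2).continuousAt.div (continuous_apply 0).continuousAt hp0.ne')
  have hU0 : ∀ᶠ q : Fin 3 → ℝ in nhds p, p 0 / 2 < q 0 :=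
    (continuous_apply 0).continuousAt.eventually_const_lt (half_lt_self hp0)
  have hU1 : ∀ᶠ q in nhds p, |(φ q).2 - f (φ q).1| ≤ C * |affinePart F (φ q).1 (φ q).2| :=
    hcont.eventually (hnear.mono fun q hq => hq.1)
  have hU2 : ∀ᶠ q in nhds p, (φ q).1 ∈ Set.Icc (p 1 / p 0 - η) (p 1 / p 0 + η) :=
    (continuous_fst.continuousAt.comp hcont).eventually
      (Icc_mem_nhds (by simp [hφ, hη]) (by simp [hφ, hη]))
  refine ⟨_, hU0.and (hU1.and hU2), hs.mono ?_⟩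
  filter_upwards [Filter.eventually_ge_atTop 1] with B hB v ⟨⟨hv, hn⟩, hd0, hd1, hd2⟩
  have hB0 : 0 < B := by linarith
  rw [counted_iff] at hv
  obtain ⟨hprim, hsmall, hlo, hhi⟩ := hv
  have hpos : 0 < ‖castVec v‖ := (half_pos hB0).trans hlo
  have hφv : φ (direction v) = (absc v, ordi v) := by
    rw [hφ]
    exact Prod.ext (direction_div_direction hpos 1) (direction_div_direction hpos 2)
  rw [hφv] at hd1 hd2
  have hv0 : c * B ≤ v 0 := by
    have h0 : (v 0 : ℝ) = ‖castVec v‖ * direction v 0 := congrFun (direction_of_pos hpos) 0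
    rw [h0, show c * B = B / 2 * (p 0 / 2) by rw [hc]; ring]
    gcongr
  have hv0' : 0 < (v 0 : ℝ) := lt_of_lt_of_le (by positivity) hv0
  refine ⟨⟨⟨hprim, fun i => (norm_le_pi_norm (castVec v) i).trans hhi, hv0, hd1.trans ?_⟩, hn⟩, hd2⟩
  rw [aeval_eq_pow_mul_affinePart hF (p := castVec v) hv0'.ne', abs_mul, abs_pow] at hsmall
  change |(v 0 : ℝ)| ^ k * |affinePart F (absc v) (ordi v)| ≤ B ^ γ at hsmall
  rw [abs_of_pos hv0'] at hsmall
  have h1 : (c * B) ^ k * |affinePart F (absc v) (ordi v)| ≤ B ^ γ := by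
    refine le_trans ?_ hsmall
    gcongr
  have h2 : B ^ (γ - k) ≤ B ^ (-τ) :=
    Real.rpow_le_rpow_of_exponent_le hB (by linarith [min_le_left ((k : ℝ) - γ) 5])
  rw [Real.rpow_sub hB0, Real.rpow_natCast] at h2
  rw [mul_assoc]
  gcongr
  rw [mul_pow, mul_comm, ← le_div_iff₀ (by positivity)] at h1
  refine h1.trans ?_
  rw [show B ^ γ / (c ^ k * B ^ k) = (c ^ k)⁻¹ * (B ^ γ / B ^ k) by ring]
  gcongr

theorem locallySparse {F : MvPolynomial (Fin 3) ℤ} {k : ℕ} (hns : Smooth F) (hk : 3 ≤ k)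
    (hF : F.IsHomogeneous k) {γ : ℝ} (hγ : γ < k - 4) {p : Fin 3 → ℝ} (hp : p ≠ 0) :
    LocallySparse F γ p := by
  by_cases h0 : aeval p F = 0
  swap
  · exact locallySparse_of_ne_zero hF (by linarith) h0
  obtain ⟨j, hj⟩ := hns.exists_pderiv_ne_zero hp
  obtain ⟨i, hij, hi⟩ : ∃ i, i ≠ j ∧ p i ≠ 0 := by
    by_contra! hall
    have hsum := sum_mul_aeval_pderiv hF p
    rw [h0, mul_zero, Finset.sum_eq_single j (fun i _ hij => by rw [hall i hij, zero_mul])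
      (by simp)] at hsum
    have hpj := (mul_eq_zero.1 hsum).resolve_right hj
    refine hp (funext fun i => ?_)
    by_cases hij : i = j
    · rw [hij, hpj, Pi.zero_apply]
    · exact hall i hij
  obtain ⟨σ, hσ0, hσ2⟩ : ∃ σ : Equiv.Perm (Fin 3), σ 0 = i ∧ σ 2 = j := by
    clear hj hi
    revert i j
    decide
  have hpos : ∀ q : Fin 3 → ℝ, aeval q F = 0 → aeval q (pderiv j F) ≠ 0 → 0 < q i →
      LocallySparse F γ q := by
    intro q hq0 hqj hqi
    have hcomp : (q ∘ σ) ∘ σ.symm = q := by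
      ext l
      simp
    refine LocallySparse.of_rename σ (locallySparse_of_chart (hns.rename σ.symm) hk
      hF.rename_isHomogeneous hγ ?_ ?_ ?_)
    · simpa [hσ0] using hqi
    · rwa [aeval_rename, hcomp]
    · rwa [show (2 : Fin 3) = σ.symm j by rw [← hσ2, Equiv.symm_apply_apply],
        pderiv_rename σ.symm.injective, aeval_rename, hcomp]
  rcases hi.lt_or_gt with hi | hi
  · refine LocallySparse.of_neg hF (hpos (-p) ?_ ?_ (by simpa using hi))
    · rw [← neg_one_smul ℝ p, aeval_smul_of_isHomogeneous hF, h0, mul_zero]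
    · rw [← neg_one_smul ℝ p, aeval_smul_of_isHomogeneous hF.pderiv]
      exact mul_ne_zero (pow_ne_zero _ (by norm_num)) hj
  · exact hpos p h0 hj hi

theorem sparse_counted {F : MvPolynomial (Fin 3) ℤ} {k : ℕ} (hns : Smooth F) (hk : 3 ≤ k)
    (hF : F.IsHomogeneous k) {γ : ℝ} (hγ : γ < k - 4) :
    Sparse fun B v => Counted F γ B v ∧ ¬ OnInflTangent F v := by
  refine (sparse_of_isCompact (isCompact_sphere (0 : Fin 3 → ℝ) 1) direction _
    fun p hp => locallySparse hns hk hF hγ ?_).mono ?_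
  · rintro rfl
    simp at hp
  · filter_upwards [Filter.eventually_gt_atTop 0] with B hB v hv
    refine ⟨hv, ?_⟩
    have hpos : 0 < ‖castVec v‖ := (half_pos hB).trans (counted_iff.1 hv.1).2.2.1
    rw [mem_sphere_zero_iff_norm, direction, norm_smul, norm_inv, norm_norm,
      inv_mul_cancel₀ hpos.ne']

theorem Sparse.isLittleO_ncard {α : Type*} {P : ℝ → α → Prop} (h : Sparse P) :
    (fun B : ℝ => (Set.ncard {v | P B v} : ℝ)) =o[Filter.atTop] fun B : ℝ => B := by
  rw [Asymptotics.isLittleO_iff]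
  intro ε hε
  filter_upwards [h ε hε, Filter.eventually_ge_atTop 0] with B hB hB0
  rw [Real.norm_of_nonneg (Nat.cast_nonneg _), Real.norm_of_nonneg hB0]
  rcases Set.finite_or_infinite {v | P B v} with hfin | hinf
  · rw [Set.ncard_eq_toFinset_card _ hfin]
    exact hB _ fun v hv => hfin.mem_toFinset.1 hv
  · rw [hinf.ncard, Nat.cast_zero]
    positivity

end Chart

open Asymptotics Filter in
theorem statement1 (F : MvPolynomial (Fin 3) ℤ) (k : ℕ) (hk : 5 ≤ k)
    (hhom : F.IsHomogeneous k)
    (hns : ∀ x : Fin 3 → ℂ, x ≠ 0 → ∃ i, MvPolynomial.aeval x (MvPolynomial.pderiv i F) ≠ 0)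
    (γ : ℝ) (hγ0 : 0 ≤ γ) (hγk : γ ≤ (k : ℝ) - 2)
    (τ : ℝ) (hτ : τ = (k : ℝ) - γ)
    (hcase : (k ≤ 9 ∧ (9 : ℝ) / 2 < τ) ∨ (9 < k ∧ (3 : ℝ) / 2 * Real.sqrt k < τ)) :
    (fun B : ℝ => (Set.ncard {x : Fin 3 → ℤ | Counted F γ B x ∧ ¬ OnInflTangent F x} : ℝ))
      =o[atTop] (fun B : ℝ => B) := by
  have hτ4 : 4 < τ := by
    rcases hcase with ⟨-, h⟩ | ⟨h9, h⟩
    · linarith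
    · have hsqrt : 3 ≤ Real.sqrt k := by
        refine Real.le_sqrt_of_sq_le ?_
        have : (9 : ℝ) ≤ k := by exact_mod_cast h9.le
        linarith
      linarith
  exact (sparse_counted hns (by omega) hhom (by linarith)).isLittleO_ncard
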